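/- arXiv:1310.7352 — 5 statements merged into one kernel-verified Lean document; each statement's English description precedes it below -/
import Mathlib

section
/- Let (E_n) be a sequence of finite-dimensional Banach spaces, E = (⊕_n E_n)_{ℓ¹}, and T ∈ L(E). Let ε > 0. Suppose there exists an isomorphic embedding θ : E → ℓ∞ such that sup_n Fac^ε_{ℓ¹}(θ T J_n) < ∞. Then the operator-norm distance from θT to G_{ℓ¹}(E, ℓ∞) is at most ε. -/
open Filter Topology
open scoped ENNReal

noncomputable section

instance : Fact ((1:ℝ≥0∞) ≤ 1) := ⟨le_rfl⟩
instance : Fact ((1:ℝ≥0∞) ≤ ⊤) := ⟨le_top⟩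

/-- `ℓ¹`, the space of absolutely summable real sequences. -/
abbrev ellOne : Type := lp (fun _ : ℕ => ℝ) 1

/-- `ℓ∞`, the space of bounded real sequences. -/
abbrev ellInfty : Type := lp (fun _ : ℕ => ℝ) ⊤

/-- `Fac^ε_Z(T) = inf {‖R‖·‖S‖ : ‖T - S ∘ R‖ ≤ ε}`, valued in `ℝ≥0∞` (the infimum of the
empty set being `∞`). -/
def Fac (Z : Type*) [NormedAddCommGroup Z] [NormedSpace ℝ Z]
    {X Y : Type*} [NormedAddCommGroup X] [NormedSpace ℝ X]
    [NormedAddCommGroup Y] [NormedSpace ℝ Y] (ε : ℝ) (T : X →L[ℝ] Y) : ℝ≥0∞ :=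
  sInf {c : ℝ≥0∞ | ∃ (R : X →L[ℝ] Z) (S : Z →L[ℝ] Y),
    ‖T - S.comp R‖ ≤ ε ∧ c = ENNReal.ofReal (‖R‖ * ‖S‖)}

/-- A uniformly bounded family of operators on the summands extends to the `ℓ¹`-direct sum. -/
theorem exists_clm_hasSum_of_lp_one {ι : Type*} {F : ι → Type*}
    [∀ i, NormedAddCommGroup (F i)] [∀ i, NormedSpace ℝ (F i)]
    {G : Type*} [NormedAddCommGroup G] [NormedSpace ℝ G] [CompleteSpace G]
    (f : ∀ i, F i →L[ℝ] G) (C : ℝ) (hC : 0 ≤ C) (hf : ∀ i, ‖f i‖ ≤ C) :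
    ∃ g : lp F 1 →L[ℝ] G, ‖g‖ ≤ C ∧ ∀ x : lp F 1, HasSum (fun i => f i (x i)) (g x) := by
  have hnorm : ∀ x : lp F 1, HasSum (fun i => C * ‖x i‖) (C * ‖x‖) := fun x => by
    have h := lp.hasSum_norm (p := 1) (by simp) x
    simp only [ENNReal.toReal_one, Real.rpow_one] at h
    exact h.mul_left C
  have hle : ∀ (x : lp F 1) i, ‖f i (x i)‖ ≤ C * ‖x i‖ := fun x i =>
    (f i).le_of_opNorm_le (hf i) _
  have hs : ∀ x : lp F 1, Summable (fun i => f i (x i)) := fun x =>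
    Summable.of_norm_bounded (hnorm x).summable (hle x)
  let g₀ : lp F 1 →ₗ[ℝ] G :=
    { toFun := fun x => ∑' i, f i (x i)
      map_add' := fun x y => by
        simp only [lp.coeFn_add, Pi.add_apply, map_add]
        exact (hs x).tsum_add (hs y)
      map_smul' := fun c x => by
        simp only [lp.coeFn_smul, Pi.smul_apply, map_smul, RingHom.id_apply]
        exact (hs x).tsum_const_smul c }
  refine ⟨g₀.mkContinuous C fun x => tsum_of_norm_bounded (hnorm x) (hle x),
    g₀.mkContinuous_norm_le hC _, fun x => (hs x).hasSum⟩

/-- A uniformly bounded family of factorizations through `ℓ¹`, defined on the summands of an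
`ℓ¹`-direct sum, glues to a single factorization through `ℓ¹`. -/
theorem exists_factorization_ellOne {F : ℕ → Type*}
    [∀ n, NormedAddCommGroup (F n)] [∀ n, NormedSpace ℝ (F n)]
    {G : Type*} [NormedAddCommGroup G] [NormedSpace ℝ G] [CompleteSpace G]
    (R : ∀ n, F n →L[ℝ] ellOne) (S : ∀ _ : ℕ, ellOne →L[ℝ] G) (K : ℝ) (hK : 0 ≤ K)
    (hR : ∀ n, ‖R n‖ ≤ 1) (hS : ∀ n, ‖S n‖ ≤ K) :
    ∃ (R' : lp F 1 →L[ℝ] ellOne) (S' : ellOne →L[ℝ] G),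
      ∀ x : lp F 1, HasSum (fun n => S n (R n (x n))) (S' (R' x)) := by
  let e : ℕ → ellOne := fun m => lp.single 1 m (1 : ℝ)
  have he : ∀ m, ‖e m‖ = 1 := fun m => by simp [e, lp.norm_single]
  have hsum : ∀ y : ellOne, HasSum (fun m => y m • e m) y := fun y => by
    have h := lp.hasSum_single (p := 1) (by simp) y
    convert h using 2 with m
    simp [e, ← lp.single_smul]
  have hι : ∀ n : ℕ, ∃ g : ellOne →L[ℝ] ellOne, ‖g‖ ≤ 1 ∧
      ∀ y : ellOne, HasSum (fun m => y m • e (Nat.pair n m)) (g y) := fun n => by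
    simpa using exists_clm_hasSum_of_lp_one (F := fun _ : ℕ => ℝ)
      (fun m => ContinuousLinearMap.toSpanSingleton ℝ (e (Nat.pair n m))) 1 zero_le_one
      (fun m => by simp [he])
  choose ι hι₁ hι₂ using hι
  obtain ⟨R', -, hR'⟩ := exists_clm_hasSum_of_lp_one (fun n => (ι n).comp (R n)) 1 zero_le_one
    (fun n => ((ι n).opNorm_comp_le (R n)).trans
      (mul_le_one₀ (hι₁ n) (norm_nonneg _) (hR n)))
  obtain ⟨S', -, hS'⟩ := exists_clm_hasSum_of_lp_one (F := fun _ : ℕ => ℝ)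
    (fun k => ContinuousLinearMap.toSpanSingleton ℝ (S k.unpair.1 (e k.unpair.2))) K hK
    (fun k => by
      simpa [he] using (S k.unpair.1).le_of_opNorm_le (hS k.unpair.1) (e k.unpair.2))
  have hSe : ∀ k, S' (e k) = S k.unpair.1 (e k.unpair.2) := fun k => by
    refine (hS' (e k)).unique ?_
    convert hasSum_single k ?_ using 1
    · simp [e]
    · intro j hj
      simp [e, hj]
  have hSι : ∀ n y, S' (ι n y) = S n y := fun n y => by
    refine (S'.hasSum (hι₂ n y)).unique ?_
    convert (S n).hasSum (hsum y) using 2 with m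
    simp [hSe]
  refine ⟨R', S', fun x => ?_⟩
  simpa [hSι] using S'.hasSum (hR' x)

/-- An approximate factorization with finite `Fac` constant below `K` can be normalized so that
the first factor is a contraction. -/
theorem exists_normalized_of_Fac_lt {Z X Y : Type*} [NormedAddCommGroup Z] [NormedSpace ℝ Z]
    [NormedAddCommGroup X] [NormedSpace ℝ X] [NormedAddCommGroup Y] [NormedSpace ℝ Y]
    {ε K : ℝ} {T : X →L[ℝ] Y} (hK : 0 ≤ K) (h : Fac Z ε T < ENNReal.ofReal K) :
    ∃ (R : X →L[ℝ] Z) (S : Z →L[ℝ] Y), ‖T - S.comp R‖ ≤ ε ∧ ‖R‖ ≤ 1 ∧ ‖S‖ ≤ K := by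
  obtain ⟨c, ⟨R, S, hRS, rfl⟩, hc⟩ := sInf_lt_iff.mp h
  have hc' : ‖R‖ * ‖S‖ ≤ K := (ENNReal.ofReal_lt_ofReal_iff'.mp hc).1.le
  rcases eq_or_ne R 0 with rfl | hR
  · exact ⟨0, 0, by simpa using hRS, by simp, by simpa using hK⟩
  · have hR' : ‖R‖ ≠ 0 := norm_ne_zero_iff.mpr hR
    refine ⟨‖R‖⁻¹ • R, ‖R‖ • S, ?_, ?_, ?_⟩
    · simpa [ContinuousLinearMap.comp_smul, ContinuousLinearMap.smul_comp, smul_smul, hR']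
        using hRS
    · simp [norm_smul, hR']
    · simpa [norm_smul] using hc'

/-- Let `(E n)` be finite-dimensional Banach spaces, `E = (⊕ₙ Eₙ)_{ℓ¹}`,
`T ∈ L(E)` and `ε > 0`.  Here `J n : E n → lp E 1` is the natural embedding of the `n`-th
summand (characterized by its coordinates).  If there is an isomorphic embedding
`θ : E → ℓ∞` with `sup_n Fac^ε_{ℓ¹}(θ T Jₙ) < ∞`, then the operator-norm distance from
`θT` to `G_{ℓ¹}(E, ℓ∞)` is at most `ε`. -/
theorem stmt0 (E : ℕ → Type) [∀ n, NormedAddCommGroup (E n)] [∀ n, NormedSpace ℝ (E n)]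
    [∀ n, FiniteDimensional ℝ (E n)]
    (T : lp E 1 →L[ℝ] lp E 1) (ε : ℝ) (hε : 0 < ε)
    (J : ∀ n, E n →L[ℝ] lp E 1)
    (hJ : ∀ n (x : E n), (J n x : ∀ m, E m) n = x ∧ ∀ m, m ≠ n → (J n x : ∀ m, E m) m = 0)
    (θ : lp E 1 →L[ℝ] ellInfty)
    (hθ : ∃ c > (0:ℝ), ∀ x, c * ‖x‖ ≤ ‖θ x‖)
    (hsup : ⨆ n, Fac ellOne ε (θ.comp (T.comp (J n))) < ⊤) :
    Metric.infDist (θ.comp T)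
      {W : lp E 1 →L[ℝ] ellInfty |
        ∃ (R : lp E 1 →L[ℝ] ellOne) (S : ellOne →L[ℝ] ellInfty), W = S.comp R} ≤ ε := by
  set C := ⨆ n, Fac ellOne ε (θ.comp (T.comp (J n))) with hCdef
  have hlt : ∀ n, Fac ellOne ε (θ.comp (T.comp (J n))) < ENNReal.ofReal (C.toReal + 1) :=
    fun n => by
      refine (le_iSup (fun n => Fac ellOne ε (θ.comp (T.comp (J n)))) n).trans_lt ?_
      rw [← hCdef, ENNReal.lt_ofReal_iff_toReal_lt hsup.ne]
      exact lt_add_one _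
  have hK : 0 ≤ C.toReal + 1 := by positivity
  choose R S hRS hR hS using fun n => exists_normalized_of_Fac_lt hK (hlt n)
  obtain ⟨R', S', hfac⟩ := exists_factorization_ellOne R S _ hK hR hS
  have hmem : S'.comp R' ∈ {W : lp E 1 →L[ℝ] ellInfty |
      ∃ (R : lp E 1 →L[ℝ] ellOne) (S : ellOne →L[ℝ] ellInfty), W = S.comp R} := ⟨R', S', rfl⟩
  refine (Metric.infDist_le_dist_of_mem hmem).trans ?_
  rw [dist_eq_norm]
  refine ContinuousLinearMap.opNorm_le_bound _ hε.le fun x => ?_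
  have hJs : ∀ n (y : E n), J n y = lp.single 1 n y := fun n y => by
    ext m
    rcases eq_or_ne m n with rfl | hm
    · simp [(hJ m y).1]
    · simp [(hJ n y).2 m hm, hm]
  have hx : HasSum (fun n => J n (x n)) x := by
    simpa only [hJs] using lp.hasSum_single (p := 1) (by simp) x
  have hn : HasSum (fun n => ε * ‖x n‖) (ε * ‖x‖) := by
    have h := lp.hasSum_norm (p := 1) (by simp) x
    simp only [ENNReal.toReal_one, Real.rpow_one] at h
    exact h.mul_left ε
  have hd : HasSum (fun n => (θ.comp (T.comp (J n)) - (S n).comp (R n)) (x n))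
      ((θ.comp T - S'.comp R') x) := ((θ.comp T).hasSum hx).sub (hfac x)
  rw [← hd.tsum_eq]
  exact tsum_of_norm_bounded hn fun n => ContinuousLinearMap.le_of_opNorm_le _ (hRS n) _
end
end

section
/- Let X be a Banach space containing uniformly isomorphic copies of ℓ∞(k), i.e., there is λ < ∞ such that for every k ∈ ℕ there is a subspace of X that is λ-isomorphic to ℓ∞(k). Then G^i_{ℓ¹}(X) is a proper ideal of L(X); in particular, the identity operator on X does not belong to G^i_{ℓ¹}(X). -/
open Filter Topology
open scoped ENNReal

noncomputable section

/-- `ℓ∞(k)`: `ℝ^k` with the supremum norm. -/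
abbrev ellInftyFin (k : ℕ) : Type := PiLp ⊤ (fun _ : Fin k => ℝ)

/-- `G^i_{ℓ¹}(X)`: the set of `T ∈ L(X)` such that there is an isomorphic embedding
`θ : X → ℓ∞` with `θT` in the operator-norm closure of
`G_{ℓ¹}(X, ℓ∞) = {S ∘ R : R ∈ L(X, ℓ¹), S ∈ L(ℓ¹, ℓ∞)}`. -/
def GiEllOne (X : Type*) [NormedAddCommGroup X] [NormedSpace ℝ X] : Set (X →L[ℝ] X) :=
  {T | ∃ θ : X →L[ℝ] ellInfty, (∃ c > (0:ℝ), ∀ x, c * ‖x‖ ≤ ‖θ x‖) ∧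
    θ.comp T ∈ closure {W : X →L[ℝ] ellInfty |
      ∃ (R : X →L[ℝ] ellOne) (S : ellOne →L[ℝ] ellInfty), W = S.comp R}}

/-- The average of `f (x ± u 0 ± ⋯ ± u (k - 1))` over all choices of signs. -/
def signAverage {E : Type*} [AddCommGroup E] (u : ℕ → E) (f : E → ℝ) : ℕ → E → ℝ
  | 0, x => f x
  | k + 1, x => (signAverage u f k (x + u k) + signAverage u f k (x - u k)) / 2

theorem signAverage_le_of_forall_le {E : Type*} [AddCommGroup E] [Module ℝ E] (u : ℕ → E)
    (f : E → ℝ) (M : ℝ) (k : ℕ) (x : E)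
    (h : ∀ s : ℕ → ℝ, (∀ i, |s i| ≤ 1) → f (x + ∑ i ∈ Finset.range k, s i • u i) ≤ M) :
    signAverage u f k x ≤ M := by
  induction k generalizing x with
  | zero => simpa [signAverage] using h 0 (by simp)
  | succ k ih =>
    have key (e : ℝ) (he : |e| ≤ 1) : signAverage u f k (x + e • u k) ≤ M := by
      refine ih _ fun s hs => ?_
      have := h (Function.update s k e) fun i => by
        rcases eq_or_ne i k with rfl | hi
        · simpa using he
        · simpa [hi] using hs i
      have hsum : ∑ i ∈ Finset.range k, Function.update s k e i • u i =
          ∑ i ∈ Finset.range k, s i • u i :=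
        Finset.sum_congr rfl fun i hi => by
          rw [Function.update_of_ne (Finset.mem_range.1 hi).ne]
      rw [Finset.sum_range_succ, hsum, Function.update_self] at this
      rwa [add_assoc, add_comm (e • u k)]
    have h₁ := key 1 (by simp)
    have h₂ := key (-1) (by simp)
    rw [one_smul] at h₁
    rw [neg_one_smul, ← sub_eq_add_neg] at h₂
    rw [signAverage]
    linarith

theorem mul_sq_sub_mul_pow_four_le_abs {t : ℝ} (ht : 0 ≤ t) (x : ℝ) :
    t * x ^ 2 - 4 / 27 * t ^ 3 * x ^ 4 ≤ |x| := by
  have hy : 0 ≤ t * |x| := by positivity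
  have h : t * |x| - 4 / 27 * (t * |x|) ^ 3 ≤ 1 := by
    nlinarith [mul_nonneg (by linarith : 0 ≤ t * |x| + 3) (sq_nonneg (2 * (t * |x|) - 3))]
  have h₄ : x ^ 4 = |x| ^ 4 := by rw [← abs_pow, abs_of_nonneg (by positivity)]
  calc t * x ^ 2 - 4 / 27 * t ^ 3 * x ^ 4
      = |x| * (t * |x| - 4 / 27 * (t * |x|) ^ 3) := by rw [h₄, ← sq_abs x]; ring
    _ ≤ |x| * 1 := by gcongr
    _ = |x| := mul_one _

theorem moments_le_signAverage_abs {t : ℝ} (ht : 0 ≤ t) (a : ℕ → ℝ) (k : ℕ) (x : ℝ) :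
    t * (x ^ 2 + ∑ i ∈ Finset.range k, a i ^ 2) -
      4 / 27 * t ^ 3 * (x ^ 4 + 6 * x ^ 2 * ∑ i ∈ Finset.range k, a i ^ 2 +
        3 * (∑ i ∈ Finset.range k, a i ^ 2) ^ 2) ≤ signAverage a abs k x := by
  induction k generalizing x with
  | zero => simpa [signAverage] using mul_sq_sub_mul_pow_four_le_abs ht x
  | succ k ih =>
    rw [Finset.sum_range_succ, signAverage]
    have h₁ := ih (x + a k)
    have h₂ := ih (x - a k)
    have h₃ : 0 ≤ t ^ 3 * a k ^ 4 := by positivity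
    linarith

/-- The lower Khinchine inequality in `L¹`. -/
theorem sqrt_sum_sq_le_signAverage_abs (a : ℕ → ℝ) (k : ℕ) :
    5 / 9 * √(∑ i ∈ Finset.range k, a i ^ 2) ≤ signAverage a abs k 0 := by
  set q := √(∑ i ∈ Finset.range k, a i ^ 2) with hq
  have hsum : ∑ i ∈ Finset.range k, a i ^ 2 = q ^ 2 :=
    (Real.sq_sqrt (Finset.sum_nonneg fun i _ => sq_nonneg _)).symm
  have h := moments_le_signAverage_abs (t := q⁻¹) (by positivity) a k 0
  rw [hsum] at h
  refine le_trans (le_of_eq ?_) h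
  rcases eq_or_ne q 0 with h0 | h0
  · simp [h0]
  · field_simp
    ring

theorem sum_abs_le_signAverage_abs (a : ℕ → ℝ) (k : ℕ) :
    ∑ i ∈ Finset.range k, |a i| ≤ 9 / 5 * √k * signAverage a abs k 0 := by
  have h : (∑ i ∈ Finset.range k, |a i|) ≤ √k * √(∑ i ∈ Finset.range k, a i ^ 2) := by
    rw [← Real.sqrt_mul (Nat.cast_nonneg k)]
    refine Real.le_sqrt_of_sq_le ?_
    simpa using sq_sum_le_card_mul_sum_sq (s := Finset.range k) (f := fun i => |a i|)
  have h' := mul_le_mul_of_nonneg_left (sqrt_sum_sq_le_signAverage_abs a k) (Real.sqrt_nonneg k)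
  linarith

theorem hasSum_abs_ellOne (x : ellOne) : HasSum (fun n => |x n|) ‖x‖ := by
  simpa using lp.hasSum_norm (p := 1) (by simp) x

theorem sum_signAverage_abs_le (u : ℕ → ellOne) (F : Finset ℕ) (k : ℕ) (x : ellOne) :
    ∑ n ∈ F, signAverage (fun i => u i n) abs k (x n) ≤ signAverage u norm k x := by
  induction k generalizing x with
  | zero => exact sum_le_hasSum F (fun n _ => abs_nonneg _) (hasSum_abs_ellOne x)
  | succ k ih =>
    simp only [signAverage]
    rw [← Finset.sum_div, Finset.sum_add_distrib]
    have h₁ := ih (x + u k)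
    have h₂ := ih (x - u k)
    simp only [lp.coeFn_add, lp.coeFn_sub, Pi.add_apply, Pi.sub_apply] at h₁ h₂
    linarith

theorem sum_norm_le_signAverage_norm (u : ℕ → ellOne) (k : ℕ) :
    ∑ i ∈ Finset.range k, ‖u i‖ ≤ 9 / 5 * √k * signAverage u norm k 0 := by
  have h : HasSum (fun n => ∑ i ∈ Finset.range k, |u i n|) (∑ i ∈ Finset.range k, ‖u i‖) :=
    hasSum_sum fun i _ => hasSum_abs_ellOne (u i)
  refine hasSum_le_of_sum_le h fun F => ?_
  calc ∑ n ∈ F, ∑ i ∈ Finset.range k, |u i n|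
      ≤ ∑ n ∈ F, 9 / 5 * √k * signAverage (fun i => u i n) abs k 0 :=
        Finset.sum_le_sum fun n _ => sum_abs_le_signAverage_abs (fun i => u i n) k
    _ = 9 / 5 * √k * ∑ n ∈ F, signAverage (fun i => u i n) abs k ((0 : ellOne) n) := by
        rw [← Finset.mul_sum]; rfl
    _ ≤ 9 / 5 * √k * signAverage u norm k 0 := by
        gcongr
        exact sum_signAverage_abs_le u F k 0

theorem lower_bound_mul_le_of_ellInftyFin_ellOne {k : ℕ} (T : ellInftyFin k →L[ℝ] ellOne)
    {d M : ℝ} (hd : 0 ≤ d) (hlow : ∀ v, d * ‖v‖ ≤ ‖T v‖) (hM : ∀ v, ‖v‖ ≤ 1 → ‖T v‖ ≤ M) :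
    k * d ≤ 9 / 5 * √k * M := by
  let e : ℕ → ellInftyFin k := fun i => WithLp.toLp ⊤ fun j => if (j : ℕ) = i then 1 else 0
  have he (i : ℕ) (hi : i ∈ Finset.range k) : 1 ≤ ‖e i‖ := by
    simpa [e] using PiLp.norm_apply_le (e i) ⟨i, Finset.mem_range.1 hi⟩
  have hsum (s : ℕ → ℝ) :
      ∑ i ∈ Finset.range k, s i • e i = WithLp.toLp ⊤ fun j : Fin k => s j := by
    ext j
    simp [e]
  have hupper : signAverage (fun i => T (e i)) norm k 0 ≤ M := by
    refine signAverage_le_of_forall_le _ _ _ _ _ fun s hs => ?_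
    simp_rw [zero_add, ← map_smul, ← map_sum, hsum]
    refine hM _ ?_
    rw [PiLp.norm_toLp]
    exact (pi_norm_le_iff_of_nonneg zero_le_one).2 fun j => hs j
  calc (k : ℝ) * d = ∑ i ∈ Finset.range k, d := by simp
    _ ≤ ∑ i ∈ Finset.range k, ‖T (e i)‖ := Finset.sum_le_sum fun i hi =>
        (le_mul_of_one_le_right hd (he i hi)).trans (hlow _)
    _ ≤ 9 / 5 * √k * signAverage (fun i => T (e i)) norm k 0 :=
        sum_norm_le_signAverage_norm _ k
    _ ≤ 9 / 5 * √k * M := by gcongr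

theorem exists_lower_bound_of_id_mem_GiEllOne {X : Type*} [NormedAddCommGroup X]
    [NormedSpace ℝ X] (h : ContinuousLinearMap.id ℝ X ∈ GiEllOne X) :
    ∃ R : X →L[ℝ] ellOne, ∃ d > 0, ∀ x, d * ‖x‖ ≤ ‖R x‖ := by
  obtain ⟨θ, ⟨c, hc, hθ⟩, hcl⟩ := h
  rw [ContinuousLinearMap.comp_id] at hcl
  obtain ⟨_, ⟨R, S, rfl⟩, hdist⟩ := Metric.mem_closure_iff.1 hcl (c / 2) (by positivity)
  rw [dist_eq_norm] at hdist
  refine ⟨R, c / 2 / (‖S‖ + 1), by positivity, fun x => ?_⟩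
  have h₁ : ‖θ x - S (R x)‖ ≤ c / 2 * ‖x‖ :=
    ((θ - S.comp R).le_opNorm x).trans (by gcongr)
  have h₂ : ‖S (R x)‖ ≤ ‖S‖ * ‖R x‖ := S.le_opNorm _
  have h₃ := norm_sub_norm_le (θ x) (S (R x))
  rw [div_mul_eq_mul_div, div_le_iff₀ (by positivity)]
  linarith [hθ x, norm_nonneg (R x)]

/-- if a Banach space `X` contains uniformly isomorphic copies of `ℓ∞(k)`
(for some `λ < ∞` and each `k`, an embedding `J : ℓ∞(k) → X` with `‖v‖ ≤ ‖J v‖` and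
`‖J‖ ≤ λ`, i.e. a subspace `λ`-isomorphic to `ℓ∞(k)`), then `G^i_{ℓ¹}(X)` is a proper
ideal of `L(X)`; in particular the identity operator does not belong to it. -/
theorem stmt3 (X : Type*) [NormedAddCommGroup X] [NormedSpace ℝ X] [CompleteSpace X]
    (hcopies : ∃ lam : ℝ, ∀ k : ℕ, ∃ J : ellInftyFin k →L[ℝ] X,
      (∀ v, ‖v‖ ≤ ‖J v‖) ∧ ‖J‖ ≤ lam) :
    GiEllOne X ≠ Set.univ ∧ ContinuousLinearMap.id ℝ X ∉ GiEllOne X := by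
  suffices h : ContinuousLinearMap.id ℝ X ∉ GiEllOne X from
    ⟨fun h' => h (h' ▸ Set.mem_univ _), h⟩
  intro hid
  obtain ⟨R, d, hd, hR⟩ := exists_lower_bound_of_id_mem_GiEllOne hid
  obtain ⟨lam, hJ⟩ := hcopies
  obtain ⟨m, hm⟩ := exists_nat_gt (9 / 5 * (‖R‖ * lam) / d)
  obtain ⟨J, hJlow, hJnorm⟩ := hJ ((m + 1) ^ 2)
  have h := lower_bound_mul_le_of_ellInftyFin_ellOne (R.comp J) (d := d) (M := ‖R‖ * lam) hd.le
    (fun v => (mul_le_mul_of_nonneg_left (hJlow v) hd.le).trans (hR (J v)))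
    (fun v hv => (R.le_opNorm _).trans (mul_le_mul_of_nonneg_left
      ((J.le_of_opNorm_le_of_le hJnorm hv).trans_eq (mul_one lam)) (norm_nonneg R)))
  push_cast at h
  rw [Real.sqrt_sq (by positivity)] at h
  rw [div_lt_iff₀ hd] at hm
  have hpos : (0 : ℝ) < m + 1 := by positivity
  have h' : (m + 1) * d ≤ 9 / 5 * (‖R‖ * lam) :=
    le_of_mul_le_mul_left (by linarith) hpos
  linarith
end
end

section
/- Let (E_n) be a sequence of finite-dimensional Banach spaces satisfying condition (*), and E = (⊕_n E_n)_{ℓ¹}. Suppose T ∈ L(E), I₁, I₂, … and N₁, N₂, … are finite subsets of ℕ with max I_j < min I_{j+1} and max N_j < min N_{j+1} for all j, and set W_j = P_{I_j} T J_{N_j}. If the identity operators 1_{E_n} factor through (W_j) uniformly, then the identity 1_E factors through T, i.e., there exist R, S ∈ L(E) with 1_E = R T S. -/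
open Filter Topology
open scoped ENNReal

noncomputable section

/-- `(U n)` factor through `(V n)` uniformly: there is `K < ∞` such that each `U n` can be
written as `U n = R ∘ V k ∘ S` with `‖R‖·‖S‖ ≤ K`. -/
def FactorsUniformly {X Y G H : ℕ → Type*}
    [∀ n, NormedAddCommGroup (X n)] [∀ n, NormedSpace ℝ (X n)]
    [∀ n, NormedAddCommGroup (Y n)] [∀ n, NormedSpace ℝ (Y n)]
    [∀ n, NormedAddCommGroup (G n)] [∀ n, NormedSpace ℝ (G n)]
    [∀ n, NormedAddCommGroup (H n)] [∀ n, NormedSpace ℝ (H n)]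
    (U : ∀ n, X n →L[ℝ] Y n) (V : ∀ n, G n →L[ℝ] H n) : Prop :=
  ∃ K : ℝ, ∀ n, ∃ (k : ℕ) (S : X n →L[ℝ] G k) (R : H k →L[ℝ] Y n),
    U n = R.comp ((V k).comp S) ∧ ‖R‖ * ‖S‖ ≤ K

section EllOne

variable {ι : Type*} {E : ι → Type*} [∀ n, NormedAddCommGroup (E n)]

theorem lp_one_hasSum_norm (x : lp E 1) : HasSum (fun i => ‖x i‖) ‖x‖ := by
  simpa using lp.hasSum_norm (p := 1) (by norm_num) x

theorem lp_one_sum_norm_le (x : lp E 1) (s : Finset ι) : ∑ i ∈ s, ‖x i‖ ≤ ‖x‖ :=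
  sum_le_hasSum s (fun _ _ => norm_nonneg _) (lp_one_hasSum_norm x)

theorem lp_one_norm_le_of_sum_le {x : lp E 1} {C : ℝ}
    (h : ∀ s : Finset ι, ∑ i ∈ s, ‖x i‖ ≤ C) : ‖x‖ ≤ C :=
  hasSum_le_of_sum_le (lp_one_hasSum_norm x) h

theorem lp_one_norm_eq_sum_of_restrict {x : lp E 1} {I : Finset ι} {z : lp (fun i : I => E i.1) 1}
    (h : ∀ i : I, z i = x i.1) : ‖z‖ = ∑ i ∈ I, ‖x i‖ := by
  rw [← (lp_one_hasSum_norm z).tsum_eq, tsum_fintype, ← Finset.sum_coe_sort I]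
  simp [h]

theorem lp_one_exists_sum_tail_le [DecidableEq ι] (x : lp E 1) {ε : ℝ} (hε : 0 < ε) :
    ∃ t : Finset ι, ∀ u : Finset ι, Disjoint u t → ∑ i ∈ u, ‖x i‖ ≤ ε := by
  obtain ⟨t, ht⟩ := summable_iff_vanishing_norm.1 (lp_one_hasSum_norm x).summable ε hε
  exact ⟨t, fun u hu => (le_abs_self _).trans (ht u hu).le⟩

variable [∀ n, NormedSpace ℝ (E n)]

/-- Uniformly bounded operators out of the summands glue to an operator out of the `ℓ¹`-sum. -/
theorem lp_one_exists_desc [DecidableEq ι] {F : Type*} [NormedAddCommGroup F] [NormedSpace ℝ F]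
    [CompleteSpace F] (s : ∀ n, E n →L[ℝ] F) (c : ℝ) (hs : ∀ n y, ‖s n y‖ ≤ c * ‖y‖) :
    ∃ S : lp E 1 →L[ℝ] F, ∀ n y, S (lp.single 1 n y) = s n y := by
  have hsum : ∀ x : lp E 1, Summable fun n => ‖s n (x n)‖ := fun x =>
    .of_nonneg_of_le (fun _ => norm_nonneg _) (fun n => hs n _)
      ((lp_one_hasSum_norm x).summable.mul_left c)
  let S₀ : lp E 1 →ₗ[ℝ] F :=
    { toFun := fun x => ∑' n, s n (x n)
      map_add' := fun x y => by
        rw [← (hsum x).of_norm.tsum_add (hsum y).of_norm]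
        simp
      map_smul' := fun a x => by
        rw [RingHom.id_apply, ← (hsum x).of_norm.tsum_const_smul a]
        simp }
  refine ⟨S₀.mkContinuous c fun x => ?_, fun n y => ?_⟩
  · refine (norm_tsum_le_tsum_norm (hsum x)).trans ?_
    rw [← ((lp_one_hasSum_norm x).mul_left c).tsum_eq]
    exact (hsum x).tsum_le_tsum (fun n => hs n _) ((lp_one_hasSum_norm x).summable.mul_left c)
  · change ∑' m, s m (lp.single 1 n y m) = s n y
    rw [tsum_eq_single n fun m hm => by rw [lp.single_apply_ne _ _ _ hm, map_zero],
      lp.single_apply_self]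

/-- Operators into the summands whose norms are summable glue to an operator into the
`ℓ¹`-sum. -/
theorem lp_one_exists_lift {F : Type*} [NormedAddCommGroup F] [NormedSpace ℝ F]
    (r : ∀ n, F →L[ℝ] E n) (c : ℝ)
    (hr : ∀ (x : F) (t : Finset ι), ∑ n ∈ t, ‖r n x‖ ≤ c * ‖x‖) :
    ∃ R : F →L[ℝ] lp E 1, ∀ x n, R x n = r n x := by
  let R₀ : F →ₗ[ℝ] lp E 1 :=
    { toFun := fun x => ⟨fun n => r n x, memℓp_gen' (C := c * ‖x‖) (by simpa using hr x)⟩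
      map_add' := fun x y => lp.ext (funext fun n => map_add (r n) x y)
      map_smul' := fun a x => lp.ext (funext fun n => map_smul (r n) a x) }
  exact ⟨R₀.mkContinuous c fun x => lp_one_norm_le_of_sum_le (hr x), fun _ _ => rfl⟩

theorem lp_one_opNorm_le_of_single [DecidableEq ι] {F : Type*} [NormedAddCommGroup F]
    [NormedSpace ℝ F] (A : lp E 1 →L[ℝ] F) {c : ℝ} (hc : 0 ≤ c)
    (h : ∀ n y, ‖A (lp.single 1 n y)‖ ≤ c * ‖y‖) : ‖A‖ ≤ c := by
  refine A.opNorm_le_bound hc fun x => ?_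
  have hx := A.hasSum (lp.hasSum_single ENNReal.one_ne_top x)
  exact hx.norm_le_of_bounded ((lp_one_hasSum_norm x).mul_left c) fun n => h n _

/-- The tails of an operator from a finite-dimensional space to an `ℓ¹`-sum are uniformly
small. -/
theorem lp_one_exists_sum_tail_le_mul_norm [DecidableEq ι] {X : Type*} [NormedAddCommGroup X]
    [NormedSpace ℝ X] [FiniteDimensional ℝ X] (A : X →L[ℝ] lp E 1) {ε : ℝ} (hε : 0 < ε) :
    ∃ t : Finset ι, ∀ u : Finset ι, Disjoint u t → ∀ y, ∑ i ∈ u, ‖A y i‖ ≤ ε * ‖y‖ := by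
  let v := Module.finBasis ℝ X
  let c := ∑ b, ‖(LinearMap.toContinuousLinearMap (v.coord b))‖
  have hc : 0 ≤ c := by positivity
  have hδ : 0 < ε / (c + 1) := by positivity
  choose t ht using fun b => lp_one_exists_sum_tail_le (A (v b)) hδ
  refine ⟨Finset.univ.biUnion t, fun u hu y => ?_⟩
  rw [Finset.disjoint_biUnion_right] at hu
  have hcoord : ∀ b, |v.repr y b| ≤ ‖LinearMap.toContinuousLinearMap (v.coord b)‖ * ‖y‖ :=
    fun b => (LinearMap.toContinuousLinearMap (v.coord b)).le_opNorm y
  calc ∑ i ∈ u, ‖A y i‖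
      ≤ ∑ i ∈ u, ∑ b, |v.repr y b| * ‖A (v b) i‖ := by
        refine Finset.sum_le_sum fun i _ => ?_
        have : A y i = ∑ b, v.repr y b • A (v b) i := by
          conv_lhs => rw [← v.sum_repr y]
          rw [map_sum, lp.coeFn_sum, Finset.sum_apply]
          simp
        rw [this]
        refine (norm_sum_le _ _).trans_eq (Finset.sum_congr rfl fun b _ => ?_)
        rw [norm_smul, Real.norm_eq_abs]
    _ = ∑ b, |v.repr y b| * ∑ i ∈ u, ‖A (v b) i‖ := by
        rw [Finset.sum_comm]
        simp_rw [Finset.mul_sum]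
    _ ≤ ∑ b, (‖LinearMap.toContinuousLinearMap (v.coord b)‖ * ‖y‖) * (ε / (c + 1)) := by
        gcongr with b _
        · exact hcoord b
        · exact ht b u (hu b (Finset.mem_univ b))
    _ = c / (c + 1) * (ε * ‖y‖) := by
        rw [← Finset.sum_mul, ← Finset.sum_mul]
        change c * ‖y‖ * (ε / (c + 1)) = _
        ring
    _ ≤ 1 * (ε * ‖y‖) := by
        gcongr
        rw [div_le_one (by positivity)]
        linarith
    _ = ε * ‖y‖ := one_mul _

end EllOne

theorem exists_ge_forall_mem_lt (t : Finset ℕ) (M : ℕ) :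
    ∃ B, M ≤ B ∧ ∀ i ∈ t, i < B :=
  ⟨M + t.sup id + 1, by omega, fun i hi => by
    have := Finset.le_sup (f := id) hi
    simp only [id] at this
    omega⟩

section Blocks

variable {E : ℕ → Type*} [∀ n, NormedAddCommGroup (E n)] [∀ n, NormedSpace ℝ (E n)]

/-- If the identity of a finite-dimensional space `X` factors through `T`, with uniform bounds,
via operators `lp E 1 → X` supported on arbitrarily late finite sets, then it factors
approximately through `T` in such a way that moreover the initial coordinates of `T ∘ s` are
small. -/
theorem exists_almost_factorization_of_factorizations [∀ n, FiniteDimensional ℝ (E n)]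
    {X : Type*} [NormedAddCommGroup X]
    [NormedSpace ℝ X] [FiniteDimensional ℝ X] (T : lp E 1 →L[ℝ] lp E 1) {K : ℝ} (hK : 0 ≤ K)
    (h : ∀ M : ℕ, ∃ (s : X →L[ℝ] lp E 1) (r : lp E 1 →L[ℝ] X) (I : Finset ℕ),
      (∀ y, ‖s y‖ ≤ ‖y‖) ∧ (∀ x, ‖r x‖ ≤ K * ∑ i ∈ I, ‖x i‖) ∧ (∀ i ∈ I, M ≤ i) ∧
        ∀ y, r (T (s y)) = y)
    (M : ℕ) {ε : ℝ} (hε : 0 < ε) :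
    ∃ (s : X →L[ℝ] lp E 1) (r : lp E 1 →L[ℝ] X) (I : Finset ℕ),
      (∀ y, ‖s y‖ ≤ 2 * ‖y‖) ∧ (∀ x, ‖r x‖ ≤ K * ∑ i ∈ I, ‖x i‖) ∧ (∀ i ∈ I, M ≤ i) ∧
        (∀ y, ‖r (T (s y)) - y‖ ≤ ε * ‖y‖) ∧
        ∀ y, ∑ i ∈ Finset.range M, ‖T (s y) i‖ ≤ ε * ‖y‖ := by
  choose s r I hs hr hI hid using h
  let ev : lp E 1 →L[ℝ] ∀ i : Fin M, E i := ContinuousLinearMap.pi fun i => lp.evalCLM ℝ E 1 i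
  let A : ℕ → X →L[ℝ] ∀ i : Fin M, E i := fun l => ev.comp (T.comp (s l))
  have hA : ∀ l, A l ∈ Metric.closedBall (0 : X →L[ℝ] ∀ i : Fin M, E i) (‖ev‖ * ‖T‖) := by
    intro l
    rw [mem_closedBall_zero_iff]
    refine ContinuousLinearMap.opNorm_le_bound _ (by positivity) fun y => ?_
    calc ‖ev (T (s l y))‖ ≤ ‖ev‖ * (‖T‖ * ‖s l y‖) :=
          (ev.le_opNorm _).trans (by gcongr; exact T.le_opNorm _)
      _ ≤ ‖ev‖ * (‖T‖ * ‖y‖) := by gcongr; exact hs l y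
      _ = _ := by ring
  have : ProperSpace (X →L[ℝ] ∀ i : Fin M, E i) := FiniteDimensional.proper ℝ _
  obtain ⟨L, -, φ, hφ, hL⟩ := tendsto_subseq_of_bounded Metric.isBounded_closedBall hA
  have hδ : 0 < ε / (2 * (M + 1)) := by positivity
  obtain ⟨l₀, hl₀⟩ := Metric.tendsto_atTop.1 hL _ hδ
  obtain ⟨t, ht⟩ := lp_one_exists_sum_tail_le_mul_norm (T.comp (s (φ l₀)))
    (show 0 < ε / (K + 1) by positivity)
  obtain ⟨B, hB, htB⟩ := exists_ge_forall_mem_lt t (M + l₀)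
  have hBφ : B ≤ φ B := hφ.id_le B
  refine ⟨s (φ B) - s (φ l₀), r (φ B), I (φ B), fun y => ?_, hr _, fun i hi => ?_,
    fun y => ?_, fun y => ?_⟩
  · refine (norm_sub_le (s (φ B) y) (s (φ l₀) y)).trans ?_
    linarith [hs (φ B) y, hs (φ l₀) y]
  · have := hI _ i hi
    omega
  · have hdisj : Disjoint (I (φ B)) t := Finset.disjoint_left.2 fun i hi hit => by
      have := hI _ i hi
      have := htB i hit
      omega
    rw [sub_apply, map_sub, map_sub, hid, sub_sub_cancel_left, norm_neg]
    calc ‖r (φ B) (T (s (φ l₀) y))‖ ≤ K * (ε / (K + 1) * ‖y‖) :=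
          (hr _ _).trans (by gcongr; exact ht _ hdisj y)
      _ = K / (K + 1) * (ε * ‖y‖) := by ring
      _ ≤ 1 * (ε * ‖y‖) := by
          gcongr
          rw [div_le_one (by positivity)]
          linarith
      _ = ε * ‖y‖ := one_mul _
  · have hdist : ‖A (φ B) - A (φ l₀)‖ ≤ ε / (M + 1) := by
      rw [← dist_eq_norm]
      calc dist (A (φ B)) (A (φ l₀)) ≤ dist (A (φ B)) L + dist (A (φ l₀)) L :=
            dist_triangle_right _ _ _
        _ ≤ ε / (2 * (M + 1)) + ε / (2 * (M + 1)) :=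
            add_le_add (hl₀ B (by omega)).le (hl₀ l₀ le_rfl).le
        _ = ε / (M + 1) := by field_simp; ring
    have hco : ∀ i ∈ Finset.range M, ‖T ((s (φ B) - s (φ l₀)) y) i‖ ≤ ε / (M + 1) * ‖y‖ := by
      intro i hi
      have h1 : T ((s (φ B) - s (φ l₀)) y) i
          = (A (φ B) - A (φ l₀)) y ⟨i, Finset.mem_range.1 hi⟩ := by
        simp [A, ev]
        rfl
      rw [h1]
      exact (norm_le_pi_norm _ _).trans ((ContinuousLinearMap.le_opNorm _ _).trans (by gcongr))
    refine (Finset.sum_le_sum hco).trans ?_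
    rw [Finset.sum_const, Finset.card_range, nsmul_eq_mul]
    calc (M : ℝ) * (ε / (M + 1) * ‖y‖) = M / (M + 1) * (ε * ‖y‖) := by ring
      _ ≤ 1 * (ε * ‖y‖) := by
          gcongr
          rw [div_le_one (by positivity)]
          linarith
      _ = ε * ‖y‖ := one_mul _

/-- Choosing the blocks one after the other. -/
theorem exists_block_sequence [∀ n, FiniteDimensional ℝ (E n)] (T : lp E 1 →L[ℝ] lp E 1)
    {K : ℝ} {ε : ℝ} (hε : 0 < ε)
    (h : ∀ n M : ℕ, ∃ (s : E n →L[ℝ] lp E 1) (r : lp E 1 →L[ℝ] E n) (I : Finset ℕ),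
      (∀ y, ‖s y‖ ≤ 2 * ‖y‖) ∧ (∀ x, ‖r x‖ ≤ K * ∑ i ∈ I, ‖x i‖) ∧ (∀ i ∈ I, M ≤ i) ∧
        (∀ y, ‖r (T (s y)) - y‖ ≤ ε * ‖y‖) ∧
        ∀ y, ∑ i ∈ Finset.range M, ‖T (s y) i‖ ≤ ε * ‖y‖) :
    ∃ (s : ∀ n, E n →L[ℝ] lp E 1) (r : ∀ n, lp E 1 →L[ℝ] E n) (I : ℕ → Finset ℕ) (M : ℕ → ℕ),
      (∀ n y, ‖s n y‖ ≤ 2 * ‖y‖) ∧ (∀ n x, ‖r n x‖ ≤ K * ∑ i ∈ I n, ‖x i‖) ∧ Monotone M ∧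
        (∀ n, ∀ i ∈ I n, M n ≤ i ∧ i < M (n + 1)) ∧
        (∀ n y, ‖r n (T (s n y)) - y‖ ≤ ε * ‖y‖) ∧
        (∀ n y, ∑ i ∈ Finset.range (M n), ‖T (s n y) i‖ ≤ ε * ‖y‖) ∧
        ∀ n y (u : Finset ℕ), (∀ i ∈ u, M (n + 1) ≤ i) → ∑ i ∈ u, ‖T (s n y) i‖ ≤ ε * ‖y‖ := by
  choose s r I hs hr hI hid hini using h
  choose t ht using fun n M => lp_one_exists_sum_tail_le_mul_norm (T.comp (s n M)) hε
  choose next hnext hlt using fun n M => exists_ge_forall_mem_lt (t n M ∪ I n M) M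
  let M : ℕ → ℕ := fun n => Nat.rec 0 next n
  have hM : ∀ n, M (n + 1) = next n (M n) := fun _ => rfl
  refine ⟨fun n => s n (M n), fun n => r n (M n), fun n => I n (M n), M, fun n => hs n _,
    fun n => hr n _, monotone_nat_of_le_succ fun n => hnext n _, fun n i hi => ⟨hI n _ i hi, ?_⟩,
    fun n => hid n _, fun n => hini n _, fun n y u hu => ht n _ u ?_ y⟩
  · exact hlt n _ i (Finset.mem_union_right _ hi)
  · refine Finset.disjoint_left.2 fun i hi hit => ?_
    exact absurd (hlt n (M n) i (Finset.mem_union_left _ hit)) (not_lt.2 (hu i hi))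

/-- The gluing step: a sequence of almost factorizations along almost decoupled blocks gives a
factorization of the identity of the whole `ℓ¹`-sum. -/
theorem exists_factorization_of_block_sequence [∀ n, CompleteSpace (E n)]
    (T : lp E 1 →L[ℝ] lp E 1)
    {K : ℝ} (hK : 0 ≤ K) {ε : ℝ} (hε : 0 < ε) (hKε : ε + 2 * (K * ε) < 1)
    (s : ∀ n, E n →L[ℝ] lp E 1) (r : ∀ n, lp E 1 →L[ℝ] E n) (I : ℕ → Finset ℕ) (M : ℕ → ℕ)
    (hs : ∀ n y, ‖s n y‖ ≤ 2 * ‖y‖) (hr : ∀ n x, ‖r n x‖ ≤ K * ∑ i ∈ I n, ‖x i‖)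
    (hM : Monotone M) (hI : ∀ n, ∀ i ∈ I n, M n ≤ i ∧ i < M (n + 1))
    (hid : ∀ n y, ‖r n (T (s n y)) - y‖ ≤ ε * ‖y‖)
    (hini : ∀ n y, ∑ i ∈ Finset.range (M n), ‖T (s n y) i‖ ≤ ε * ‖y‖)
    (htail : ∀ n y (u : Finset ℕ), (∀ i ∈ u, M (n + 1) ≤ i) →
      ∑ i ∈ u, ‖T (s n y) i‖ ≤ ε * ‖y‖) :
    ∃ R S : lp E 1 →L[ℝ] lp E 1, ContinuousLinearMap.id ℝ (lp E 1) = R.comp (T.comp S) := by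
  have hdisj : ∀ u : Finset ℕ, (u : Set ℕ).PairwiseDisjoint I := by
    intro u a _ b _ hab
    refine Finset.disjoint_left.2 fun i hia hib => ?_
    obtain ⟨ha1, ha2⟩ := hI a i hia
    obtain ⟨hb1, hb2⟩ := hI b i hib
    rcases lt_or_gt_of_ne hab with hlt | hlt
    · have := hM (Nat.succ_le_of_lt hlt)
      simp only [Nat.succ_eq_add_one] at this
      omega
    · have := hM (Nat.succ_le_of_lt hlt)
      simp only [Nat.succ_eq_add_one] at this
      omega
  have hrsum : ∀ (x : lp E 1) (u : Finset ℕ),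
      ∑ n ∈ u, ‖r n x‖ ≤ K * ∑ i ∈ u.biUnion I, ‖x i‖ := by
    intro x u
    rw [Finset.sum_biUnion (hdisj u), Finset.mul_sum]
    exact Finset.sum_le_sum fun n _ => hr n x
  obtain ⟨S, hS⟩ := lp_one_exists_desc s 2 hs
  obtain ⟨R, hR⟩ := lp_one_exists_lift r K fun x u => (hrsum x u).trans
    (by gcongr; exact lp_one_sum_norm_le _ _)
  have hclose : ‖1 - R.comp (T.comp S)‖ < 1 := by
    refine lt_of_le_of_lt (lp_one_opNorm_le_of_single _ (by positivity) fun m y => ?_) hKε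
    refine lp_one_norm_le_of_sum_le fun u => ?_
    set z := T (s m y) with hz
    have hcoord : ∀ n, ((1 - R.comp (T.comp S)) (lp.single 1 m y) : lp E 1) n
        = (lp.single 1 m y : lp E 1) n - r n z := by
      intro n
      simp [hS, hR, hz]
    have hlow : ∑ n ∈ u with n < m, ‖r n z‖ ≤ K * (ε * ‖y‖) := by
      refine (hrsum z _).trans ?_
      gcongr
      refine (Finset.sum_le_sum_of_subset_of_nonneg ?_ fun _ _ _ => norm_nonneg _).trans (hini m y)
      intro i hi
      obtain ⟨n, hn, hin⟩ := Finset.mem_biUnion.1 hi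
      exact Finset.mem_range.2 ((hI n i hin).2.trans_le (hM (Finset.mem_filter.1 hn).2))
    have hhigh : ∑ n ∈ u with m < n, ‖r n z‖ ≤ K * (ε * ‖y‖) := by
      refine (hrsum z _).trans ?_
      gcongr
      refine htail m y _ fun i hi => ?_
      obtain ⟨n, hn, hin⟩ := Finset.mem_biUnion.1 hi
      exact (hM (Finset.mem_filter.1 hn).2).trans (hI n i hin).1
    have hbound : ∀ n, ‖((1 - R.comp (T.comp S)) (lp.single 1 m y) : lp E 1) n‖
        ≤ (if n = m then ε * ‖y‖ else 0) + (if n < m then ‖r n z‖ else 0)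
          + (if m < n then ‖r n z‖ else 0) := by
      intro n
      rw [hcoord]
      rcases lt_trichotomy n m with hn | rfl | hn
      · simp [hn, hn.ne, hn.not_gt]
      · simpa [norm_sub_rev y] using hid n y
      · simp [hn, hn.ne', hn.not_gt]
    refine (Finset.sum_le_sum fun n _ => hbound n).trans ?_
    rw [Finset.sum_add_distrib, Finset.sum_add_distrib, ← Finset.sum_filter (fun n => n < m),
      ← Finset.sum_filter (fun n => m < n), Finset.sum_ite_eq']
    have : (if m ∈ u then ε * ‖y‖ else 0) ≤ ε * ‖y‖ := by
      split_ifs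
      · exact le_rfl
      · positivity
    linarith
  have hunit := isUnit_one_sub_of_norm_lt_one hclose
  rw [sub_sub_cancel] at hunit
  obtain ⟨V, hV⟩ := hunit.exists_left_inv
  exact ⟨V.comp R, S, hV.symm⟩

end Blocks

section LateFactorization

variable {E : ℕ → Type*} [∀ n, NormedAddCommGroup (E n)] [∀ n, NormedSpace ℝ (E n)]

theorem le_of_mem_of_forall_lt_succ {I : ℕ → Finset ℕ} (hne : ∀ j, (I j).Nonempty)
    (hord : ∀ j, ∀ a ∈ I j, ∀ b ∈ I (j + 1), a < b) (j : ℕ) : ∀ a ∈ I j, j ≤ a := by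
  induction j with
  | zero => exact fun a _ => Nat.zero_le a
  | succ j ih =>
    intro a ha
    obtain ⟨b, hb⟩ := hne j
    exact (ih b hb).trans_lt (hord j b hb a ha)

/-- Under condition (*), the identity of each `E n` factors uniformly through `T` via operators
supported on arbitrarily late finite sets. -/
theorem exists_late_factorization [∀ n, FiniteDimensional ℝ (E n)]
    (hdim : ∀ k : ℕ, ∃ n, k ≤ Module.finrank ℝ (E n))
    {C : ℝ} (hC : ∀ m n : ℕ, m < n → ∃ (i : E m →L[ℝ] E n) (q : E n →L[ℝ] E m),
      q.comp i = ContinuousLinearMap.id ℝ (E m) ∧ ‖i‖ ≤ 1 ∧ ‖q‖ ≤ C)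
    (T : lp E 1 →L[ℝ] lp E 1)
    (P : ∀ I : Finset ℕ, lp E 1 →L[ℝ] lp (fun i : I => E i.1) 1)
    (hP : ∀ (I : Finset ℕ) (x : lp E 1) (i : I), P I x i = x i.1)
    (J : ∀ I : Finset ℕ, lp (fun i : I => E i.1) 1 →L[ℝ] lp E 1)
    (hJ : ∀ (I : Finset ℕ) (x : lp (fun i : I => E i.1) 1) (m : ℕ),
      J I x m = if h : m ∈ I then x ⟨m, h⟩ else 0)
    (I N : ℕ → Finset ℕ) (hI : ∀ j, ∀ a ∈ I j, j ≤ a) {K : ℝ}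
    (hK : ∀ n, ∃ (k : ℕ) (S : E n →L[ℝ] lp (fun i : N k => E i.1) 1)
      (R : lp (fun i : I k => E i.1) 1 →L[ℝ] E n),
      ContinuousLinearMap.id ℝ (E n) = R.comp (((P (I k)).comp (T.comp (J (N k)))).comp S) ∧
        ‖R‖ * ‖S‖ ≤ K)
    (n M : ℕ) :
    ∃ (s : E n →L[ℝ] lp E 1) (r : lp E 1 →L[ℝ] E n) (I : Finset ℕ),
      (∀ y, ‖s y‖ ≤ ‖y‖) ∧ (∀ x, ‖r x‖ ≤ C * K * ∑ i ∈ I, ‖x i‖) ∧ (∀ i ∈ I, M ≤ i) ∧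
        ∀ y, r (T (s y)) = y := by
  obtain ⟨m, hm⟩ := hdim (∑ i ∈ Finset.range (n + 1), Module.finrank ℝ (E i) +
    ∑ j ∈ Finset.range M, ∑ i ∈ N j, Module.finrank ℝ (E i) + 1)
  have hnm : n < m := by
    by_contra hle
    have := Finset.single_le_sum (f := fun i => Module.finrank ℝ (E i))
      (fun _ _ => Nat.zero_le _) (Finset.mem_range.2 (show m < n + 1 by omega))
    omega
  obtain ⟨i, q, hqi, hi, hq⟩ := hC n m hnm
  obtain ⟨k, S, R, hRS, hRSK⟩ := hK m
  have hRS' : ∀ y, R (P (I k) (T (J (N k) (S y)))) = y := fun y =>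
    (DFunLike.congr_fun hRS y).symm
  have hinj : Function.Injective S := Function.LeftInverse.injective
    (g := fun z => R (P (I k) (T (J (N k) z)))) hRS'
  have hMk : M ≤ k := by
    by_contra! hlt
    let f : E m →ₗ[ℝ] ∀ i : N k, E i.1 :=
      { toFun := fun y => S y
        map_add' := fun x y => by rw [map_add]; rfl
        map_smul' := fun a x => by simp }
    have hf : Function.Injective f := fun x y hxy => hinj (lp.ext hxy)
    have h1 := LinearMap.finrank_le_finrank_of_injective hf
    rw [Module.finrank_pi_fintype, Finset.sum_coe_sort (N k) fun i => Module.finrank ℝ (E i)] at h1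
    have := Finset.single_le_sum (f := fun j => ∑ i ∈ N j, Module.finrank ℝ (E i))
      (fun _ _ => Nat.zero_le _) (Finset.mem_range.2 hlt)
    omega
  have hS : 0 < ‖S‖ := by
    rw [norm_pos_iff]
    rintro rfl
    have : Subsingleton (E m) := ⟨fun x y => hinj rfl⟩
    have := Module.finrank_zero_of_subsingleton (R := ℝ) (M := E m)
    omega
  have hC0 : 0 ≤ C := (norm_nonneg q).trans hq
  have hJnorm : ∀ x, ‖J (N k) x‖ ≤ ‖x‖ := by
    intro x
    have hx : ‖x‖ = ∑ i ∈ N k, ‖J (N k) x i‖ :=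
      lp_one_norm_eq_sum_of_restrict fun i => by simp [hJ]
    rw [hx]
    refine lp_one_norm_le_of_sum_le fun u => ?_
    rw [← Finset.sum_filter_of_ne (p := fun i => i ∈ N k)]
    · exact Finset.sum_le_sum_of_subset_of_nonneg (fun i hi => (Finset.mem_filter.1 hi).2)
        fun _ _ _ => norm_nonneg _
    · intro i _ hne
      by_contra hi
      exact hne (by simp [hJ, hi])
  refine ⟨‖S‖⁻¹ • (J (N k)).comp (S.comp i), ‖S‖ • q.comp (R.comp (P (I k))), I k,
    fun y => ?_, fun x => ?_, fun a ha => hMk.trans (hI k a ha), fun y => ?_⟩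
  · calc ‖(‖S‖⁻¹ • (J (N k)).comp (S.comp i)) y‖ = ‖S‖⁻¹ * ‖J (N k) (S (i y))‖ := by
          simp [norm_smul]
      _ ≤ ‖S‖⁻¹ * (‖S‖ * (1 * ‖y‖)) := by
          gcongr
          refine (hJnorm _).trans ((S.le_opNorm _).trans ?_)
          gcongr
          exact i.le_of_opNorm_le hi y
      _ = ‖y‖ := by field_simp
  · calc ‖(‖S‖ • q.comp (R.comp (P (I k)))) x‖ = ‖S‖ * ‖q (R (P (I k) x))‖ := by
          simp [norm_smul]
      _ ≤ ‖S‖ * (C * (‖R‖ * ‖P (I k) x‖)) := by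
          gcongr
          refine (q.le_of_opNorm_le hq _).trans ?_
          gcongr
          exact R.le_opNorm _
      _ = C * (‖R‖ * ‖S‖) * ‖P (I k) x‖ := by ring
      _ ≤ C * K * ‖P (I k) x‖ := by gcongr
      _ = C * K * ∑ i ∈ I k, ‖x i‖ := by rw [lp_one_norm_eq_sum_of_restrict (hP (I k) x)]
  · have hqi' : q (i y) = y := DFunLike.congr_fun hqi y
    simp [hRS', hqi', smul_smul, hS.ne']

end LateFactorization

/-- let `(E n)` be finite-dimensional Banach spaces satisfying condition (*)
(`(dim Eₙ)` unbounded, and uniformly complemented copies of `Eₘ` in `Eₙ` for `m < n`), and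
`E = (⊕ₙ Eₙ)_{ℓ¹}`.  For finite subsets `I₁ < I₂ < ⋯` and `N₁ < N₂ < ⋯` of `ℕ`, with
`P I : E → E_I` and `J I : E_I → E` the natural projections and embeddings (characterized
by their coordinates), set `W j = P_{I j} ∘ T ∘ J_{N j}`.  If the identities `1_{Eₙ}`
factor through `(W j)` uniformly, then `1_E` factors through `T`. -/
theorem stmt5 (E : ℕ → Type) [∀ n, NormedAddCommGroup (E n)] [∀ n, NormedSpace ℝ (E n)]
    [∀ n, FiniteDimensional ℝ (E n)]
    (hdim : ∀ k : ℕ, ∃ n, k ≤ Module.finrank ℝ (E n))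
    (hstar : ∃ C : ℝ, ∀ m n : ℕ, m < n → ∃ (i : E m →L[ℝ] E n) (q : E n →L[ℝ] E m),
      q.comp i = ContinuousLinearMap.id ℝ (E m) ∧ ‖i‖ ≤ 1 ∧ ‖q‖ ≤ C)
    (T : lp E 1 →L[ℝ] lp E 1)
    (P : ∀ I : Finset ℕ, lp E 1 →L[ℝ] lp (fun i : I => E i.1) 1)
    (hP : ∀ (I : Finset ℕ) (x : lp E 1) (i : I),
      (P I x : ∀ i : I, E i.1) i = (x : ∀ n, E n) i.1)
    (J : ∀ I : Finset ℕ, lp (fun i : I => E i.1) 1 →L[ℝ] lp E 1)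
    (hJ : ∀ (I : Finset ℕ) (x : lp (fun i : I => E i.1) 1) (m : ℕ),
      (J I x : ∀ n, E n) m = if h : m ∈ I then (x : ∀ i : I, E i.1) ⟨m, h⟩ else 0)
    (I N : ℕ → Finset ℕ)
    (hIne : ∀ j, (I j).Nonempty) (hNne : ∀ j, (N j).Nonempty)
    (hIord : ∀ j, ∀ a ∈ I j, ∀ b ∈ I (j + 1), a < b)
    (hNord : ∀ j, ∀ a ∈ N j, ∀ b ∈ N (j + 1), a < b)
    (h : FactorsUniformly (fun n => ContinuousLinearMap.id ℝ (E n))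
      (fun j => (P (I j)).comp (T.comp (J (N j))))) :
    ∃ R S : lp E 1 →L[ℝ] lp E 1,
      ContinuousLinearMap.id ℝ (lp E 1) = R.comp (T.comp S) := by
  obtain ⟨C, hC⟩ := hstar
  obtain ⟨K, hK⟩ := h
  have hlate := exists_late_factorization hdim hC T P hP J hJ I N
    (le_of_mem_of_forall_lt_succ hIne hIord) hK
  have hlate' : ∀ n M : ℕ, ∃ (s : E n →L[ℝ] lp E 1) (r : lp E 1 →L[ℝ] E n) (I : Finset ℕ),
      (∀ y, ‖s y‖ ≤ ‖y‖) ∧ (∀ x, ‖r x‖ ≤ |C * K| * ∑ i ∈ I, ‖x i‖) ∧ (∀ i ∈ I, M ≤ i) ∧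
        ∀ y, r (T (s y)) = y := by
    intro n M
    obtain ⟨s, r, I, hs, hr, hI⟩ := hlate n M
    exact ⟨s, r, I, hs, fun x => (hr x).trans (by gcongr; exact le_abs_self _), hI⟩
  have hε : 0 < 1 / (2 + 2 * |C * K|) := by positivity
  have hKε : 1 / (2 + 2 * |C * K|) + 2 * (|C * K| * (1 / (2 + 2 * |C * K|))) < 1 := by
    field_simp
    linarith
  have : ∀ n, CompleteSpace (E n) := fun n => FiniteDimensional.complete ℝ (E n)
  obtain ⟨s, r, I', M, hs, hr, hM, hI, hid, hini, htail⟩ := exists_block_sequence T hε fun n M =>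
    exists_almost_factorization_of_factorizations T (abs_nonneg (C * K)) (hlate' n) M hε
  exact exists_factorization_of_block_sequence T (abs_nonneg (C * K)) hε hKε s r I' M hs hr hM hI
    hid hini htail
end
end

section
/- Let E = (⊕_n ℓ∞(n))_{ℓ¹}. If T is a bounded linear operator on E such that T ∉ G^i_{ℓ¹}(E), then the identity 1_E factors through T, i.e., there exist bounded linear operators R, S ∈ L(E) with 1_E = R T S. -/
open Filter Topology
open scoped ENNReal

noncomputable section

/-- `E = (⊕ₙ ℓ∞(n))_{ℓ¹}`, the `ℓ¹`-direct sum of the finite-dimensional spaces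
`ℓ∞(n) = (ℝ^n, ‖·‖_∞)`, `n = 1, 2, …`. -/
abbrev ESpace : Type := lp (fun n : ℕ => PiLp ⊤ (fun _ : Fin (n + 1) => ℝ)) 1

section EllOneSum

variable {X : ℕ → Type*} [∀ b, NormedAddCommGroup (X b)]

theorem lpOne_hasSum_norm (f : lp X 1) : HasSum (fun b => ‖f b‖) ‖f‖ := by
  simpa using lp.hasSum_norm (E := X) (p := 1) (by simp) f

theorem lpOne_sum_norm_le (f : lp X 1) (s : Finset ℕ) : ∑ b ∈ s, ‖f b‖ ≤ ‖f‖ :=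
  sum_le_hasSum s (fun _ _ => norm_nonneg _) (lpOne_hasSum_norm f)

theorem lpOne_hasSum_single (f : lp X 1) : HasSum (fun b => lp.single 1 b (f b)) f :=
  lp.hasSum_single (by simp) f

/-- Partial sums bound the tail of a vector in an `ℓ¹`-sum. -/
theorem lpOne_norm_sub_sum (f : lp X 1) (s : Finset ℕ) :
    ‖f - ∑ b ∈ s, lp.single 1 b (f b)‖ = ‖f‖ - ∑ b ∈ s, ‖f b‖ := by
  simpa using lp.norm_compl_sum_single (E := X) (p := 1) (by simp) f s

theorem lpOne_separableSpace [∀ b, TopologicalSpace.SeparableSpace (X b)] :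
    TopologicalSpace.SeparableSpace (lp X 1) := by
  rw [← TopologicalSpace.isSeparable_univ_iff]
  let φ : Finset ℕ → (∀ b, X b) → lp X 1 := fun s v => ∑ b ∈ s, lp.single 1 b (v b)
  have hφ : ∀ s, Continuous (φ s) := fun s => continuous_finsetSum _ fun b _ =>
    (lp.isometry_single (E := X) (p := 1) b).continuous.comp (continuous_apply b)
  have h : TopologicalSpace.IsSeparable (⋃ s, Set.range (φ s)) :=
    .iUnion fun s => TopologicalSpace.isSeparable_range (hφ s)
  refine h.closure.mono fun f _ => ?_
  exact mem_closure_of_tendsto (lpOne_hasSum_single f)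
    (Eventually.of_forall fun s => Set.mem_iUnion.2 ⟨s, fun b => f b, rfl⟩)

variable [∀ b, NormedSpace ℝ (X b)] {Y Z : Type*} [NormedAddCommGroup Y] [NormedSpace ℝ Y]
  [NormedAddCommGroup Z] [NormedSpace ℝ Z]

/-- A uniformly bounded family of operators on the summands extends to the `ℓ¹`-sum. -/
theorem exists_lpOne_extension [CompleteSpace Y] (F : ∀ b, X b →L[ℝ] Y) (C : ℝ)
    (hF : ∀ b x, ‖F b x‖ ≤ C * ‖x‖) :
    ∃ S : lp X 1 →L[ℝ] Y, ∀ b x, S (lp.single 1 b x) = F b x := by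
  have hsn : ∀ f : lp X 1, Summable fun b => ‖F b (f b)‖ := fun f =>
    Summable.of_nonneg_of_le (fun _ => norm_nonneg _) (fun b => hF b (f b))
      ((lpOne_hasSum_norm f).summable.mul_left C)
  have hs : ∀ f : lp X 1, Summable fun b => F b (f b) := fun f => (hsn f).of_norm
  let L : lp X 1 →ₗ[ℝ] Y :=
    { toFun := fun f => ∑' b, F b (f b)
      map_add' := fun f g => by
        simp only [lp.coeFn_add, Pi.add_apply, map_add]
        exact (hs f).tsum_add (hs g)
      map_smul' := fun c f => by
        simp only [lp.coeFn_smul, Pi.smul_apply, map_smul, RingHom.id_apply]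
        exact (hs f).tsum_const_smul c }
  refine ⟨L.mkContinuous C fun f => ?_, fun b x => ?_⟩
  · calc ‖∑' b, F b (f b)‖ ≤ ∑' b, ‖F b (f b)‖ := norm_tsum_le_tsum_norm (hsn f)
      _ ≤ ∑' b, C * ‖f b‖ := (hsn f).tsum_le_tsum (fun b => hF b (f b))
          ((lpOne_hasSum_norm f).summable.mul_left C)
      _ = C * ‖f‖ := by rw [tsum_mul_left, (lpOne_hasSum_norm f).tsum_eq]
  · change ∑' b', F b' ((lp.single 1 b x : lp X 1) b') = F b x
    rw [tsum_eq_single b, lp.single_apply_self]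
    intro b' hb'
    rw [lp.single_apply_ne _ _ _ hb', map_zero]

/-- A family of operators into the summands with summable norms induces an operator into the
`ℓ¹`-sum. -/
theorem exists_to_lpOne (G : ∀ b, Z →L[ℝ] X b) (C : ℝ) (hC : 0 ≤ C)
    (hG : ∀ z (s : Finset ℕ), ∑ b ∈ s, ‖G b z‖ ≤ C * ‖z‖) :
    ∃ R : Z →L[ℝ] lp X 1, (∀ z b, R z b = G b z) ∧ ∀ z, ‖R z‖ ≤ C * ‖z‖ := by
  have hmem : ∀ z, Memℓp (fun b => G b z) 1 := fun z =>
    memℓp_gen' (C := C * ‖z‖) fun s => by simpa using hG z s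
  let L : Z →ₗ[ℝ] lp X 1 :=
    { toFun := fun z => ⟨fun b => G b z, hmem z⟩
      map_add' := fun x y => by ext b; simp; rfl
      map_smul' := fun c x => by ext b; simp }
  have hL : ∀ z, ‖L z‖ ≤ C * ‖z‖ := fun z => by
    refine lp.norm_le_of_forall_sum_le (by simp) (by positivity) fun s => ?_
    simp only [ENNReal.toReal_one, Real.rpow_one]
    exact hG z s
  exact ⟨L.mkContinuous C hL, fun z b => rfl, hL⟩

theorem norm_le_of_norm_single_le (D : lp X 1 →L[ℝ] Y) (C : ℝ)
    (h : ∀ b x, ‖D (lp.single 1 b x)‖ ≤ C * ‖x‖) (f : lp X 1) : ‖D f‖ ≤ C * ‖f‖ :=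
  ((lpOne_hasSum_single f).mapL D).norm_le_of_bounded ((lpOne_hasSum_norm f).mul_left C)
    fun b => h b (f b)

end EllOneSum

section Duality

variable {Y Z : Type*} [NormedAddCommGroup Y] [NormedSpace ℝ Y]
  [NormedAddCommGroup Z] [NormedSpace ℝ Z]

/-- Every separable normed space embeds into `ℓ∞`. -/
theorem exists_embedding_ellInfty [TopologicalSpace.SeparableSpace Y] :
    ∃ θ : Y →L[ℝ] ellInfty, (∀ x, ‖θ x‖ ≤ ‖x‖) ∧ ∀ x, 1 / 2 * ‖x‖ ≤ ‖θ x‖ := by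
  let u := TopologicalSpace.denseSeq Y
  choose f hf hfu using fun k => exists_dual_vector'' ℝ (u k)
  have hle : ∀ x k, ‖f k x‖ ≤ ‖x‖ := fun x k => by
    simpa using (f k).le_of_opNorm_le (hf k) x
  have hmem : ∀ x, Memℓp (fun k => f k x) ⊤ := fun x =>
    memℓp_infty ⟨‖x‖, by rintro _ ⟨k, rfl⟩; exact hle x k⟩
  let L : Y →ₗ[ℝ] ellInfty :=
    { toFun := fun x => ⟨fun k => f k x, hmem x⟩
      map_add' := fun x y => by ext b; simp; rfl
      map_smul' := fun c x => by ext b; simp }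
  have hL : ∀ x, ‖L x‖ ≤ 1 * ‖x‖ := fun x =>
    lp.norm_le_of_forall_le (by positivity) fun k => by
      rw [one_mul]; exact hle x k
  refine ⟨L.mkContinuous 1 hL, fun x => by simpa using hL x, fun x => ?_⟩
  rcases eq_or_ne x 0 with rfl | hx
  · simp
  obtain ⟨_, hk, ⟨k, rfl⟩⟩ := Metric.dense_iff.1 (TopologicalSpace.denseRange_denseSeq Y) x
    (‖x‖ / 4) (by positivity)
  have hk' : ‖u k - x‖ < ‖x‖ / 4 := by simpa [dist_eq_norm] using hk
  have h1 : ‖f k x‖ ≤ ‖L x‖ := lp.norm_apply_le_norm (by simp) (L x) k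
  have h2 : ‖u k‖ ≤ ‖f k x‖ + ‖u k - x‖ := by
    have h3 : f k (u k) = ‖u k‖ := by simpa using hfu k
    have h4 : f k (u k) = f k x + f k (u k - x) := by simp
    have h5 := hle (u k - x) k
    rw [Real.norm_eq_abs] at h5 ⊢
    linarith [le_abs_self (f k x), le_abs_self (f k (u k - x))]
  have h6 : ‖x‖ ≤ ‖u k‖ + ‖u k - x‖ := by
    rw [norm_sub_rev]; exact norm_le_norm_add_norm_sub' x (u k)
  change _ ≤ ‖L x‖
  linarith

/-- An `ℓ∞`-valued operator dominated by `C‖R·‖ + ε‖·‖` lies within `ε` of an operator factoring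
through `R`. -/
theorem exists_factor_of_norm_le (R : Y →L[ℝ] Z) (U : Y →L[ℝ] ellInfty) (C ε : ℝ)
    (hC : 0 ≤ C) (hε : 0 ≤ ε) (h : ∀ x, ‖U x‖ ≤ C * ‖R x‖ + ε * ‖x‖) :
    ∃ S : Z →L[ℝ] ellInfty, ‖U - S.comp R‖ ≤ ε := by
  have key : ∀ k : ℕ, ∃ s : Z →ₗ[ℝ] ℝ, (∀ z, |s z| ≤ C * ‖z‖) ∧
      ∀ x, |U x k - s (R x)| ≤ ε * ‖x‖ := by
    intro k
    let u : Y →ₗ[ℝ] ℝ := (lp.evalₗ (𝕜 := ℝ) (fun _ : ℕ => ℝ) (p := ⊤) k).comp U.toLinearMap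
    have hu : ∀ x, u x = U x k := fun x => rfl
    let N : Z × Y → ℝ := fun p => C * ‖p.1‖ + ε * ‖p.2‖
    let Γ : Submodule ℝ (Z × Y) := LinearMap.range (R.toLinearMap.prod LinearMap.id)
    obtain ⟨g, hg, hgN⟩ := exists_extension_of_le_sublinear
      ⟨Γ, (u.comp (LinearMap.snd ℝ Z Y)).domRestrict Γ⟩ N
      (fun c hc p => by simp [N, norm_smul, abs_of_pos hc]; ring)
      (fun p q => by
        have h1 := mul_le_mul_of_nonneg_left (norm_add_le p.1 q.1) hC
        have h2 := mul_le_mul_of_nonneg_left (norm_add_le p.2 q.2) hε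
        simp only [N, Prod.fst_add, Prod.snd_add]; linarith)
      (by
        rintro ⟨_, x, rfl⟩
        change u x ≤ C * ‖R x‖ + ε * ‖x‖
        refine le_trans ?_ (h x)
        rw [hu]
        exact (le_abs_self _).trans (lp.norm_apply_le_norm (by simp) (U x) k))
    have hgabs : ∀ p, |g p| ≤ N p := fun p => abs_le'.2 ⟨hgN p, by
      simpa [N] using hgN (-p)⟩
    refine ⟨g.comp (LinearMap.inl ℝ Z Y), fun z => by simpa [N] using hgabs (z, 0), fun x => ?_⟩
    have h1 : g (R x, x) = U x k := hg ⟨(R x, x), ⟨x, rfl⟩⟩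
    have h2 : U x k - g (R x, 0) = g (0, x) := by
      rw [← h1, ← map_sub]; simp
    simpa [h2, N] using hgabs (0, x)
  choose s hs hsU using key
  have hmem : ∀ z, Memℓp (fun k => s k z) ⊤ := fun z =>
    memℓp_infty ⟨C * ‖z‖, by rintro _ ⟨k, rfl⟩; exact hs k z⟩
  let L : Z →ₗ[ℝ] ellInfty :=
    { toFun := fun z => ⟨fun k => s k z, hmem z⟩
      map_add' := fun x y => by ext b; simp; rfl
      map_smul' := fun c x => by ext b; simp }
  have hL : ∀ z, ‖L z‖ ≤ C * ‖z‖ := fun z =>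
    lp.norm_le_of_forall_le (by positivity) fun k => hs k z
  refine ⟨L.mkContinuous C hL, ContinuousLinearMap.opNorm_le_bound _ hε fun x => ?_⟩
  exact lp.norm_le_of_forall_le (by positivity) fun k => hsU k x

end Duality

section Selection

theorem sum_biUnion_le_sum_sum {α β : Type*} [DecidableEq β] (s : Finset α) (A : α → Finset β)
    (f : β → ℝ) (hf : ∀ b, 0 ≤ f b) : ∑ b ∈ s.biUnion A, f b ≤ ∑ a ∈ s, ∑ b ∈ A a, f b := by
  classical
  induction s using Finset.induction_on with
  | empty => simp
  | insert a s ha ih =>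
    rw [Finset.biUnion_insert, Finset.sum_insert ha]
    have h1 := Finset.sum_union_inter (s₁ := A a) (s₂ := s.biUnion A) (f := f)
    have h2 : 0 ≤ ∑ b ∈ A a ∩ s.biUnion A, f b := Finset.sum_nonneg fun b _ => hf b
    linarith

/-- Dichotomy for a family of measures on a finite set: either some members are large on pairwise
disjoint sets, or one measure controls the whole family. -/
theorem exists_disjoint_or_control {ι : Type*} [Fintype ι] (W : Set (ι → ℝ))
    (hW : ∀ w ∈ W, ∀ i, 0 ≤ w i) (K : ℝ) (hK0 : 0 ≤ K) (hK : ∀ w ∈ W, ∑ i, w i ≤ K)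
    (δ η : ℝ) (hη0 : 0 ≤ η) (k : ℕ) (hη : k * η ≤ δ) :
    (∃ (w : Fin k → ι → ℝ) (A : Fin k → Finset ι), (∀ j, w j ∈ W) ∧
      (∀ i j, i ≠ j → Disjoint (A i) (A j)) ∧ ∀ j, δ ≤ ∑ i ∈ A j, w j i) ∨
    ∃ p : ι → ℝ, (∀ i, 0 ≤ p i) ∧ ∑ i, p i ≤ k * K ∧
      ∀ A : Finset ι, ∑ i ∈ A, p i < η → ∀ w ∈ W, ∑ i ∈ A, w i ≤ 2 * δ := by
  classical
  refine or_iff_not_imp_right.2 fun h => ?_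
  push Not at h
  have chain : ∀ r ≤ k, ∃ (w : ℕ → ι → ℝ) (A : ℕ → Finset ι), ∀ j < r, w j ∈ W ∧
      2 * δ < ∑ i ∈ A j, w j i ∧ ∀ l < j, ∑ i ∈ A j, w l i < η := by
    intro r
    induction r with
    | zero => exact fun _ => ⟨0, fun _ => ∅, fun j hj => absurd hj (Nat.not_lt_zero j)⟩
    | succ r ih =>
      intro hr
      obtain ⟨w, A, hwA⟩ := ih (by omega)
      have hnn : ∀ l ∈ Finset.range r, ∀ i, 0 ≤ w l i := fun l hl i =>
        hW _ (hwA l (Finset.mem_range.1 hl)).1 i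
      obtain ⟨A', hA', w', hw', hA'w'⟩ := h (fun i => ∑ l ∈ Finset.range r, w l i)
        (fun i => Finset.sum_nonneg fun l hl => hnn l hl i) (by
          rw [Finset.sum_comm]
          calc ∑ l ∈ Finset.range r, ∑ i, w l i ≤ ∑ l ∈ Finset.range r, K :=
                Finset.sum_le_sum fun l hl => hK _ (hwA l (Finset.mem_range.1 hl)).1
            _ = r * K := by simp
            _ ≤ k * K := by gcongr; omega)
      refine ⟨Function.update w r w', Function.update A r A', fun j hj => ?_⟩
      rcases Nat.lt_succ_iff_lt_or_eq.1 hj with hj | rfl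
      · obtain ⟨h1, h2, h3⟩ := hwA j hj
        have hne : j ≠ r := hj.ne
        simp only [Function.update_of_ne hne]
        refine ⟨h1, h2, fun l hl => ?_⟩
        rw [Function.update_of_ne (hl.trans hj).ne]
        exact h3 l hl
      · simp only [Function.update_self]
        refine ⟨hw', hA'w', fun l hl => ?_⟩
        rw [Function.update_of_ne hl.ne]
        refine lt_of_le_of_lt (Finset.sum_le_sum fun i _ => ?_) hA'
        exact Finset.single_le_sum (f := fun l => w l i) (fun l hl => hnn l hl i)
          (Finset.mem_range.2 hl)
  obtain ⟨w, A, hwA⟩ := chain k le_rfl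
  refine ⟨fun j => w j, fun j => A j \ ((Finset.range k).filter fun s => (j : ℕ) < s).biUnion A,
    fun j => (hwA j j.2).1, ?_, fun j => ?_⟩
  · have aux : ∀ i j : Fin k, i < j →
        Disjoint (A i \ ((Finset.range k).filter fun s => (i : ℕ) < s).biUnion A)
          (A j \ ((Finset.range k).filter fun s => (j : ℕ) < s).biUnion A) := by
      intro i j hij
      rw [Finset.disjoint_left]
      intro x hx hx'
      refine (Finset.mem_sdiff.1 hx).2 (Finset.mem_biUnion.2 ⟨j, ?_, (Finset.mem_sdiff.1 hx').1⟩)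
      exact Finset.mem_filter.2 ⟨Finset.mem_range.2 j.2, hij⟩
    intro i j hij
    rcases lt_or_gt_of_ne hij with h | h
    · exact aux i j h
    · exact (aux j i h).symm
  · obtain ⟨h1, h2, -⟩ := hwA j j.2
    set B := ((Finset.range k).filter fun s => (j : ℕ) < s).biUnion A with hB
    have h3 : ∑ i ∈ B, w j i ≤ k * η := by
      calc ∑ i ∈ B, w j i
          ≤ ∑ s ∈ (Finset.range k).filter fun s => (j : ℕ) < s, ∑ i ∈ A s, w j i :=
            sum_biUnion_le_sum_sum _ _ _ (hW _ h1)
        _ ≤ ∑ s ∈ (Finset.range k).filter fun s => (j : ℕ) < s, η := by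
            refine Finset.sum_le_sum fun s hs => ?_
            obtain ⟨hs, hjs⟩ := Finset.mem_filter.1 hs
            exact ((hwA s (Finset.mem_range.1 hs)).2.2 j hjs).le
        _ ≤ ∑ s ∈ Finset.range k, η :=
            Finset.sum_le_sum_of_subset_of_nonneg (Finset.filter_subset _ _) fun _ _ _ => hη0
        _ = k * η := by simp
    have h4 : ∑ i ∈ A j, w j i ≤ ∑ i ∈ A j \ B, w j i + ∑ i ∈ B, w j i := by
      rw [← Finset.sum_union Finset.sdiff_disjoint]
      refine Finset.sum_le_sum_of_subset_of_nonneg (fun x hx => ?_) fun i _ _ => hW _ h1 i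
      simp [hx]
    linarith

/-- A nonnegative matrix with bounded row sums has a large submatrix with small off-diagonal
entries. -/
theorem exists_almost_diagonal {α : Type*} [DecidableEq α] (a : α → α → ℝ)
    (ha : ∀ i j, 0 ≤ a i j) (K t : ℝ) (ht : 0 < t) (D : ℕ) (hD : 2 * K / t + 1 ≤ D)
    (hD1 : 1 ≤ D) (m : ℕ) (F : Finset α) (hF : ∀ i ∈ F, ∑ j ∈ F, a i j ≤ K) (hm : m * D ≤ F.card) :
    ∃ J ⊆ F, J.card = m ∧ ∀ i ∈ J, ∀ j ∈ J, i ≠ j → a i j ≤ t := by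
  induction m generalizing F with
  | zero => exact ⟨∅, by simp, by simp, by simp⟩
  | succ m ih =>
    have hne : F.Nonempty := by
      rw [← Finset.card_pos]
      nlinarith
    obtain ⟨j, hj, hjK⟩ : ∃ j ∈ F, ∑ i ∈ F, (a i j + a j i) ≤ 2 * K := by
      refine Finset.exists_le_of_sum_le hne ?_
      have h1 : ∑ i ∈ F, ∑ j ∈ F, a i j ≤ ∑ i ∈ F, K := Finset.sum_le_sum hF
      have h2 : ∑ j ∈ F, ∑ i ∈ F, (a i j + a j i) = 2 * ∑ i ∈ F, ∑ j ∈ F, a i j := by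
        simp only [Finset.sum_add_distrib]
        rw [Finset.sum_comm]
        ring
      rw [h2, ← Finset.mul_sum]
      linarith
    set B := F.filter fun i => t < a i j + a j i with hB
    have hBc : (B.card : ℝ) * t ≤ 2 * K := by
      calc (B.card : ℝ) * t = ∑ i ∈ B, t := by simp
        _ ≤ ∑ i ∈ B, (a i j + a j i) :=
            Finset.sum_le_sum fun i hi => (Finset.mem_filter.1 hi).2.le
        _ ≤ ∑ i ∈ F, (a i j + a j i) :=
            Finset.sum_le_sum_of_subset_of_nonneg (Finset.filter_subset _ _)
              fun i _ _ => add_nonneg (ha _ _) (ha _ _)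
        _ ≤ 2 * K := hjK
    have hBD : B.card + 1 ≤ D := by
      have := (le_div_iff₀ ht).2 hBc
      exact_mod_cast (by linarith : (B.card : ℝ) + 1 ≤ D)
    have hsub : F \ insert j B ⊆ F := Finset.sdiff_subset
    obtain ⟨J, hJF, hJm, hJ⟩ := ih (F \ insert j B)
      (fun i hi => (Finset.sum_le_sum_of_subset_of_nonneg hsub fun _ _ _ => ha _ _).trans
        (hF i (hsub hi))) (by
        have h1 := Finset.le_card_sdiff (insert j B) F
        have h2 := Finset.card_insert_le j B
        have h3 : (m + 1) * D = m * D + D := by ring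
        omega)
    have hJ' : ∀ i ∈ J, i ∈ F ∧ i ≠ j ∧ a i j + a j i ≤ t := by
      intro i hi
      have h1 := Finset.mem_sdiff.1 (hJF hi)
      refine ⟨h1.1, fun h => h1.2 (by simp [h]), not_lt.1 fun h => h1.2 ?_⟩
      exact Finset.mem_insert_of_mem (Finset.mem_filter.2 ⟨h1.1, h⟩)
    have hjJ : j ∉ J := fun h => (hJ' j h).2.1 rfl
    refine ⟨insert j J, Finset.insert_subset hj (hJF.trans hsub), by
      rw [Finset.card_insert_of_notMem hjJ, hJm], fun x hx y hy hxy => ?_⟩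
    rcases Finset.mem_insert.1 hx with rfl | hxJ <;> rcases Finset.mem_insert.1 hy with rfl | hyJ
    · exact absurd rfl hxy
    · linarith [(hJ' y hyJ).2.2, ha y x]
    · linarith [(hJ' x hxJ).2.2, ha y x]
    · exact hJ x hxJ y hyJ hxy

end Selection

section GlidingHump

variable {X : ℕ → Type*} [∀ b, NormedAddCommGroup (X b)]

theorem lpOne_sum_single_apply (f : lp X 1) (s : Finset ℕ) (b : ℕ) :
    (∑ a ∈ s, lp.single 1 a (f a) : lp X 1) b = if b ∈ s then f b else 0 := by
  rw [lp.coeFn_sum, Finset.sum_apply]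
  split_ifs with hb
  · rw [Finset.sum_eq_single b, lp.single_apply_self]
    · exact fun a _ hab => lp.single_apply_ne _ _ _ hab.symm
    · exact fun h => absurd hb h
  · exact Finset.sum_eq_zero fun a ha => lp.single_apply_ne _ _ _ (by rintro rfl; exact hb ha)

theorem sum_sum_Ico_le (N : ℕ → ℕ) (hN : Monotone N) (g : ℕ → ℝ) (hg : ∀ b, 0 ≤ g b)
    (s : Finset ℕ) : ∃ M, ∑ l ∈ s, ∑ b ∈ Finset.Ico (N l) (N (l + 1)), g b ≤
      ∑ b ∈ Finset.range M, g b := by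
  obtain ⟨L, hL⟩ := s.exists_nat_subset_range
  have h : ∀ L, ∑ l ∈ Finset.range L, ∑ b ∈ Finset.Ico (N l) (N (l + 1)), g b =
      ∑ b ∈ Finset.Ico (N 0) (N L), g b := by
    intro L
    induction L with
    | zero => simp
    | succ L ih =>
      rw [Finset.sum_range_succ, ih,
        Finset.sum_Ico_consecutive _ (hN (Nat.zero_le L)) (hN (Nat.le_succ L))]
  refine ⟨N L, ?_⟩
  calc _ ≤ ∑ l ∈ Finset.range L, ∑ b ∈ Finset.Ico (N l) (N (l + 1)), g b :=
        Finset.sum_le_sum_of_subset_of_nonneg hL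
          fun _ _ _ => Finset.sum_nonneg fun b _ => hg b
    _ = ∑ b ∈ Finset.Ico (N 0) (N L), g b := h L
    _ ≤ _ := Finset.sum_le_sum_of_subset_of_nonneg
          (fun b hb => Finset.mem_range.2 (Finset.mem_Ico.1 hb).2) fun b _ _ => hg b

/-- If `T` almost factors the identity of each summand of an `ℓ¹`-sum arbitrarily far out, with
images almost supported on intervals, then `T` factors the identity of the whole sum. -/
theorem exists_factorization_of_local [∀ b, NormedSpace ℝ (X b)] [∀ b, CompleteSpace (X b)]
    (T : lp X 1 →L[ℝ] lp X 1) (C ε : ℝ) (hC : 0 ≤ C) (hε : C * ε + ε ≤ 1 / 2)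
    (h : ∀ l N : ℕ, ∃ N' ≥ N, ∃ (S : X l →L[ℝ] lp X 1) (G : lp X 1 →L[ℝ] X l),
      (∀ x, ‖S x‖ ≤ ‖x‖) ∧ (∀ y, ‖G y‖ ≤ C * ∑ b ∈ Finset.Ico N N', ‖y b‖) ∧
      (∀ x, ‖G (T (S x)) - x‖ ≤ ε * ‖x‖) ∧
      ∀ x, ‖T (S x)‖ - ∑ b ∈ Finset.Ico N N', ‖T (S x) b‖ ≤ ε * ‖x‖) :
    ∃ R S : lp X 1 →L[ℝ] lp X 1, ContinuousLinearMap.id ℝ (lp X 1) = R.comp (T.comp S) := by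
  classical
  choose N' hN' S G hS hG hGT hT using h
  let N : ℕ → ℕ := fun l => Nat.rec 0 (fun l n => N' l n) l
  have hNs : ∀ l, N (l + 1) = N' l (N l) := fun l => rfl
  have hN : Monotone N := monotone_nat_of_le_succ fun l => hN' l (N l)
  obtain ⟨V, hV⟩ := exists_lpOne_extension (fun l => S l (N l)) 1
    (fun l x => by rw [one_mul]; exact hS l (N l) x)
  obtain ⟨R, hR, hRn⟩ := exists_to_lpOne (fun l => G l (N l)) C hC (fun z s => by
    obtain ⟨M, hM⟩ := sum_sum_Ico_le N hN (fun b => ‖z b‖) (fun b => norm_nonneg _) s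
    calc ∑ l ∈ s, ‖G l (N l) z‖
        ≤ ∑ l ∈ s, C * ∑ b ∈ Finset.Ico (N l) (N (l + 1)), ‖z b‖ :=
          Finset.sum_le_sum fun l _ => hG l (N l) z
      _ ≤ C * ∑ b ∈ Finset.range M, ‖z b‖ := by
          rw [← Finset.mul_sum]; exact mul_le_mul_of_nonneg_left hM hC
      _ ≤ C * ‖z‖ := mul_le_mul_of_nonneg_left (lpOne_sum_norm_le z _) hC)
  have hbound : ∀ l x, ‖(1 - R.comp (T.comp V)) (lp.single 1 l x)‖ ≤ 1 / 2 * ‖x‖ := by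
    intro l x
    set y := T (S l (N l) x) with hy
    set q : lp X 1 := ∑ b ∈ Finset.Ico (N l) (N (l + 1)), lp.single 1 b (y b) with hq
    have hqb : ∀ b, q b = if b ∈ Finset.Ico (N l) (N (l + 1)) then y b else 0 :=
      lpOne_sum_single_apply y _
    have hG0 : ∀ m (z : lp X 1), (∀ b ∈ Finset.Ico (N m) (N (m + 1)), z b = 0) →
        G m (N m) z = 0 := by
      intro m z hz
      rw [← norm_le_zero_iff]
      refine (hG m (N m) z).trans (le_of_eq ?_)
      rw [← hNs, Finset.sum_eq_zero fun b hb => by rw [hz b hb, norm_zero], mul_zero]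
    have hyq : ‖y - q‖ ≤ ε * ‖x‖ := by
      rw [hq, lpOne_norm_sub_sum]
      exact hT l (N l) x
    have hRq : R q = lp.single 1 l (G l (N l) y) := by
      ext1
      funext m
      rw [hR]
      rcases eq_or_ne m l with rfl | hml
      · rw [lp.single_apply_self, ← sub_eq_zero, ← map_sub]
        refine hG0 m _ fun b hb => ?_
        rw [lp.coeFn_sub, Pi.sub_apply, hqb, if_pos hb, sub_self]
      · rw [lp.single_apply_ne _ _ _ hml]
        refine hG0 m _ fun b hb => ?_
        rw [hqb, if_neg]
        intro hb'
        rw [Finset.mem_Ico] at hb hb'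
        rcases lt_or_gt_of_ne hml with h | h
        · have := hN (Nat.succ_le_of_lt h); grind
        · have := hN (Nat.succ_le_of_lt h); grind
    have hexp : (1 - R.comp (T.comp V)) (lp.single 1 l x) =
        -(R (y - q) + lp.single 1 l (G l (N l) y - x)) := by
      rw [map_sub, hRq, lp.single_sub]
      simp only [sub_apply, one_apply_eq_self,
        ContinuousLinearMap.comp_apply, hV, ← hy]
      abel
    rw [hexp, norm_neg]
    have h1 : ‖R (y - q)‖ ≤ C * (ε * ‖x‖) :=
      (hRn _).trans (mul_le_mul_of_nonneg_left hyq hC)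
    have h2 : ‖(lp.single 1 l (G l (N l) y - x) : lp X 1)‖ ≤ ε * ‖x‖ := by
      rw [lp.norm_single (by simp)]
      exact hGT l (N l) x
    have h3 := mul_le_mul_of_nonneg_right hε (norm_nonneg x)
    linarith [norm_add_le (R (y - q)) (lp.single 1 l (G l (N l) y - x) : lp X 1)]
  have hlt : ‖1 - R.comp (T.comp V)‖ < 1 :=
    (ContinuousLinearMap.opNorm_le_bound _ (by norm_num)
      (norm_le_of_norm_single_le _ _ hbound)).trans_lt (by norm_num)
  let u := Units.oneSub (1 - R.comp (T.comp V)) hlt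
  have hu : (u : lp X 1 →L[ℝ] lp X 1) = R.comp (T.comp V) := by simp [u]
  refine ⟨(↑u⁻¹ : lp X 1 →L[ℝ] lp X 1).comp R, V, ?_⟩
  rw [ContinuousLinearMap.comp_assoc, ← hu]
  exact (Units.inv_mul u).symm

end GlidingHump

section Blocks

/-- The summand `ℓ∞(n + 1)` of `E`. -/
abbrev Block (n : ℕ) : Type := PiLp ⊤ (fun _ : Fin (n + 1) => ℝ)

theorem block_abs_apply_le {n : ℕ} (x : Block n) (i : Fin (n + 1)) : |x i| ≤ ‖x‖ :=
  PiLp.norm_apply_le x i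

theorem block_norm_le {n : ℕ} (x : Block n) (M : ℝ) (h : ∀ i, |x i| ≤ M) : ‖x‖ ≤ M := by
  rw [PiLp.norm_eq_ciSup]
  exact ciSup_le h

theorem block_norm_le_sum {n : ℕ} (x : Block n) : ‖x‖ ≤ ∑ i, |x i| :=
  block_norm_le x _ fun i =>
    Finset.single_le_sum (f := fun i => |x i|) (fun _ _ => abs_nonneg _) (Finset.mem_univ i)

theorem block_eq_sum {n : ℕ} (x : Block n) :
    x = ∑ i, x i • (WithLp.toLp ⊤ (Pi.single i 1) : Block n) := by
  ext i
  simp [Pi.single_apply]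

end Blocks

section LocalFactorization

variable {Y Z : Type*} [NormedAddCommGroup Y] [NormedSpace ℝ Y]
  [NormedAddCommGroup Z] [NormedSpace ℝ Z]

/-- The vectors `v j` are dominated by the unit vector basis of a finite-dimensional `ℓ∞`. -/
def SupDominated {k : ℕ} (v : Fin k → Y) : Prop :=
  ∀ (c : Fin k → ℝ) (M : ℝ), 0 ≤ M → (∀ j, |c j| ≤ M) → ‖∑ j, c j • v j‖ ≤ M

theorem SupDominated.comp_injective {k m : ℕ} {v : Fin k → Y} (hv : SupDominated v)
    (σ : Fin m → Fin k) (hσ : Function.Injective σ) : SupDominated (v ∘ σ) := by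
  intro c M hM hc
  have h : ∑ j, c j • (v ∘ σ) j = ∑ j, Function.extend σ c 0 j • v j := by
    refine Fintype.sum_of_injective σ hσ _ _ (fun i hi => ?_) fun j => ?_
    · rw [Function.extend_apply' _ _ _ (by simpa using hi)]; simp
    · rw [hσ.extend_apply]; rfl
  rw [h]
  refine hv _ M hM fun j => ?_
  by_cases hj : ∃ i, σ i = j
  · obtain ⟨i, rfl⟩ := hj
    rw [hσ.extend_apply]; exact hc i
  · rw [Function.extend_apply' _ _ _ hj]; simpa using hM

theorem SupDominated.sum_abs_le {k : ℕ} {v : Fin k → Y} (hv : SupDominated v)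
    (T : Y →L[ℝ] Z) (g : Z →L[ℝ] ℝ) (hg : ‖g‖ ≤ 1) : ∑ j, |g (T (v j))| ≤ ‖T‖ := by
  set c : Fin k → ℝ := fun j => SignType.sign (g (T (v j))) with hc
  have hc1 : ∀ j, |c j| ≤ 1 := fun j => by
    rcases lt_trichotomy (g (T (v j))) 0 with h | h | h <;> simp [hc, h]
  have h1 : ∑ j, |g (T (v j))| = g (T (∑ j, c j • v j)) := by
    simp only [map_sum, map_smul, smul_eq_mul, hc, sign_mul_self]
  rw [h1]
  calc g (T (∑ j, c j • v j)) ≤ ‖g (T (∑ j, c j • v j))‖ := le_abs_self _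
    _ ≤ ‖g‖ * (‖T‖ * ‖∑ j, c j • v j‖) :=
        (g.le_opNorm _).trans (mul_le_mul_of_nonneg_left (T.le_opNorm _) (norm_nonneg _))
    _ ≤ 1 * (‖T‖ * 1) := by
        gcongr
        exact hv c 1 zero_le_one hc1
    _ = ‖T‖ := by ring

/-- `T` has, for every `k`, a `k`-tuple of vectors dominated by the basis of `ℓ∞(k)` whose images
are bounded below by `δ`. -/
def LargeOnSupDominated (T : Y →L[ℝ] Z) (δ : ℝ) : Prop :=
  ∀ k : ℕ, ∃ (v : Fin k → Y) (f : Fin k → Z →L[ℝ] ℝ), SupDominated v ∧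
    (∀ j, ‖f j‖ ≤ 1) ∧ ∀ j, δ ≤ f j (T (v j))

/-- The tuples may be chosen almost biorthogonal and almost killed by a given finite family of
functionals. -/
theorem LargeOnSupDominated.exists_almost_biorthogonal {T : Y →L[ℝ] Z} {δ : ℝ}
    (h : LargeOnSupDominated T δ) {β : Type*} (B : Finset β) (φ : β → Z →L[ℝ] ℝ)
    (hφ : ∀ b, ‖φ b‖ ≤ 1) (m : ℕ) (η : ℝ) (hη : 0 < η) :
    ∃ (v : Fin m → Y) (f : Fin m → Z →L[ℝ] ℝ), SupDominated v ∧
      (∀ j, ‖f j‖ ≤ 1) ∧ (∀ j, δ ≤ f j (T (v j))) ∧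
      (∀ i j, i ≠ j → |f i (T (v j))| ≤ η) ∧ ∀ j, ∑ b ∈ B, |φ b (T (v j))| ≤ η := by
  classical
  obtain ⟨D, hD⟩ := exists_nat_ge (2 * ‖T‖ / η + 1)
  obtain ⟨P, hP⟩ := exists_nat_ge (B.card * ‖T‖ / η)
  obtain ⟨v, f, hv, hf, hfv⟩ := h (m * D + P)
  set s : Fin (m * D + P) → ℝ := fun j => ∑ b ∈ B, |φ b (T (v j))| with hs
  have hs0 : ∀ j, 0 ≤ s j := fun j => Finset.sum_nonneg fun _ _ => abs_nonneg _
  have hsum : ∑ j, s j ≤ B.card * ‖T‖ := by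
    rw [hs, Finset.sum_comm]
    calc _ ≤ ∑ b ∈ B, ‖T‖ := Finset.sum_le_sum fun b _ => hv.sum_abs_le T (φ b) (hφ b)
      _ = _ := by simp
  set F : Finset (Fin (m * D + P)) := Finset.univ.filter fun j => s j ≤ η with hF
  have hFc : m * D ≤ F.card := by
    have h1 : (((Finset.univ.filter fun j => ¬ s j ≤ η).card : ℕ) : ℝ) * η ≤ B.card * ‖T‖ := by
      refine le_trans ?_ hsum
      calc _ = ∑ j ∈ Finset.univ.filter fun j => ¬ s j ≤ η, η := by simp
        _ ≤ ∑ j ∈ Finset.univ.filter fun j => ¬ s j ≤ η, s j :=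
            Finset.sum_le_sum fun j hj => (not_le.1 (Finset.mem_filter.1 hj).2).le
        _ ≤ _ := Finset.sum_le_sum_of_subset_of_nonneg (Finset.filter_subset _ _)
            fun j _ _ => hs0 j
    have h2 : (Finset.univ.filter fun j => ¬ s j ≤ η).card ≤ P := by
      exact_mod_cast ((le_div_iff₀ hη).2 h1).trans hP
    have h3 : F.card + (Finset.univ.filter fun j => ¬ s j ≤ η).card = m * D + P :=
      (Finset.card_filter_add_card_filter_not _).trans (by simp)
    omega
  have hD1 : 1 ≤ D := by
    have : (1 : ℝ) ≤ D := by
      have : 0 ≤ 2 * ‖T‖ / η := by positivity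
      linarith
    exact_mod_cast this
  obtain ⟨J, hJF, hJm, hJ⟩ := exists_almost_diagonal (fun i j => |f i (T (v j))|)
    (fun _ _ => abs_nonneg _) ‖T‖ η hη D hD hD1 m F (fun i _ =>
      (Finset.sum_le_univ_sum_of_nonneg fun _ => abs_nonneg _).trans
        (hv.sum_abs_le T (f i) (hf i))) hFc
  let σ := J.orderEmbOfFin hJm
  have hσ : ∀ i, σ i ∈ J := fun i => J.orderEmbOfFin_mem hJm i
  refine ⟨v ∘ σ, f ∘ σ, hv.comp_injective σ σ.injective, fun j => hf _, fun j => hfv _,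
    fun i j hij => hJ _ (hσ i) _ (hσ j) (σ.injective.ne hij), fun j => ?_⟩
  exact (Finset.mem_filter.1 (hJF (hσ j))).2

/-- Local factorization far out in the `ℓ¹`-sum. -/
theorem LargeOnSupDominated.exists_local_factorization {T : Y →L[ℝ] ESpace} {δ : ℝ} (hδ : 0 < δ)
    (h : LargeOnSupDominated T δ) (ε : ℝ) (hε : 0 < ε) (l N : ℕ) :
    ∃ N' ≥ N, ∃ (S : Block l →L[ℝ] Y) (G : ESpace →L[ℝ] Block l),
      (∀ x, ‖S x‖ ≤ ‖x‖) ∧ (∀ y, ‖G y‖ ≤ 1 / δ * ∑ b ∈ Finset.Ico N N', ‖y b‖) ∧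
      (∀ x, ‖G (T (S x)) - x‖ ≤ ε * ‖x‖) ∧
      ∀ x, ‖T (S x)‖ - ∑ b ∈ Finset.Ico N N', ‖T (S x) b‖ ≤ ε * ‖x‖ := by
  classical
  obtain ⟨η, hη, hη1, hη2⟩ : ∃ η : ℝ, 0 < η ∧ (l + 1) * (3 * η) ≤ ε ∧
      (l + 1) * (3 * η) ≤ ε * δ := by
    refine ⟨min ε (ε * δ) / (3 * (l + 1)), by positivity, ?_, ?_⟩ <;>
    · have h1 : ((l : ℝ) + 1) * (3 * (min ε (ε * δ) / (3 * (l + 1)))) = min ε (ε * δ) := by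
        field_simp
      rw [h1]
      simp
  let φ : (Σ b : ℕ, Fin (b + 1)) → ESpace →L[ℝ] ℝ := fun p =>
    (PiLp.proj ⊤ (fun _ : Fin (p.1 + 1) => ℝ) p.2 : Block p.1 →L[ℝ] ℝ).comp
      (lp.evalCLM ℝ Block 1 p.1)
  have hφa : ∀ p (y : ESpace), φ p y = y p.1 p.2 := fun p y => rfl
  have hφ : ∀ p, ‖φ p‖ ≤ 1 := fun p =>
    ContinuousLinearMap.opNorm_le_bound _ zero_le_one fun y => by
      rw [one_mul]
      exact (block_abs_apply_le (y p.1) p.2).trans (lp.norm_apply_le_norm (by simp) y p.1)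
  obtain ⟨v, f, hv, hf, hfv, hoff, hhead⟩ := h.exists_almost_biorthogonal
    ((Finset.range N).sigma fun b => (Finset.univ : Finset (Fin (b + 1)))) φ hφ (l + 1) η hη
  have hhead' : ∀ j, ∑ b ∈ Finset.range N, ‖T (v j) b‖ ≤ η := fun j => by
    refine le_trans (Finset.sum_le_sum fun b _ => block_norm_le_sum _) ?_
    refine le_trans (le_of_eq ?_) (hhead j)
    rw [Finset.sum_sigma]
    rfl
  obtain ⟨N', hNN', hN'⟩ : ∃ N' ≥ N, ∀ j, ‖T (v j)‖ - ∑ b ∈ Finset.range N', ‖T (v j) b‖ ≤ η := by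
    have h1 : ∀ᶠ n in atTop, ∀ j, ‖T (v j)‖ - η < ∑ b ∈ Finset.range n, ‖T (v j) b‖ :=
      Filter.eventually_all.2 fun j =>
        (lpOne_hasSum_norm (T (v j))).tendsto_sum_nat.eventually_const_lt (by linarith)
    obtain ⟨n, hn, hn'⟩ := (h1.and (eventually_ge_atTop N)).exists
    exact ⟨n, hn', fun j => by linarith [hn j]⟩
  set I := Finset.Ico N N' with hI
  let Q : ESpace →L[ℝ] ESpace := ∑ b ∈ I, (lp.singleContinuousLinearMap ℝ Block 1 b).comp
    (lp.evalCLM ℝ Block 1 b)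
  have hQa : ∀ y, Q y = ∑ b ∈ I, lp.single 1 b (y b) := fun y => by
    simp [Q]; rfl
  have hQ : ∀ y, ‖Q y‖ ≤ ∑ b ∈ I, ‖y b‖ := fun y => by
    rw [hQa]
    refine (norm_sum_le _ _).trans (le_of_eq (Finset.sum_congr rfl fun b _ => ?_))
    exact lp.norm_single (by simp) _ _
  have hQc : ∀ y, ‖y - Q y‖ = ‖y‖ - ∑ b ∈ I, ‖y b‖ := fun y => by
    rw [hQa, lpOne_norm_sub_sum]
  have hvQ : ∀ j, ‖T (v j) - Q (T (v j))‖ ≤ 2 * η := fun j => by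
    rw [hQc]
    have h1 := Finset.sum_range_add_sum_Ico (fun b => ‖T (v j) b‖) hNN'
    linarith [hhead' j, hN' j]
  have hd : ∀ i, 0 < f i (T (v i)) := fun i => hδ.trans_le (hfv i)
  let S : Block l →L[ℝ] Y := ∑ j, (PiLp.proj ⊤ (fun _ : Fin (l + 1) => ℝ) j).smulRight (v j)
  have hSa : ∀ x, S x = ∑ j, x j • v j := fun x => by simp [S]
  let G : ESpace →L[ℝ] Block l :=
    ((PiLp.continuousLinearEquiv ⊤ ℝ (fun _ : Fin (l + 1) => ℝ)).symm :
      (Fin (l + 1) → ℝ) →L[ℝ] Block l).comp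
      (ContinuousLinearMap.pi fun i => (f i (T (v i)))⁻¹ • (f i).comp Q)
  have hGa : ∀ y i, G y i = (f i (T (v i)))⁻¹ * f i (Q y) := fun y i => rfl
  have hTS : ∀ x, ‖T (S x) - Q (T (S x))‖ ≤ (l + 1) * (2 * η) * ‖x‖ := fun x => by
    have h1 : T (S x) - Q (T (S x)) = ∑ j, x j • (T (v j) - Q (T (v j))) := by
      simp [hSa, smul_sub]
    rw [h1]
    calc _ ≤ ∑ j : Fin (l + 1), ‖x‖ * (2 * η) := norm_sum_le_of_le _ fun j _ => by
          rw [norm_smul]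
          exact mul_le_mul (block_abs_apply_le x j) (hvQ j) (norm_nonneg _) (norm_nonneg _)
      _ = _ := by simp; ring
  refine ⟨N', hNN', S, G, fun x => ?_, fun y => ?_, fun x => ?_, fun x => ?_⟩
  · rw [hSa]
    exact hv _ _ (norm_nonneg x) (block_abs_apply_le x)
  · refine block_norm_le _ _ fun i => ?_
    rw [hGa, abs_mul, abs_inv, abs_of_pos (hd i), ← one_div]
    have h1 : |f i (Q y)| ≤ ∑ b ∈ I, ‖y b‖ := by
      simpa using ((f i).le_of_opNorm_le (hf i) (Q y)).trans (by simpa using hQ y)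
    exact mul_le_mul (one_div_le_one_div_of_le hδ (hfv i)) h1 (abs_nonneg _) (by positivity)
  · refine block_norm_le _ _ fun i => ?_
    have h1 : f i (T (S x)) = x i * f i (T (v i)) + ∑ j ∈ Finset.univ.erase i,
        x j * f i (T (v j)) := by
      rw [Finset.add_sum_erase _ (fun j => x j * f i (T (v j))) (Finset.mem_univ i)]
      simp [hSa]
    have h2 : |∑ j ∈ Finset.univ.erase i, x j * f i (T (v j))| ≤ (l + 1) * η * ‖x‖ := by
      calc _ ≤ ∑ j ∈ Finset.univ.erase i, ‖x‖ * η := Finset.abs_sum_le_sum_abs _ _ |>.trans <|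
            Finset.sum_le_sum fun j hj => by
              rw [abs_mul]
              exact mul_le_mul (block_abs_apply_le x j)
                (hoff i j (Finset.ne_of_mem_erase hj).symm) (abs_nonneg _) (norm_nonneg _)
        _ ≤ ∑ j : Fin (l + 1), ‖x‖ * η :=
            Finset.sum_le_sum_of_subset_of_nonneg (Finset.subset_univ _)
              fun _ _ _ => by positivity
        _ = _ := by simp; ring
    have h3 : |f i (T (S x) - Q (T (S x)))| ≤ (l + 1) * (2 * η) * ‖x‖ := by
      refine ((f i).le_of_opNorm_le (hf i) _).trans ?_
      rw [one_mul]
      exact hTS x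
    have h4 : (G (T (S x)) - x) i = (f i (T (v i)))⁻¹ *
        ((∑ j ∈ Finset.univ.erase i, x j * f i (T (v j))) - f i (T (S x) - Q (T (S x)))) := by
      rw [PiLp.sub_apply, hGa, map_sub, h1]
      field_simp [(hd i).ne']
      ring
    rw [h4, abs_mul, abs_inv, abs_of_pos (hd i), inv_mul_le_iff₀ (hd i)]
    have h5 := mul_le_mul_of_nonneg_right hη2 (norm_nonneg x)
    have h6 : ε * δ * ‖x‖ ≤ f i (T (v i)) * (ε * ‖x‖) := by
      have := mul_le_mul_of_nonneg_right (hfv i) (by positivity : 0 ≤ ε * ‖x‖)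
      linarith
    refine (abs_sub _ _).trans ?_
    linarith
  · rw [← hQc]
    refine (hTS x).trans (mul_le_mul_of_nonneg_right ?_ (norm_nonneg x))
    have : 0 ≤ ((l : ℝ) + 1) * η := by positivity
    linarith

end LocalFactorization

section Control

/-- An operator dominated blockwise by `L¹`-seminorms of uniformly bounded measures, up to `ε`,
belongs to `G^i_{ℓ¹}`. -/
theorem mem_GiEllOne_of_control (T : ESpace →L[ℝ] ESpace)
    (h : ∀ ε > (0 : ℝ), ∃ C L : ℝ, 0 ≤ C ∧ 0 ≤ L ∧ ∀ n, ∃ p : Fin (n + 1) → ℝ, (∀ i, 0 ≤ p i) ∧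
      ∑ i, p i ≤ L ∧ ∀ x : Block n,
        ‖T (lp.single 1 n x)‖ ≤ C * ∑ i, p i * |x i| + ε * ‖x‖) :
    T ∈ GiEllOne ESpace := by
  classical
  have : TopologicalSpace.SeparableSpace ESpace := lpOne_separableSpace (X := Block)
  obtain ⟨θ, hθ1, hθ2⟩ := exists_embedding_ellInfty (Y := ESpace)
  refine ⟨θ, ⟨1 / 2, by norm_num, hθ2⟩, Metric.mem_closure_iff.2 fun ε hε => ?_⟩
  obtain ⟨C, L, hC, hL, hp⟩ := h (ε / 2) (by positivity)
  choose p hp0 hpL hpT using hp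
  have : Infinite (Σ n : ℕ, Fin (n + 1)) :=
    Infinite.of_injective (fun n => ⟨n, 0⟩) fun a b hab => congrArg Sigma.fst hab
  obtain ⟨e⟩ := nonempty_equiv_of_countable (α := ℕ) (β := Σ n : ℕ, Fin (n + 1))
  let ψ : (Σ n : ℕ, Fin (n + 1)) → ESpace →L[ℝ] ℝ := fun q =>
    p q.1 q.2 • (PiLp.proj ⊤ (fun _ : Fin (q.1 + 1) => ℝ) q.2 : Block q.1 →L[ℝ] ℝ).comp
      (lp.evalCLM ℝ Block 1 q.1)
  have hψ : ∀ q (x : ESpace), ‖ψ q x‖ = p q.1 q.2 * |x q.1 q.2| := fun q x => by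
    change |p q.1 q.2 * x q.1 q.2| = _
    rw [abs_mul, abs_of_nonneg (hp0 _ _)]
  have hblock : ∀ (x : ESpace) n, ∑ i, p n i * |x n i| ≤ L * ‖x n‖ := fun x n => by
    calc ∑ i, p n i * |x n i| ≤ ∑ i, p n i * ‖x n‖ := Finset.sum_le_sum fun i _ =>
          mul_le_mul_of_nonneg_left (block_abs_apply_le _ _) (hp0 n i)
      _ ≤ L * ‖x n‖ := by
          rw [← Finset.sum_mul]
          exact mul_le_mul_of_nonneg_right (hpL n) (norm_nonneg _)
  obtain ⟨R, hR, -⟩ := exists_to_lpOne (X := fun _ => ℝ) (fun k => ψ (e k)) L hL (fun x s => by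
    obtain ⟨M, hM⟩ := ((s.map e.toEmbedding).image Sigma.fst).exists_nat_subset_range
    calc ∑ k ∈ s, ‖ψ (e k) x‖ = ∑ q ∈ s.map e.toEmbedding, ‖ψ q x‖ := by
          rw [Finset.sum_map]; rfl
      _ ≤ ∑ q ∈ (Finset.range M).sigma fun _ => Finset.univ, ‖ψ q x‖ :=
          Finset.sum_le_sum_of_subset_of_nonneg (fun q hq => Finset.mem_sigma.2
            ⟨hM (Finset.mem_image_of_mem _ hq), Finset.mem_univ _⟩) fun _ _ _ => norm_nonneg _
      _ = ∑ n ∈ Finset.range M, ∑ i, p n i * |x n i| := by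
          rw [Finset.sum_sigma]; simp only [hψ]
      _ ≤ ∑ n ∈ Finset.range M, L * ‖x n‖ := Finset.sum_le_sum fun n _ => hblock x n
      _ ≤ L * ‖x‖ := by
          rw [← Finset.mul_sum]
          exact mul_le_mul_of_nonneg_left (lpOne_sum_norm_le x _) hL)
  have hRsum : ∀ (x : ESpace) (s : Finset ℕ), ∑ n ∈ s, ∑ i, p n i * |x n i| ≤ ‖R x‖ := by
    intro x s
    calc ∑ n ∈ s, ∑ i, p n i * |x n i|
        = ∑ q ∈ s.sigma fun _ => Finset.univ, ‖ψ q x‖ := by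
          rw [Finset.sum_sigma]; simp only [hψ]
      _ = ∑ k ∈ (s.sigma fun _ => Finset.univ).map e.symm.toEmbedding, ‖R x k‖ := by
          rw [Finset.sum_map]
          refine Finset.sum_congr rfl fun q _ => ?_
          rw [hR]; simp
      _ ≤ ‖R x‖ := lpOne_sum_norm_le (X := fun _ => ℝ) (R x) _
  have hT : ∀ x, ‖θ.comp T x‖ ≤ C * ‖R x‖ + ε / 2 * ‖x‖ := by
    intro x
    refine (hθ1 (T x)).trans ?_
    refine le_of_tendsto ((lpOne_hasSum_single x).mapL T).norm (Eventually.of_forall fun s => ?_)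
    calc ‖∑ n ∈ s, T (lp.single 1 n (x n))‖
        ≤ ∑ n ∈ s, (C * ∑ i, p n i * |x n i| + ε / 2 * ‖x n‖) :=
          norm_sum_le_of_le _ fun n _ => hpT n (x n)
      _ = C * ∑ n ∈ s, ∑ i, p n i * |x n i| + ε / 2 * ∑ n ∈ s, ‖x n‖ := by
          rw [Finset.sum_add_distrib, Finset.mul_sum, Finset.mul_sum]
      _ ≤ C * ‖R x‖ + ε / 2 * ‖x‖ := add_le_add
          (mul_le_mul_of_nonneg_left (hRsum x s) hC)
          (mul_le_mul_of_nonneg_left (lpOne_sum_norm_le x s) (by positivity))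
  obtain ⟨S, hS⟩ := exists_factor_of_norm_le R (θ.comp T) C (ε / 2) hC (by positivity) hT
  refine ⟨S.comp R, ⟨R, S, rfl⟩, ?_⟩
  rw [dist_eq_norm]
  linarith

theorem supDominated_single {n k : ℕ} (x : Fin k → Block n) (hx : ∀ i, ∑ j, |x j i| ≤ 1) :
    SupDominated fun j => (lp.single 1 n (x j) : ESpace) := by
  intro c M hM hc
  have h1 : ∑ j, c j • (lp.single 1 n (x j) : ESpace) = lp.single 1 n (∑ j, c j • x j) := by
    have := map_sum (lp.singleContinuousLinearMap ℝ Block 1 n) (fun j => c j • x j) Finset.univ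
    simp only [map_smul, lp.singleContinuousLinearMap_apply] at this
    exact this.symm
  rw [h1, lp.norm_single (by simp)]
  refine block_norm_le _ _ fun i => ?_
  have h2 : (∑ j, c j • x j) i = ∑ j, c j * x j i := by simp
  rw [h2]
  calc |∑ j, c j * x j i| ≤ ∑ j, M * |x j i| := (Finset.abs_sum_le_sum_abs _ _).trans <|
        Finset.sum_le_sum fun j _ => by
          rw [abs_mul]; exact mul_le_mul_of_nonneg_right (hc j) (abs_nonneg _)
    _ ≤ M := by
        rw [← Finset.mul_sum]
        exact mul_le_of_le_one_right hM (hx i)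

/-- The unit vectors of the `n`-th summand of `E`. -/
def unitVec (n : ℕ) (i : Fin (n + 1)) : ESpace :=
  lp.single 1 n (WithLp.toLp ⊤ (Pi.single i 1))

theorem single_eq_sum_unitVec {n : ℕ} (x : Block n) :
    (lp.single 1 n x : ESpace) = ∑ i, x i • unitVec n i := by
  conv_lhs => rw [block_eq_sum x]
  have := map_sum (lp.singleContinuousLinearMap ℝ Block 1 n)
    (fun i => x i • (WithLp.toLp ⊤ (Pi.single i 1) : Block n)) Finset.univ
  simp only [map_smul, lp.singleContinuousLinearMap_apply] at this
  exact this

theorem supDominated_unitVec (n : ℕ) : SupDominated (unitVec n) :=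
  supDominated_single (fun i => WithLp.toLp ⊤ (Pi.single i 1)) fun i => by
    refine le_of_eq ?_
    rw [Finset.sum_eq_single i]
    · simp
    · intro j _ hj
      simp [hj.symm]
    · simp

/-- Functionals which are large on disjoint sets of unit vectors give tuples dominated by the basis
of `ℓ∞(k)` with large images. -/
theorem exists_supDominated_of_disjoint {Z : Type*} [NormedAddCommGroup Z] [NormedSpace ℝ Z]
    (T : ESpace →L[ℝ] Z) {n k : ℕ} (f : Fin k → Z →L[ℝ] ℝ)
    (A : Fin k → Finset (Fin (n + 1))) (hA : ∀ i j, i ≠ j → Disjoint (A i) (A j)) (δ : ℝ)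
    (hδ : ∀ j, δ ≤ ∑ i ∈ A j, |f j (T (unitVec n i))|) :
    ∃ v : Fin k → ESpace, SupDominated v ∧ ∀ j, δ ≤ f j (T (v j)) := by
  classical
  let x : Fin k → Block n := fun j => WithLp.toLp ⊤ fun i =>
    if i ∈ A j then (SignType.sign (f j (T (unitVec n i))) : ℝ) else 0
  have hxa : ∀ j i, x j i =
    if i ∈ A j then (SignType.sign (f j (T (unitVec n i))) : ℝ) else 0 := fun _ _ => rfl
  refine ⟨fun j => lp.single 1 n (x j), supDominated_single x fun i => ?_, fun j => ?_⟩
  · have hle : ∀ j, |x j i| ≤ 1 := fun j => by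
      rw [hxa]
      split_ifs
      · rcases lt_trichotomy (f j (T (unitVec n i))) 0 with h | h | h <;> simp [h]
      · simp
    by_cases h : ∃ j, i ∈ A j
    · obtain ⟨j, hj⟩ := h
      rw [Finset.sum_eq_single j]
      · exact hle j
      · intro j' _ hj'
        rw [hxa, if_neg (Finset.disjoint_left.1 (hA j j' hj'.symm) hj), abs_zero]
      · simp
    · push Not at h
      simp [hxa, h]
  · refine (hδ j).trans (le_of_eq ?_)
    change _ = f j (T (lp.single 1 n (x j)))
    rw [single_eq_sum_unitVec]
    simp only [map_sum, map_smul, smul_eq_mul, hxa, ite_mul, zero_mul, sign_mul_self]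
    rw [Finset.sum_ite_mem, Finset.univ_inter]

/-- If the functionals of `T` are uniformly absolutely continuous with respect to `p`, then `T` is
dominated by the `L¹(p)`-seminorm up to a small multiple of the norm. -/
theorem norm_single_le_of_control {Z : Type*} [NormedAddCommGroup Z] [NormedSpace ℝ Z]
    (T : ESpace →L[ℝ] Z) {n : ℕ} (p : Fin (n + 1) → ℝ) (hp : ∀ i, 0 ≤ p i) (δ η : ℝ)
    (hδ : 0 < δ) (hη : 0 < η)
    (h : ∀ A : Finset (Fin (n + 1)), ∑ i ∈ A, p i < η → ∀ f : Z →L[ℝ] ℝ, ‖f‖ ≤ 1 →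
      ∑ i ∈ A, |f (T (unitVec n i))| ≤ 2 * δ) (x : Block n) :
    ‖T (lp.single 1 n x)‖ ≤
      (‖T‖ + 1) ^ 2 / (δ * η) * ∑ i, p i * |x i| + 3 * δ * ‖x‖ := by
  classical
  have hK : 0 < ‖T‖ + 1 := by positivity
  set A : Finset (Fin (n + 1)) := Finset.univ.filter fun i => δ / (‖T‖ + 1) * ‖x‖ < |x i| with hA
  have hpx : 0 ≤ ∑ i, p i * |x i| :=
    Finset.sum_nonneg fun i _ => mul_nonneg (hp i) (abs_nonneg _)
  rcases lt_or_ge (∑ i ∈ A, p i) η with hlt | hge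
  · obtain ⟨f, hf, hfT⟩ := exists_dual_vector'' ℝ (T (lp.single 1 n x))
    have h1 : ‖T (lp.single 1 n x)‖ = ∑ i, x i * f (T (unitVec n i)) := by
      have h2 : ‖T (lp.single 1 n x)‖ = f (T (lp.single 1 n x)) := by simpa using hfT.symm
      rw [h2, single_eq_sum_unitVec]
      simp
    have h3 : ∀ i, x i * f (T (unitVec n i)) ≤
        (if i ∈ A then ‖x‖ * |f (T (unitVec n i))| else 0) +
          δ / (‖T‖ + 1) * ‖x‖ * |f (T (unitVec n i))| := by
      intro i
      refine (le_abs_self _).trans ?_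
      rw [abs_mul]
      split_ifs with hi
      · have := mul_le_mul_of_nonneg_right (block_abs_apply_le x i)
          (abs_nonneg (f (T (unitVec n i))))
        have h0 : 0 ≤ δ / (‖T‖ + 1) * ‖x‖ * |f (T (unitVec n i))| := by positivity
        linarith
      · rw [zero_add]
        refine mul_le_mul_of_nonneg_right (not_lt.1 fun hlt => hi ?_) (abs_nonneg _)
        exact Finset.mem_filter.2 ⟨Finset.mem_univ _, hlt⟩
    have h4 : ∑ i, |f (T (unitVec n i))| ≤ ‖T‖ := (supDominated_unitVec n).sum_abs_le T f hf
    calc ‖T (lp.single 1 n x)‖ ≤ _ := h1.trans_le (Finset.sum_le_sum fun i _ => h3 i)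
      _ = ‖x‖ * ∑ i ∈ A, |f (T (unitVec n i))| +
          δ / (‖T‖ + 1) * ‖x‖ * ∑ i, |f (T (unitVec n i))| := by
          rw [Finset.sum_add_distrib, Finset.sum_ite_mem, Finset.univ_inter, Finset.mul_sum,
            Finset.mul_sum]
      _ ≤ ‖x‖ * (2 * δ) + δ / (‖T‖ + 1) * ‖x‖ * (‖T‖ + 1) := by
          refine add_le_add (mul_le_mul_of_nonneg_left (h A hlt f hf) (norm_nonneg _))
            (mul_le_mul_of_nonneg_left (by linarith) (by positivity))
      _ = 3 * δ * ‖x‖ := by field_simp; ring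
      _ ≤ _ := le_add_of_nonneg_left (by positivity)
  · have h1 : δ / (‖T‖ + 1) * ‖x‖ * η ≤ ∑ i, p i * |x i| := by
      calc δ / (‖T‖ + 1) * ‖x‖ * η ≤ δ / (‖T‖ + 1) * ‖x‖ * ∑ i ∈ A, p i := by gcongr
        _ = ∑ i ∈ A, p i * (δ / (‖T‖ + 1) * ‖x‖) := by rw [← Finset.sum_mul, mul_comm]
        _ ≤ ∑ i ∈ A, p i * |x i| := Finset.sum_le_sum fun i hi =>
            mul_le_mul_of_nonneg_left (Finset.mem_filter.1 hi).2.le (hp i)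
        _ ≤ _ := Finset.sum_le_sum_of_subset_of_nonneg (Finset.subset_univ _)
            fun i _ _ => mul_nonneg (hp i) (abs_nonneg _)
    calc ‖T (lp.single 1 n x)‖ ≤ ‖T‖ * ‖x‖ := by
          simpa [lp.norm_single] using T.le_opNorm (lp.single 1 n x)
      _ ≤ (‖T‖ + 1) * ‖x‖ := by gcongr; linarith
      _ = (‖T‖ + 1) ^ 2 / (δ * η) * (δ / (‖T‖ + 1) * ‖x‖ * η) := by field_simp
      _ ≤ (‖T‖ + 1) ^ 2 / (δ * η) * ∑ i, p i * |x i| := by gcongr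
      _ ≤ _ := le_add_of_nonneg_right (by positivity)

theorem mem_GiEllOne_of_not_large (T : ESpace →L[ℝ] ESpace)
    (h : ∀ δ > 0, ¬ LargeOnSupDominated T δ) : T ∈ GiEllOne ESpace := by
  refine mem_GiEllOne_of_control T fun ε hε => ?_
  have hδ : 0 < ε / 3 := by positivity
  obtain ⟨k, hk⟩ := not_forall.1 (h (ε / 3) hδ)
  have hη : 0 < ε / 3 / (k + 1) := by positivity
  refine ⟨(‖T‖ + 1) ^ 2 / (ε / 3 * (ε / 3 / (k + 1))), k * ‖T‖, by positivity, by positivity,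
    fun n => ?_⟩
  let W : Set (Fin (n + 1) → ℝ) :=
    {w | ∃ f : ESpace →L[ℝ] ℝ, ‖f‖ ≤ 1 ∧ w = fun i => |f (T (unitVec n i))|}
  rcases exists_disjoint_or_control W (by rintro _ ⟨f, -, rfl⟩ i; exact abs_nonneg _) ‖T‖
    (norm_nonneg _)
    (by rintro _ ⟨f, hf, rfl⟩; exact (supDominated_unitVec n).sum_abs_le T f hf) (ε / 3)
    (ε / 3 / (k + 1)) hη.le k
    (by rw [mul_div_assoc', div_le_iff₀ (by positivity)]; nlinarith) with
    ⟨w, A, hwW, hA, hwA⟩ | ⟨p, hp, hpK, hpW⟩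
  · choose f hf hfw using hwW
    obtain ⟨v, hv, hfv⟩ := exists_supDominated_of_disjoint T f A hA (ε / 3)
      fun j => by simpa [hfw] using hwA j
    exact absurd ⟨v, f, hv, hf, hfv⟩ hk
  · refine ⟨p, hp, hpK, fun x => ?_⟩
    have := norm_single_le_of_control T p hp (ε / 3) _ hδ hη
      (fun A hA f hf => hpW A hA _ ⟨f, hf, rfl⟩) x
    rwa [mul_div_cancel₀ ε (by norm_num : (3 : ℝ) ≠ 0)] at this

end Control

/-- for `E = (⊕ₙ ℓ∞(n))_{ℓ¹}`, if `T ∈ L(E)` does not belong to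
`G^i_{ℓ¹}(E)`, then the identity `1_E` factors through `T`: `1_E = R T S` for some
`R, S ∈ L(E)`. -/
theorem stmt8 (T : ESpace →L[ℝ] ESpace) (hT : T ∉ GiEllOne ESpace) :
    ∃ R S : ESpace →L[ℝ] ESpace,
      ContinuousLinearMap.id ℝ ESpace = R.comp (T.comp S) := by
  obtain ⟨δ, hδ, h⟩ : ∃ δ > 0, LargeOnSupDominated T δ := by
    by_contra hcon
    push Not at hcon
    exact hT (mem_GiEllOne_of_not_large T hcon)
  have hε : 0 < min (δ / 4) (1 / 4) := by positivity
  refine exists_factorization_of_local (X := Block) T (1 / δ) (min (δ / 4) (1 / 4))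
    (by positivity) ?_ fun l N => h.exists_local_factorization hδ _ hε l N
  have h1 : 1 / δ * min (δ / 4) (1 / 4) ≤ 1 / δ * (δ / 4) := by
    gcongr
    exact min_le_left _ _
  have h2 : 1 / δ * (δ / 4) = 1 / 4 := by field_simp
  linarith [min_le_right (δ / 4) (1 / 4 : ℝ)]
end
end

section
/- Let E = (⊕_n ℓ∞(n))_{ℓ¹}. Then G^i_{ℓ¹}(E) is the unique maximal two-sided ideal of the Banach algebra L(E): it is a proper closed two-sided ideal, and every proper two-sided ideal of L(E) is contained in G^i_{ℓ¹}(E). -/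
open Filter Topology
open scoped ENNReal

noncomputable section

namespace EllOneSum

theorem hasSum_norm_one {V : ℕ → Type*} [∀ n, NormedAddCommGroup (V n)] (x : lp V 1) :
    HasSum (fun n => ‖x n‖) ‖x‖ := by
  simpa using lp.hasSum_norm (p := 1) (by simp) x

/-- The norm of an operator on an `ℓ¹`-sum is controlled by its restrictions to the summands. -/
theorem opNorm_le_of_single {V : ℕ → Type*} [∀ n, NormedAddCommGroup (V n)]
    [∀ n, NormedSpace ℝ (V n)] {Y : Type*} [NormedAddCommGroup Y] [NormedSpace ℝ Y]
    (T : lp V 1 →L[ℝ] Y) {C : ℝ} (hC : 0 ≤ C)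
    (h : ∀ n v, ‖T (lp.single 1 n v)‖ ≤ C * ‖v‖) : ‖T‖ ≤ C := by
  refine T.opNorm_le_bound hC fun x => ?_
  have hx := T.hasSum (lp.hasSum_single (p := 1) (by simp) x)
  have hs := (hasSum_norm_one x).mul_left C
  rw [← hx.tsum_eq, ← hs.tsum_eq]
  exact tsum_of_norm_bounded hs.summable.hasSum fun n => h n (x n)

/-- A uniformly bounded family of operators on the summands extends to the `ℓ¹`-sum. -/
theorem exists_lift {V : ℕ → Type*} [∀ n, NormedAddCommGroup (V n)]
    [∀ n, NormedSpace ℝ (V n)] {Y : Type*} [NormedAddCommGroup Y] [NormedSpace ℝ Y]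
    [CompleteSpace Y] (u : ∀ n, V n →ₗ[ℝ] Y) {C : ℝ} (hC : 0 ≤ C)
    (h : ∀ n v, ‖u n v‖ ≤ C * ‖v‖) :
    ∃ T : lp V 1 →L[ℝ] Y, ‖T‖ ≤ C ∧ ∀ n v, T (lp.single 1 n v) = u n v := by
  have hsum (x : lp V 1) : Summable fun n => u n (x n) :=
    .of_norm_bounded ((hasSum_norm_one x).mul_left C).summable fun n => h n (x n)
  let L : lp V 1 →ₗ[ℝ] Y :=
    { toFun := fun x => ∑' n, u n (x n)
      map_add' := fun x y => by
        simp only [lp.coeFn_add, Pi.add_apply, map_add]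
        exact (hsum x).tsum_add (hsum y)
      map_smul' := fun c x => by
        simp only [lp.coeFn_smul, Pi.smul_apply, map_smul, RingHom.id_apply]
        exact (hsum x).tsum_const_smul c }
  refine ⟨L.mkContinuous C fun x => ?_, L.mkContinuous_norm_le hC _, fun n v => ?_⟩
  · have hs := (hasSum_norm_one x).mul_left C
    rw [← hs.tsum_eq]
    exact tsum_of_norm_bounded hs.summable.hasSum fun n => h n (x n)
  · change ∑' k, u k (lp.single 1 n v k) = _
    rw [tsum_eq_single n]
    · simp
    · intro k hk
      rw [lp.single_apply_ne _ _ _ hk, map_zero]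

/-- A uniformly bounded sequence of functionals defines an operator into `ℓ∞`. -/
theorem exists_toEllInfty {X : Type*} [NormedAddCommGroup X] [NormedSpace ℝ X]
    (g : ℕ → X →ₗ[ℝ] ℝ) {C : ℝ} (hC : 0 ≤ C) (h : ∀ k x, |g k x| ≤ C * ‖x‖) :
    ∃ T : X →L[ℝ] ellInfty, ‖T‖ ≤ C ∧ ∀ x k, T x k = g k x := by
  have hmem (x : X) : Memℓp (fun k => g k x) ⊤ :=
    memℓp_infty ⟨C * ‖x‖, by rintro _ ⟨k, rfl⟩; exact h k x⟩
  let L : X →ₗ[ℝ] ellInfty :=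
    { toFun := fun x => ⟨fun k => g k x, hmem x⟩
      map_add' := fun x y => by ext k; exact map_add (g k) x y
      map_smul' := fun c x => by ext k; exact map_smul (g k) c x }
  refine ⟨L.mkContinuous C fun x => ?_, L.mkContinuous_norm_le hC _, fun x k => rfl⟩
  exact lp.norm_le_of_forall_le (by positivity) fun k => h k x

/-- Every bounded operator into `ℓ∞` extends along an isomorphic embedding. -/
theorem exists_extension {X : Type*} [NormedAddCommGroup X] [NormedSpace ℝ X]
    {W : Type*} [NormedAddCommGroup W] [NormedSpace ℝ W]
    (θ : X →L[ℝ] W) {c : ℝ} (hc : 0 < c) (hθ : ∀ x, c * ‖x‖ ≤ ‖θ x‖)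
    (S : X →L[ℝ] ellInfty) : ∃ U : W →L[ℝ] ellInfty, U.comp θ = S := by
  have hinj : Function.Injective θ := by
    refine (injective_iff_map_eq_zero θ).2 fun x hx => ?_
    have := hθ x
    rw [hx, norm_zero] at this
    exact norm_le_zero_iff.1 (by nlinarith)
  let e := LinearEquiv.ofInjective (θ : X →ₗ[ℝ] W) hinj
  have he (y) : ‖e.symm y‖ ≤ c⁻¹ * ‖y‖ := by
    have h1 : θ (e.symm y) = y := by
      have := congrArg Subtype.val (e.apply_symm_apply y)
      exact this
    have h2 := hθ (e.symm y)
    rw [h1] at h2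
    rw [inv_mul_eq_div, le_div_iff₀ hc]
    simpa [mul_comm] using h2
  have key (k : ℕ) : ∃ g : W →L[ℝ] ℝ, (∀ x, g (θ x) = S x k) ∧ ‖g‖ ≤ ‖S‖ * c⁻¹ := by
    let f0 : LinearMap.range (θ : X →ₗ[ℝ] W) →ₗ[ℝ] ℝ :=
      (lp.evalₗ (𝕜 := ℝ) (fun _ : ℕ => ℝ) ⊤ k) ∘ₗ (S : X →ₗ[ℝ] ellInfty) ∘ₗ e.symm.toLinearMap
    have hf0 (y) : ‖f0 y‖ ≤ ‖S‖ * c⁻¹ * ‖y‖ := by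
      calc ‖f0 y‖ ≤ ‖S (e.symm y)‖ := lp.norm_apply_le_norm (by simp) _ k
        _ ≤ ‖S‖ * ‖e.symm y‖ := S.le_opNorm _
        _ ≤ ‖S‖ * (c⁻¹ * ‖y‖) := by gcongr; exact he y
        _ = _ := by ring
    obtain ⟨g, hg, hgn⟩ := exists_extension_norm_eq _ (f0.mkContinuous _ hf0)
    refine ⟨g, fun x => ?_, hgn.trans_le (f0.mkContinuous_norm_le (by positivity) _)⟩
    rw [show θ x = (e x : W) from rfl, hg (e x)]
    change S (e.symm (e x)) k = _
    rw [e.symm_apply_apply]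
  choose g hg hgn using key
  obtain ⟨U, -, hU⟩ := exists_toEllInfty (fun k => (g k : W →ₗ[ℝ] ℝ))
    (C := ‖S‖ * c⁻¹) (by positivity) fun k x => (g k).le_of_opNorm_le (hgn k) x
  refine ⟨U, ?_⟩
  ext x k
  exact (hU _ k).trans (hg k x)

/-- Every separable normed space embeds isometrically into `ℓ∞`. -/
theorem exists_isometric_embedding (X : Type*) [NormedAddCommGroup X] [NormedSpace ℝ X]
    [TopologicalSpace.SeparableSpace X] : ∃ θ : X →L[ℝ] ellInfty, ∀ x, ‖θ x‖ = ‖x‖ := by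
  choose g hg1 hg using fun k => exists_dual_vector'' ℝ (TopologicalSpace.denseSeq X k)
  obtain ⟨θ, hθ, hθg⟩ := exists_toEllInfty (fun k => (g k : X →ₗ[ℝ] ℝ)) zero_le_one
    fun k x => (g k).le_of_opNorm_le (hg1 k) x
  have hle (x) : ‖θ x‖ ≤ ‖x‖ := by simpa using θ.le_of_opNorm_le hθ x
  refine ⟨θ, fun x => ?_⟩
  have hclosed : IsClosed {x | ‖θ x‖ = ‖x‖} :=
    isClosed_eq (by fun_prop) (by fun_prop)
  refine hclosed.closure_subset_iff.2 ?_ (TopologicalSpace.denseRange_denseSeq X x)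
  rintro _ ⟨k, rfl⟩
  refine le_antisymm (hle _) ?_
  have h1 := lp.norm_apply_le_norm (by simp) (θ (TopologicalSpace.denseSeq X k)) k
  rw [hθg] at h1
  change ‖g k _‖ ≤ _ at h1
  rw [hg k] at h1
  simpa using h1

theorem separableSpace_ellOneSum (V : ℕ → Type*) [∀ n, NormedAddCommGroup (V n)]
    [∀ n, NormedSpace ℝ (V n)] [∀ n, FiniteDimensional ℝ (V n)] :
    TopologicalSpace.SeparableSpace (lp V 1) := by
  have h1 : TopologicalSpace.IsSeparable
      (⋃ n, Set.range (lp.singleContinuousLinearMap ℝ V 1 n)) :=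
    .iUnion fun n => by
      have : ProperSpace (V n) := FiniteDimensional.proper ℝ _
      exact TopologicalSpace.isSeparable_range (lp.singleContinuousLinearMap ℝ V 1 n).continuous
  have h2 := (h1.span (R := ℝ)).closure
  rw [← TopologicalSpace.isSeparable_univ_iff]
  refine h2.mono fun x _ => ?_
  refine mem_closure_of_tendsto (lp.hasSum_single (p := 1) (by simp) x) (.of_forall fun s => ?_)
  exact Submodule.sum_mem _ fun n _ =>
    Submodule.subset_span (Set.mem_iUnion.2 ⟨n, x n, rfl⟩)

theorem card_filter_lt_le {α : Type*} (s : Finset α) (a : α → ℝ) (ha : ∀ l ∈ s, 0 ≤ a l)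
    {τ ζ : ℝ} (hζ : 0 < ζ) (hsum : ∑ l ∈ s, a l ≤ τ) :
    (s.filter fun l => ζ < a l).card ≤ ⌈τ / ζ⌉₊ := by
  have h1 : (s.filter fun l => ζ < a l).card • ζ ≤ ∑ l ∈ s.filter (fun l => ζ < a l), a l :=
    Finset.card_nsmul_le_sum _ _ _ fun l hl => (Finset.mem_filter.1 hl).2.le
  have h2 : ∑ l ∈ s.filter (fun l => ζ < a l), a l ≤ ∑ l ∈ s, a l :=
    Finset.sum_le_sum_of_subset_of_nonneg (Finset.filter_subset _ _) fun l hl _ => ha l hl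
  have h3 : ((s.filter fun l => ζ < a l).card : ℝ) ≤ τ / ζ := by
    rw [le_div_iff₀ hζ, ← nsmul_eq_mul]
    linarith
  exact_mod_cast h3.trans (Nat.le_ceil _)

/-- A graph on naturals in which every vertex has few smaller neighbours has a large independent
set. -/
theorem exists_independent_subset (bad : ℕ → ℕ → Prop) [∀ j l, Decidable (bad j l)] (K m : ℕ)
    (V : Finset ℕ) (hV : m * (K + 1) ≤ V.card)
    (hbad : ∀ j ∈ V, (V.filter fun l => bad j l).card ≤ K) :
    ∃ S ⊆ V, S.card = m ∧ ∀ j ∈ S, ∀ l ∈ S, l < j → ¬ bad j l := by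
  induction m generalizing V with
  | zero => exact ⟨∅, by simp, by simp, by simp⟩
  | succ m ih =>
    have hne : V.Nonempty := by
      rw [← Finset.card_pos]
      nlinarith
    set j := V.max' hne with hj
    have hjV : j ∈ V := V.max'_mem hne
    set V' := (V.erase j).filter fun l => ¬ bad j l with hV'
    have hsub : V' ⊆ V := (Finset.filter_subset _ _).trans (Finset.erase_subset _ _)
    have hcard : m * (K + 1) ≤ V'.card := by
      have h1 := Finset.card_filter_add_card_filter_not (s := V.erase j) (fun l => bad j l)
      have h2 : ((V.erase j).filter fun l => bad j l).card ≤ K :=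
        (Finset.card_le_card (Finset.filter_subset_filter _ (Finset.erase_subset _ _))).trans
          (hbad j hjV)
      have h3 := Finset.card_erase_add_one hjV
      rw [hV']
      nlinarith
    obtain ⟨S, hSV, hScard, hS⟩ := ih V' hcard fun i hi =>
      (Finset.card_le_card (Finset.filter_subset_filter _ hsub)).trans (hbad i (hsub hi))
    have hjS : j ∉ S := fun h => by simpa [hV'] using hSV h
    refine ⟨insert j S, Finset.insert_subset hjV (hSV.trans hsub), ?_, ?_⟩
    · rw [Finset.card_insert_of_notMem hjS, hScard]
    · intro i hi l hl hli
      rcases Finset.mem_insert.1 hi with rfl | hi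
      · rcases Finset.mem_insert.1 hl with rfl | hl
        · exact absurd hli (lt_irrefl _)
        · exact (Finset.mem_filter.1 (hSV hl)).2
      · rcases Finset.mem_insert.1 hl with rfl | hl
        · exact absurd hli (not_lt.2 (V.le_max' i (hsub (hSV hi))))
        · exact hS i hi l hl hli

/-- Functionals each of which carries mass not dominated by its predecessors almost attain this
mass on disjointly supported vectors. -/
theorem exists_disjoint_vectors {ι : Type*} [Fintype ι] (f : ℕ → ι → ℝ) {τ ε L : ℝ} (M : ℕ)
    (hL : 0 < L) (hf : ∀ j, ∑ i, |f j i| ≤ τ)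
    (h : ∀ j < M, ε < ∑ i, max (|f j i| - L * ∑ l ∈ Finset.range j, |f l i|) 0) :
    ∃ x : ℕ → ι → ℝ, (∀ i, ∑ j ∈ Finset.range M, |x j i| ≤ 1) ∧
      (∀ j < M, ε - M * (τ / L) ≤ ∑ i, f j i * x j i) ∧
      ∀ l < M, ∀ j < l, ∑ i, |f j i| * |x l i| ≤ τ / L := by
  classical
  let B (j : ℕ) (i : ι) : Prop := L * ∑ l ∈ Finset.range j, |f l i| < |f j i|
  let x (j : ℕ) (i : ι) : ℝ :=
    if B j i ∧ ∀ l, j < l → l < M → ¬ B l i then SignType.sign (f j i) else 0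
  have hB {j l : ℕ} {i : ι} (hjl : j < l) (hb : B l i) : |f j i| ≤ |f l i| / L := by
    rw [le_div_iff₀ hL, mul_comm]
    refine le_trans ?_ hb.le
    gcongr
    exact Finset.single_le_sum (f := fun l => |f l i|) (fun _ _ => abs_nonneg _)
      (Finset.mem_range.2 hjl)
  have hsign (t : ℝ) : |(SignType.sign t : ℝ)| ≤ 1 := by
    rcases lt_trichotomy t 0 with ht | rfl | ht
    · simp [sign_neg ht]
    · simp
    · simp [sign_pos ht]
  have hx1 (j i) : |x j i| ≤ 1 := by
    simp only [x]
    split_ifs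
    · exact hsign _
    · simp
  have hxB {j i} (hx : x j i ≠ 0) : B j i ∧ ∀ l, j < l → l < M → ¬ B l i := by
    by_contra hc
    exact hx (if_neg hc)
  refine ⟨x, fun i => ?_, fun j hj => ?_, fun l hl j hjl => ?_⟩
  · by_cases hex : ∃ j < M, x j i ≠ 0
    · obtain ⟨j, hj, hxj⟩ := hex
      rw [Finset.sum_eq_single j]
      · exact hx1 j i
      · intro l hl hlj
        rw [abs_eq_zero]
        by_contra hxl
        rcases lt_or_gt_of_ne hlj with h1 | h1
        · exact (hxB hxl).2 j h1 hj (hxB hxj).1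
        · exact (hxB hxj).2 l h1 (Finset.mem_range.1 hl) (hxB hxl).1
      · intro hj'
        exact absurd (Finset.mem_range.2 hj) hj'
    · push Not at hex
      rw [Finset.sum_eq_zero]
      · exact zero_le_one
      · intro j hj
        rw [hex j (Finset.mem_range.1 hj), abs_zero]
  · have hpt (i : ι) : max (|f j i| - L * ∑ l ∈ Finset.range j, |f l i|) 0 -
        ∑ l ∈ Finset.range M, |f l i| / L ≤ f j i * x j i := by
      have hnn : 0 ≤ ∑ l ∈ Finset.range M, |f l i| / L :=
        Finset.sum_nonneg fun _ _ => by positivity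
      have hnn' : 0 ≤ L * ∑ l ∈ Finset.range j, |f l i| :=
        mul_nonneg hL.le (Finset.sum_nonneg fun _ _ => abs_nonneg _)
      have hmax : max (|f j i| - L * ∑ l ∈ Finset.range j, |f l i|) 0 ≤ |f j i| :=
        max_le (by linarith) (abs_nonneg _)
      by_cases hb : B j i
      · by_cases hl : ∀ l, j < l → l < M → ¬ B l i
        · have : f j i * x j i = |f j i| := by
            simp only [x]
            rw [if_pos ⟨hb, hl⟩, self_mul_sign]
          linarith
        · have hx0 : x j i = 0 := if_neg fun hc => hl hc.2
          push Not at hl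
          obtain ⟨l, hjl, hlM, hbl⟩ := hl
          have h1 : |f l i| / L ≤ ∑ l ∈ Finset.range M, |f l i| / L :=
            Finset.single_le_sum (f := fun l => |f l i| / L) (fun _ _ => by positivity)
              (Finset.mem_range.2 hlM)
          rw [hx0, mul_zero]
          linarith [hB hjl hbl]
      · have hx0 : x j i = 0 := if_neg fun hc => hb hc.1
        rw [hx0, mul_zero, max_eq_right (by simpa [B] using hb)]
        linarith
    have hsum := Finset.sum_le_sum fun i (_ : i ∈ Finset.univ) => hpt i
    rw [Finset.sum_sub_distrib, Finset.sum_comm] at hsum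
    have h2 : ∑ l ∈ Finset.range M, ∑ i, |f l i| / L ≤ M * (τ / L) := by
      refine (Finset.sum_le_card_nsmul _ _ (τ / L) fun l _ => ?_).trans (by simp)
      rw [← Finset.sum_div]
      gcongr
      exact hf l
    linarith [h j hj]
  · have hpt (i : ι) : |f j i| * |x l i| ≤ |f l i| / L := by
      by_cases hx : x l i = 0
      · rw [hx, abs_zero, mul_zero]
        positivity
      · exact (mul_le_of_le_one_right (abs_nonneg _) (hx1 l i)).trans (hB hjl (hxB hx).1)
    refine (Finset.sum_le_sum fun i _ => hpt i).trans ?_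
    rw [← Finset.sum_div]
    gcongr
    exact hf l

theorem exists_greedy_sequence {ι : Type*} [Fintype ι] (f : ℕ → ι → ℝ) {τ ε L N : ℝ} (M : ℕ)
    (hτ : 0 ≤ τ) (hL : 0 ≤ L) (hf : ∀ k, ∑ i, |f k i| ≤ τ) (hN : L * (M * τ) ≤ N)
    (h : ∀ ν : ι → ℝ, (∀ i, 0 ≤ ν i) → ∑ i, ν i ≤ N → ∃ k, ε < ∑ i, max (|f k i| - ν i) 0) :
    ∃ k : ℕ → ℕ, ∀ j < M,
      ε < ∑ i, max (|f (k j) i| - L * ∑ l ∈ Finset.range j, |f (k l) i|) 0 := by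
  have h' (ν : ι → ℝ) : ∃ k, (∀ i, 0 ≤ ν i) → ∑ i, ν i ≤ N →
      ε < ∑ i, max (|f k i| - ν i) 0 := by
    by_cases hν : (∀ i, 0 ≤ ν i) ∧ ∑ i, ν i ≤ N
    · obtain ⟨k, hk⟩ := h ν hν.1 hν.2
      exact ⟨k, fun _ _ => hk⟩
    · exact ⟨0, fun h1 h2 => absurd ⟨h1, h2⟩ hν⟩
  choose K hK using h'
  let σ : ℕ → ι → ℝ := fun j =>
    Nat.rec 0 (fun _ s i => s i + |f (K fun i => L * s i) i|) j
  let k : ℕ → ℕ := fun j => K fun i => L * σ j i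
  have hσ (j : ℕ) (i : ι) : σ j i = ∑ l ∈ Finset.range j, |f (k l) i| := by
    induction j with
    | zero => simp [σ]
    | succ j ih => rw [Finset.sum_range_succ, ← ih]
  refine ⟨k, fun j hj => ?_⟩
  have := hK (fun i => L * σ j i) (fun i => ?_) ?_
  · simp only [← hσ]
    exact this
  · rw [hσ]
    exact mul_nonneg hL (Finset.sum_nonneg fun _ _ => abs_nonneg _)
  · simp only [hσ]
    rw [← Finset.mul_sum, Finset.sum_comm]
    refine le_trans ?_ hN
    gcongr
    refine (Finset.sum_le_card_nsmul _ _ τ fun l _ => hf _).trans ?_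
    rw [Finset.card_range, nsmul_eq_mul]
    gcongr

/-- A bounded sequence of functionals on `ℓ∞(n)` which is far from being dominated by a fixed
multiple of a probability vector is almost biorthogonal to a long sequence of disjointly supported
vectors; moreover these vectors may be chosen almost annihilated by finitely many
prescribed functionals. -/
theorem exists_almost_biorthogonal {κ : Type*} [Fintype κ] (m : ℕ) {τ ε ζ : ℝ} (hτ : 0 < τ)
    (hε : 0 < ε) (hζ : 0 < ζ) :
    ∃ N : ℝ, ∀ (n : ℕ) (f : ℕ → Fin n → ℝ) (φ : κ → Fin n → ℝ),
      (∀ k, ∑ i, |f k i| ≤ τ) → (∀ s, ∑ i, |φ s i| ≤ τ) →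
      (∀ ν : Fin n → ℝ, (∀ i, 0 ≤ ν i) → ∑ i, ν i ≤ N →
        ∃ k, ε < ∑ i, max (|f k i| - ν i) 0) →
      ∃ (k : Fin m → ℕ) (x : Fin m → Fin n → ℝ), (∀ i, ∑ a, |x a i| ≤ 1) ∧
        (∀ a, ε / 2 ≤ ∑ i, f (k a) i * x a i) ∧
        (∀ a b, a ≠ b → ∑ i, |f (k a) i| * |x b i| ≤ ζ) ∧
        ∀ a, ∑ s, ∑ i, |φ s i| * |x a i| ≤ ζ := by
  classical
  set K := ⌈τ / ζ⌉₊
  set K₂ := ⌈(Fintype.card κ * τ) / ζ⌉₊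
  set M := m * (K + 1) + K₂
  set L := τ / ζ + 2 * M * τ / ε with hLdef
  have hL : 0 < L := by positivity
  have hLζ : τ / L ≤ ζ := by
    rw [div_le_comm₀ hL hζ, hLdef]
    have : 0 ≤ 2 * M * τ / ε := by positivity
    linarith
  have hLε : M * (τ / L) ≤ ε / 2 := by
    rw [← mul_div_assoc, div_le_comm₀ hL (by positivity), hLdef]
    have h1 : 0 ≤ τ / ζ := by positivity
    have h2 : M * τ / (ε / 2) = 2 * M * τ / ε := by field_simp
    linarith
  refine ⟨L * (M * τ), fun n f φ hf hφ h => ?_⟩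
  obtain ⟨k, hk⟩ := exists_greedy_sequence f M hτ.le hL.le hf le_rfl h
  obtain ⟨x, hx1, hx2, hx3⟩ := exists_disjoint_vectors (fun j => f (k j)) M hL (fun j => hf _) hk
  have hmass (w : Fin n → ℝ) (hw : ∑ i, |w i| ≤ τ) :
      ∑ l ∈ Finset.range M, ∑ i, |w i| * |x l i| ≤ τ := by
    rw [Finset.sum_comm]
    refine le_trans (Finset.sum_le_sum fun i _ => ?_) hw
    rw [← Finset.mul_sum]
    exact mul_le_of_le_one_right (abs_nonneg _) (hx1 i)
  let q (l : ℕ) : ℝ := ∑ s, ∑ i, |φ s i| * |x l i|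
  have hq0 (l : ℕ) : 0 ≤ q l :=
    Finset.sum_nonneg fun _ _ => Finset.sum_nonneg fun _ _ => by positivity
  have hq : ∑ l ∈ Finset.range M, q l ≤ Fintype.card κ * τ := by
    simp only [q]
    rw [Finset.sum_comm]
    refine (Finset.sum_le_card_nsmul _ _ τ fun s _ => hmass _ (hφ s)).trans ?_
    simp
  let V := (Finset.range M).filter fun l => ¬ ζ < q l
  have hV : m * (K + 1) ≤ V.card := by
    have h1 := Finset.card_filter_add_card_filter_not (s := Finset.range M) (fun l => ζ < q l)
    have h2 := card_filter_lt_le (Finset.range M) q (fun l _ => hq0 l) hζ hq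
    rw [Finset.card_range] at h1
    change _ + V.card = _ at h1
    change _ ≤ K₂ at h2
    omega
  let bad (j l : ℕ) : Prop := ζ < ∑ i, |f (k j) i| * |x l i|
  obtain ⟨S, hSV, hScard, hS⟩ := exists_independent_subset bad K m V hV fun j _ =>
    (Finset.card_le_card (Finset.filter_subset_filter _ (Finset.filter_subset _ _))).trans
      (card_filter_lt_le (Finset.range M) _
        (fun l _ => Finset.sum_nonneg fun _ _ => by positivity) hζ (hmass _ (hf (k j))))
  let e := S.orderEmbOfFin hScard
  have heS (a) : e a ∈ S := S.orderEmbOfFin_mem hScard a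
  have heM (a) : e a < M := by simpa using (Finset.mem_filter.1 (hSV (heS a))).1
  refine ⟨fun a => k (e a), fun a => x (e a), fun i => ?_, fun a => ?_, fun a b hab => ?_,
    fun a => ?_⟩
  · refine le_trans ?_ (hx1 i)
    rw [← Finset.sum_image (f := fun l => |x l i|) (s := Finset.univ) (g := e)
      fun a _ b _ h => e.injective h]
    refine Finset.sum_le_sum_of_subset_of_nonneg ?_ fun _ _ _ => abs_nonneg _
    intro l hl
    obtain ⟨a, -, rfl⟩ := Finset.mem_image.1 hl
    exact Finset.mem_range.2 (heM a)
  · linarith [hx2 _ (heM a)]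
  · rcases lt_or_gt_of_ne (e.injective.ne hab) with h1 | h1
    · exact (hx3 _ (heM b) _ h1).trans hLζ
    · exact not_lt.1 (hS _ (heS a) _ (heS b) h1)
  · exact not_lt.1 (Finset.mem_filter.1 (hSV (heS a))).2

/-- The vector of the `n`-th summand of `E` with the given coordinates. -/
def block (n : ℕ) : (Fin (n + 1) → ℝ) →ₗ[ℝ] ESpace :=
  (lp.lsingle (𝕜 := ℝ) 1 n) ∘ₗ
    (WithLp.linearEquiv ⊤ ℝ (Fin (n + 1) → ℝ)).symm.toLinearMap

theorem block_apply (n : ℕ) (x : Fin (n + 1) → ℝ) :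
    block n x = lp.single 1 n (WithLp.toLp ⊤ x) := rfl

theorem norm_block (n : ℕ) (x : Fin (n + 1) → ℝ) : ‖block n x‖ = ‖x‖ := by
  rw [block_apply, lp.norm_single (by simp), PiLp.norm_toLp]

theorem block_eq_sum (n : ℕ) (x : Fin (n + 1) → ℝ) :
    block n x = ∑ i, x i • block n (Pi.single i 1) := by
  conv_lhs => rw [pi_eq_sum_univ' x]
  simp [map_sum]

theorem sum_abs_apply_block_le (φ : ESpace →L[ℝ] ℝ) {C : ℝ} (hφ : ‖φ‖ ≤ C) (n : ℕ) :
    ∑ i, |φ (block n (Pi.single i 1))| ≤ C := by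
  set s : Fin (n + 1) → ℝ := fun i => SignType.sign (φ (block n (Pi.single i 1))) with hs
  have h1 : ∑ i, |φ (block n (Pi.single i 1))| = φ (block n s) := by
    rw [block_eq_sum, map_sum]
    refine Finset.sum_congr rfl fun i _ => ?_
    rw [map_smul, smul_eq_mul, hs, sign_mul_self]
  have h2 : ‖s‖ ≤ 1 := by
    refine (pi_norm_le_iff_of_nonneg zero_le_one).2 fun i => ?_
    rcases lt_trichotomy (φ (block n (Pi.single i 1))) 0 with ht | ht | ht
    · simp [hs, sign_neg ht]
    · simp [hs, ht]
    · simp [hs, sign_pos ht]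
  rw [h1]
  calc φ (block n s) ≤ ‖φ (block n s)‖ := Real.le_norm_self _
    _ ≤ C * ‖block n s‖ := φ.le_of_opNorm_le hφ _
    _ ≤ C * 1 := by
      rw [norm_block]
      exact mul_le_mul_of_nonneg_left h2 ((norm_nonneg φ).trans hφ)
    _ = C := mul_one C

/-- The coordinate functionals of `E`. -/
def coord (s : ℕ) (i : Fin (s + 1)) : ESpace →L[ℝ] ℝ :=
  (PiLp.proj ⊤ (𝕜 := ℝ) (fun _ : Fin (s + 1) => ℝ) i).comp
    (lp.evalCLM ℝ (fun n : ℕ => PiLp ⊤ (fun _ : Fin (n + 1) => ℝ)) 1 s)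

theorem coord_apply (s : ℕ) (i : Fin (s + 1)) (y : ESpace) : coord s i y = y s i := rfl

theorem norm_coord_le (s : ℕ) (i : Fin (s + 1)) : ‖coord s i‖ ≤ 1 := by
  refine ContinuousLinearMap.opNorm_le_bound _ zero_le_one fun y => ?_
  rw [one_mul, coord_apply]
  exact (PiLp.norm_apply_le (y s) i).trans (lp.norm_apply_le_norm (by simp) y s)

/-- The natural projection of `E` onto the sum of the summands with index in `s`. -/
def trunc (s : Finset ℕ) : ESpace →L[ℝ] ESpace :=
  ∑ n ∈ s,
    (lp.singleContinuousLinearMap ℝ (fun n : ℕ => PiLp ⊤ (fun _ : Fin (n + 1) => ℝ)) 1 n).comp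
    (lp.evalCLM ℝ (fun n : ℕ => PiLp ⊤ (fun _ : Fin (n + 1) => ℝ)) 1 n)

theorem trunc_apply (s : Finset ℕ) (y : ESpace) :
    trunc s y = ∑ n ∈ s, lp.single 1 n (y n) := by
  rw [trunc, sum_apply]
  rfl

theorem norm_trunc_range_le (r : ℕ) (y : ESpace) :
    ‖trunc (Finset.range r) y‖ ≤
      ∑ s : (Σ t : Fin r, Fin ((t : ℕ) + 1)), |coord s.1 s.2 y| := by
  rw [trunc_apply, Finset.sum_range, Fintype.sum_sigma]
  refine norm_sum_le_of_le _ fun t _ => ?_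
  rw [lp.norm_single (by simp), ← PiLp.norm_ofLp]
  refine (pi_norm_le_iff_of_nonneg (Finset.sum_nonneg fun _ _ => abs_nonneg _)).2 fun i => ?_
  exact Finset.single_le_sum (f := fun i => |coord t i y|) (fun _ _ => abs_nonneg _)
    (Finset.mem_univ i)

/-- If the functionals `g k ∘ T` are not uniformly dominated on the summands of `E`, up to `ε`, by
positive measures of bounded mass, then the identities of the spaces `ℓ∞(m)` approximately factor
through `T`, with uniform bounds and with images that almost vanish on any given initial segment. -/
theorem exists_local_factorization (T : ESpace →L[ℝ] ESpace) (g : ℕ → ESpace →L[ℝ] ℝ)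
    (hg : ∀ k, ‖g k‖ ≤ 1) {ε : ℝ} (hε : 0 < ε)
    (h : ∀ N : ℝ, ∃ n, ∀ ν : Fin (n + 1) → ℝ, (∀ i, 0 ≤ ν i) → ∑ i, ν i ≤ N →
      ∃ k, ε < ∑ i, max (|g k (T (block n (Pi.single i 1)))| - ν i) 0)
    (m r : ℕ) {η : ℝ} (hη : 0 < η) :
    ∃ (u : PiLp ⊤ (fun _ : Fin (m + 1) => ℝ) →ₗ[ℝ] ESpace)
      (a : ESpace →ₗ[ℝ] PiLp ⊤ (fun _ : Fin (m + 1) => ℝ)),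
      (∀ v, ‖u v‖ ≤ ‖v‖) ∧ (∀ y, ‖a y‖ ≤ 2 / ε * ‖y‖) ∧
      (∀ v, ‖a (T (u v)) - v‖ ≤ η * ‖v‖) ∧
      ∀ v, ‖trunc (Finset.range r) (T (u v))‖ ≤ η * ‖v‖ := by
  set ζ := η / ((m + 1) * (1 + 2 / ε)) with hζdef
  have hζ : 0 < ζ := by positivity
  have hζm : (m + 1) * ζ * (1 + 2 / ε) = η := by
    rw [hζdef]
    field_simp
  have hζm0 : 0 < (m + 1) * ζ := by positivity
  have hεi : 0 < 2 / ε := by positivity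
  have hT (φ : ESpace →L[ℝ] ℝ) (hφ : ‖φ‖ ≤ 1) : ‖φ.comp T‖ ≤ ‖T‖ + 1 :=
    (φ.opNorm_comp_le T).trans (by nlinarith [norm_nonneg T, norm_nonneg φ])
  obtain ⟨N, hN⟩ := exists_almost_biorthogonal (κ := Σ t : Fin r, Fin ((t : ℕ) + 1)) (m + 1)
    (τ := ‖T‖ + 1) (by positivity) hε hζ
  obtain ⟨n, hn⟩ := h N
  obtain ⟨k, x, hx1, hx2, hx3, hx4⟩ := hN (n + 1)
    (fun k i => g k (T (block n (Pi.single i 1))))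
    (fun s i => coord s.1 s.2 (T (block n (Pi.single i 1))))
    (fun k => sum_abs_apply_block_le _ (hT _ (hg k)) n)
    (fun s => sum_abs_apply_block_le _ (hT _ (norm_coord_le _ _)) n) hn
  have happ (φ : ESpace →L[ℝ] ℝ) (y : Fin (n + 1) → ℝ) :
      φ (T (block n y)) = ∑ i, φ (T (block n (Pi.single i 1))) * y i := by
    rw [block_eq_sum, map_sum, map_sum]
    exact Finset.sum_congr rfl fun i _ => by rw [map_smul, map_smul, smul_eq_mul, mul_comm]
  have happ' (φ : ESpace →L[ℝ] ℝ) (y : Fin (n + 1) → ℝ) :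
      |φ (T (block n y))| ≤ ∑ i, |φ (T (block n (Pi.single i 1)))| * |y i| := by
    rw [happ]
    refine (Finset.abs_sum_le_sum_abs _ _).trans_eq ?_
    simp only [abs_mul]
  let c (b : Fin (m + 1)) : ℝ := g (k b) (T (block n (x b)))
  have hc (b) : ε / 2 ≤ c b := (hx2 b).trans_eq (happ _ _).symm
  have hc0 (b) : 0 < c b := (half_pos hε).trans_le (hc b)
  have hcinv (b) : (c b)⁻¹ ≤ 2 / ε := by
    rw [← inv_div]
    exact inv_anti₀ (half_pos hε) (hc b)
  let u : PiLp ⊤ (fun _ : Fin (m + 1) => ℝ) →ₗ[ℝ] ESpace :=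
    { toFun := fun v => ∑ b, v b • block n (x b)
      map_add' := fun v w => by simp [add_smul, Finset.sum_add_distrib]
      map_smul' := fun t v => by simp [mul_smul, Finset.smul_sum] }
  let a : ESpace →ₗ[ℝ] PiLp ⊤ (fun _ : Fin (m + 1) => ℝ) :=
    { toFun := fun y => WithLp.toLp ⊤ fun b => (c b)⁻¹ * g (k b) y
      map_add' := fun y z => by ext b; simp [mul_add]
      map_smul' := fun t y => by ext b; simp [mul_left_comm] }
  have hu (v) : u v = ∑ b, v b • block n (x b) := rfl
  have ha (y b) : a y b = (c b)⁻¹ * g (k b) y := rfl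
  have hnorm (w : PiLp ⊤ (fun _ : Fin (m + 1) => ℝ)) {C : ℝ} (hC : 0 ≤ C)
      (hw : ∀ b, |w b| ≤ C) : ‖w‖ ≤ C := by
    rw [← PiLp.norm_ofLp]
    exact (pi_norm_le_iff_of_nonneg hC).2 hw
  have hvb (v : PiLp ⊤ (fun _ : Fin (m + 1) => ℝ)) (b) : |v b| ≤ ‖v‖ := PiLp.norm_apply_le v b
  refine ⟨u, a, fun v => ?_, fun y => ?_, fun v => ?_, fun v => ?_⟩
  · have : u v = block n (∑ b, v b • x b) := by simp [hu, map_sum]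
    rw [this, norm_block]
    refine (pi_norm_le_iff_of_nonneg (norm_nonneg v)).2 fun i => ?_
    rw [Finset.sum_apply]
    calc ‖∑ b, (v b • x b) i‖ ≤ ∑ b, ‖v‖ * |x b i| := norm_sum_le_of_le _ fun b _ => by
          rw [Pi.smul_apply, norm_smul]
          exact mul_le_mul_of_nonneg_right (hvb v b) (abs_nonneg _)
      _ ≤ ‖v‖ := by
          rw [← Finset.mul_sum]
          exact mul_le_of_le_one_right (norm_nonneg v) (hx1 i)
  · refine hnorm _ (by positivity) fun b => ?_
    rw [ha, abs_mul, abs_of_pos (inv_pos.2 (hc0 b))]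
    have h1 : |g (k b) y| ≤ 1 * ‖y‖ := (g (k b)).le_of_opNorm_le (hg _) y
    rw [one_mul] at h1
    gcongr
    exact hcinv b
  · refine hnorm _ (by positivity) fun b => ?_
    have h1 : a (T (u v)) b - v b =
        (c b)⁻¹ * ∑ d ∈ Finset.univ.erase b, v d * g (k b) (T (block n (x d))) := by
      rw [ha, hu]
      simp only [map_sum, map_smul, smul_eq_mul]
      rw [← Finset.add_sum_erase _ _ (Finset.mem_univ b), mul_add]
      change (c b)⁻¹ * (v b * c b) + _ - _ = _
      rw [mul_comm (v b), inv_mul_cancel_left₀ (hc0 b).ne']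
      ring
    have h2 : |∑ d ∈ Finset.univ.erase b, v d * g (k b) (T (block n (x d)))| ≤
        (m + 1) * (‖v‖ * ζ) := by
      refine (Finset.abs_sum_le_sum_abs _ _).trans ?_
      refine (Finset.sum_le_card_nsmul _ _ (‖v‖ * ζ) fun d hd => ?_).trans ?_
      · rw [abs_mul]
        gcongr
        · exact hvb v d
        · exact (happ' _ _).trans (hx3 b d (Finset.ne_of_mem_erase hd).symm)
      · rw [nsmul_eq_mul]
        gcongr
        exact_mod_cast (Finset.card_erase_le).trans (by simp)
    rw [PiLp.sub_apply, h1, abs_mul, abs_of_pos (inv_pos.2 (hc0 b))]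
    calc (c b)⁻¹ * _ ≤ 2 / ε * ((m + 1) * (‖v‖ * ζ)) := by
          gcongr
          exact hcinv b
      _ = (m + 1) * ζ * (2 / ε) * ‖v‖ := by ring
      _ ≤ η * ‖v‖ := by
          gcongr
          nlinarith
  · refine (norm_trunc_range_le r _).trans ?_
    calc ∑ s : (Σ t : Fin r, Fin ((t : ℕ) + 1)), |coord s.1 s.2 (T (u v))|
        ≤ ∑ s : (Σ t : Fin r, Fin ((t : ℕ) + 1)), ∑ b, ‖v‖ *
            ∑ i, |coord s.1 s.2 (T (block n (Pi.single i 1)))| * |x b i| := by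
          refine Finset.sum_le_sum fun s _ => ?_
          rw [hu]
          simp only [map_sum, map_smul, smul_eq_mul]
          refine (Finset.abs_sum_le_sum_abs _ _).trans (Finset.sum_le_sum fun b _ => ?_)
          rw [abs_mul]
          exact mul_le_mul (hvb v b) (happ' _ _) (abs_nonneg _) (norm_nonneg v)
      _ ≤ (m + 1) * (‖v‖ * ζ) := by
          rw [Finset.sum_comm]
          refine (Finset.sum_le_card_nsmul _ _ (‖v‖ * ζ) fun b _ => ?_).trans (by simp)
          rw [← Finset.mul_sum]
          gcongr
          exact hx4 b
      _ = (m + 1) * ζ * ‖v‖ := by ring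
      _ ≤ η * ‖v‖ := by
          gcongr
          nlinarith

theorem tendsto_trunc_range (y : ESpace) :
    Tendsto (fun r => trunc (Finset.range r) y) atTop (𝓝 y) := by
  simpa only [trunc_apply] using (lp.hasSum_single (p := 1) (by simp) y).tendsto_sum_nat

theorem exists_trunc_close {m : ℕ} (F : PiLp ⊤ (fun _ : Fin (m + 1) => ℝ) →ₗ[ℝ] ESpace) (r : ℕ)
    {η : ℝ} (hη : 0 < η) :
    ∃ r' > r, ∀ v, ‖F v - trunc (Finset.range r') (F v)‖ ≤ η * ‖v‖ := by
  have hev (b : Fin (m + 1)) : ∀ᶠ r' in atTop,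
      ‖F (PiLp.single ⊤ b 1) - trunc (Finset.range r') (F (PiLp.single ⊤ b 1))‖ <
        η / (m + 1) := by
    have h1 := (tendsto_const_nhds (x := F (PiLp.single ⊤ b 1))).sub
      (tendsto_trunc_range (F (PiLp.single ⊤ b 1)))
    rw [sub_self] at h1
    have h2 := h1.norm
    rw [norm_zero] at h2
    exact h2.eventually_lt_const (by positivity)
  obtain ⟨r', hr', hlt⟩ := ((eventually_all.2 hev).and (eventually_gt_atTop r)).exists
  refine ⟨r', hlt, fun v => ?_⟩
  have hv : v = ∑ b, v b • PiLp.single ⊤ b (1 : ℝ) := by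
    ext i
    simp [Pi.single_apply]
  have h1 : F v - trunc (Finset.range r') (F v) = ∑ b, v b •
      (F (PiLp.single ⊤ b 1) - trunc (Finset.range r') (F (PiLp.single ⊤ b 1))) := by
    conv_lhs => rw [hv]
    simp only [map_sum, map_smul, smul_sub, Finset.sum_sub_distrib]
  rw [h1]
  refine (norm_sum_le_of_le (f := fun b => v b •
      (F (PiLp.single ⊤ b 1) - trunc (Finset.range r') (F (PiLp.single ⊤ b 1)))) _
    (n := fun _ => ‖v‖ * (η / (m + 1))) fun b _ => ?_).trans_eq ?_
  · rw [norm_smul]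
    exact mul_le_mul (PiLp.norm_apply_le v b) (hr' b).le (norm_nonneg _) (norm_nonneg _)
  · rw [Finset.sum_const, Finset.card_univ, Fintype.card_fin, nsmul_eq_mul]
    push_cast
    field_simp

theorem exists_comp_trunc_eq {ρ : ℕ → ℕ} (hρ : StrictMono ρ)
    (a : ∀ m : ℕ, ESpace →ₗ[ℝ] PiLp ⊤ (fun _ : Fin (m + 1) => ℝ)) {C : ℝ} (hC : 0 ≤ C)
    (ha : ∀ m y, ‖a m y‖ ≤ C * ‖y‖) :
    ∃ A : ESpace →L[ℝ] ESpace, ‖A‖ ≤ C ∧ ∀ m y,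
      A (trunc (Finset.Ico (ρ m) (ρ (m + 1))) y) =
        lp.single 1 m (a m (trunc (Finset.Ico (ρ m) (ρ (m + 1))) y)) := by
  obtain ⟨idx, hidx⟩ : ∃ idx : ℕ → ℕ, ∀ m n, ρ m ≤ n → n < ρ (m + 1) → idx n = m := by
    refine ⟨fun n => Nat.findGreatest (fun m : ℕ => ρ m ≤ n) n, fun m n h1 h2 => ?_⟩
    refine (Nat.findGreatest_eq_iff (P := fun m : ℕ => ρ m ≤ n)).2
      ⟨hρ.le_apply.trans h1, fun _ => h1, fun l hl _ hc => ?_⟩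
    exact absurd (hc.trans_lt h2) (not_lt.2 (hρ.monotone hl))
  let D (n : ℕ) : PiLp ⊤ (fun _ : Fin (n + 1) => ℝ) →ₗ[ℝ] ESpace :=
    lp.lsingle (𝕜 := ℝ) 1 (idx n) ∘ₗ a (idx n) ∘ₗ
      lp.lsingle (𝕜 := ℝ) (E := fun n : ℕ => PiLp ⊤ (fun _ : Fin (n + 1) => ℝ)) 1 n
  have hD (n v) : D n v = lp.single 1 (idx n) (a (idx n) (lp.single 1 n v)) := rfl
  obtain ⟨A, hAn, hA⟩ := exists_lift D hC fun n v => by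
    rw [hD, lp.norm_single (by simp)]
    refine (ha _ _).trans_eq ?_
    rw [lp.norm_single (by simp)]
  refine ⟨A, hAn, fun m y => ?_⟩
  change _ = lp.lsingle (𝕜 := ℝ) 1 m _
  simp only [trunc_apply, map_sum]
  refine Finset.sum_congr rfl fun n hn => ?_
  rw [Finset.mem_Ico] at hn
  rw [hA, hD, hidx m n hn.1 hn.2]
  rfl

/-- Uniform local factorizations of the identities of `ℓ∞(m)` through `T` can be glued to an
approximate factorization of the identity of `E` through `T`. -/
theorem exists_norm_one_sub_lt_one (T : ESpace →L[ℝ] ESpace) {C : ℝ} (hC : 0 ≤ C)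
    (h : ∀ (m r : ℕ) (η : ℝ), 0 < η →
      ∃ (u : PiLp ⊤ (fun _ : Fin (m + 1) => ℝ) →ₗ[ℝ] ESpace)
        (a : ESpace →ₗ[ℝ] PiLp ⊤ (fun _ : Fin (m + 1) => ℝ)),
        (∀ v, ‖u v‖ ≤ ‖v‖) ∧ (∀ y, ‖a y‖ ≤ C * ‖y‖) ∧
        (∀ v, ‖a (T (u v)) - v‖ ≤ η * ‖v‖) ∧
        ∀ v, ‖trunc (Finset.range r) (T (u v))‖ ≤ η * ‖v‖) :
    ∃ A B : ESpace →L[ℝ] ESpace, ‖1 - A * T * B‖ < 1 := by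
  set η := 1 / (2 * (1 + 4 * C)) with hηdef
  have hη : 0 < η := by positivity
  have hηC : η + 4 * C * η = 1 / 2 := by
    rw [hηdef]
    field_simp
  choose u a hu ha hau htr using fun m r => h m r η hη
  choose nxt hnxt htail using fun m r =>
    exists_trunc_close ((T : ESpace →ₗ[ℝ] ESpace) ∘ₗ u m r) r hη
  let ρ : ℕ → ℕ := fun m => Nat.rec (motive := fun _ => ℕ) 0 (fun m r => nxt m r) m
  have hρs (m) : ρ (m + 1) = nxt m (ρ m) := rfl
  have hρ : StrictMono ρ := strictMono_nat_of_lt_succ fun m => hnxt m (ρ m)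
  obtain ⟨B, -, hB⟩ := exists_lift (V := fun n : ℕ => PiLp ⊤ (fun _ : Fin (n + 1) => ℝ))
    (fun m => u m (ρ m)) zero_le_one fun m v => by simpa using hu m (ρ m) v
  obtain ⟨A, hAn, hAD⟩ := exists_comp_trunc_eq hρ (fun m => a m (ρ m)) hC fun m => ha m (ρ m)
  refine ⟨A, B, lt_of_le_of_lt (opNorm_le_of_single _ (C := 1 / 2) (by norm_num) fun m v => ?_)
    (by norm_num)⟩
  set y := T (u m (ρ m) v) with hy
  set D := trunc (Finset.Ico (ρ m) (ρ (m + 1))) y with hD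
  have hyD : ‖y - D‖ ≤ 2 * η * ‖v‖ := by
    have h1 : y - D = trunc (Finset.range (ρ m)) y +
        (y - trunc (Finset.range (ρ (m + 1))) y) := by
      have := Finset.sum_range_add_sum_Ico (fun n => (lp.single 1 n (y n) : ESpace))
        (hρ (Nat.lt_succ_self m)).le
      rw [hD, trunc_apply, trunc_apply, trunc_apply, ← this]
      abel
    rw [h1]
    have h2 := htail m (ρ m) v
    have h3 := htr m (ρ m) v
    refine (norm_add_le _ _).trans ?_
    change ‖y - trunc (Finset.range (ρ (m + 1))) y‖ ≤ _ at h2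
    linarith
  have h1 : (1 - A * T * B) (lp.single 1 m v) =
      -(lp.single 1 m (a m (ρ m) y - v)) + lp.single 1 m (a m (ρ m) (y - D)) - A (y - D) := by
    have h2 : (1 - A * T * B) (lp.single 1 m v) = lp.single 1 m v - A y := by
      change lp.single 1 m v - A (T (B (lp.single 1 m v))) = _
      rw [hB]
    have h3 : A y = A (y - D) + lp.single 1 m (a m (ρ m) D) := by
      rw [← hAD, ← map_add, sub_add_cancel]
    rw [h2, h3, map_sub (a m (ρ m)), lp.single_sub, lp.single_sub]
    abel
  rw [h1]
  have h4 : ‖(lp.single 1 m (a m (ρ m) y - v) : ESpace)‖ ≤ η * ‖v‖ := by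
    rw [lp.norm_single (by simp)]
    exact hau m (ρ m) v
  have h5 : ‖(lp.single 1 m (a m (ρ m) (y - D)) : ESpace)‖ ≤ C * ‖y - D‖ := by
    rw [lp.norm_single (by simp)]
    exact ha m (ρ m) _
  have h6 : ‖A (y - D)‖ ≤ C * ‖y - D‖ := A.le_of_opNorm_le hAn _
  have h7 : C * ‖y - D‖ ≤ C * (2 * η * ‖v‖) := by gcongr
  refine (norm_sub_le _ _).trans ?_
  have h8 := norm_add_le (-(lp.single 1 m (a m (ρ m) y - v) : ESpace))
    (lp.single 1 m (a m (ρ m) (y - D)))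
  rw [norm_neg] at h8
  have h9 : (η + 4 * C * η) * ‖v‖ = 1 / 2 * ‖v‖ := by rw [hηC]
  linarith

/-- An operator `E → ℓ∞` whose coordinate functionals are dominated, on each summand and up to
arbitrarily small errors, by uniformly bounded positive measures is approximately factorable
through `ℓ¹`. -/
theorem mem_closure_of_dominated (T : ESpace →L[ℝ] ellInfty)
    (h : ∀ ε > 0, ∃ N : ℝ, ∀ n, ∃ ν : Fin (n + 1) → ℝ, (∀ i, 0 ≤ ν i) ∧ ∑ i, ν i ≤ N ∧
      ∀ k, ∑ i, max (|T (block n (Pi.single i 1)) k| - ν i) 0 ≤ ε) :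
    T ∈ closure {W : ESpace →L[ℝ] ellInfty |
      ∃ (R : ESpace →L[ℝ] ellOne) (S : ellOne →L[ℝ] ellInfty), W = S.comp R} := by
  refine Metric.mem_closure_iff.2 fun ε hε => ?_
  obtain ⟨N₀, hN₀⟩ := h (ε / 2) (half_pos hε)
  choose ν hν0 hν₀ hν using hN₀
  set N := max N₀ 1
  have hN : 0 < N := lt_max_of_lt_right one_pos
  have hνN (n) : ∑ i, ν n i ≤ N := (hν₀ n).trans (le_max_left _ _)
  let f (n : ℕ) (i : Fin (n + 1)) (k : ℕ) : ℝ := T (block n (Pi.single i 1)) k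
  let t (n : ℕ) (i : Fin (n + 1)) (k : ℕ) : ℝ := max (-ν n i) (min (f n i k) (ν n i))
  have ht (n i k) : |t n i k| ≤ ν n i :=
    abs_le.2 ⟨le_max_left _ _, max_le (by linarith [hν0 n i]) (min_le_right _ _)⟩
  have hft (n i k) : |f n i k - t n i k| ≤ max (|f n i k| - ν n i) 0 := by
    simp only [t]
    have h0 := hν0 n i
    rcases le_total (f n i k) (ν n i) with h1 | h1
    · rw [min_eq_left h1]
      rcases le_total (-ν n i) (f n i k) with h2 | h2
      · rw [max_eq_right h2, sub_self, abs_zero]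
        exact le_max_right _ _
      · rw [max_eq_left h2, abs_of_nonpos (by linarith), abs_of_nonpos (by linarith)]
        exact le_max_of_le_left (by linarith)
    · rw [min_eq_right h1, max_eq_right (by linarith), abs_of_nonneg (by linarith),
        abs_of_nonneg (by linarith)]
      exact le_max_left _ _
  have hsN (n i k) : |N * (t n i k / ν n i)| ≤ N := by
    rw [abs_mul, abs_of_pos hN, abs_div, abs_of_nonneg (hν0 n i)]
    exact mul_le_of_le_one_right hN.le (div_le_one_of_le₀ (ht n i k) (hν0 n i))
  let s (n : ℕ) (i : Fin (n + 1)) : ellInfty :=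
    ⟨fun k => N * (t n i k / ν n i), memℓp_infty ⟨N, by rintro _ ⟨k, rfl⟩; exact hsN n i k⟩⟩
  have hs (n i) : ‖s n i‖ ≤ N := lp.norm_le_of_forall_le hN.le (hsN n i)
  let s' (j : ℕ) : ellInfty :=
    if hj : j.unpair.2 < j.unpair.1 + 1 then s j.unpair.1 ⟨j.unpair.2, hj⟩ else 0
  have hs' (j) : ‖s' j‖ ≤ N := by
    simp only [s']
    split_ifs
    · exact hs _ _
    · simpa using hN.le
  have hs'pair (n) (i : Fin (n + 1)) : s' (Nat.pair n i) = s n i := by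
    have key : ∀ j : ℕ, ∀ n' i', j = n' → ∀ (hi : (i' : ℕ) < j + 1) (hi' : i' < n' + 1),
        s j ⟨i', hi⟩ = s n' ⟨i', hi'⟩ := by
      rintro j n' i' rfl _ _
      rfl
    have h2 : (Nat.pair n i).unpair.2 = i := by rw [Nat.unpair_pair]
    have h1 : (Nat.pair n i).unpair.1 = n := by rw [Nat.unpair_pair]
    simp only [s', h2]
    rw [dif_pos (by rw [h1]; exact i.2)]
    exact key _ _ _ h1 _ i.2
  obtain ⟨S, -, hS⟩ := exists_lift (V := fun _ : ℕ => ℝ) (Y := ellInfty)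
    (fun j => LinearMap.toSpanSingleton ℝ ellInfty (s' j)) hN.le fun j c => by
      rw [LinearMap.toSpanSingleton_apply, norm_smul, mul_comm]
      gcongr
      exact hs' j
  obtain ⟨R, -, hR⟩ := exists_lift (V := fun n : ℕ => PiLp ⊤ (fun _ : Fin (n + 1) => ℝ))
    (Y := ellOne)
    (fun n =>
      { toFun := fun v => ∑ i, (v i * (ν n i / N)) • (lp.single 1 (Nat.pair n i) 1 : ellOne)
        map_add' := fun v w => by simp [add_mul, add_smul, Finset.sum_add_distrib]
        map_smul' := fun c v => by simp [mul_assoc, mul_smul, Finset.smul_sum] })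
    zero_le_one fun n v => by
      change ‖∑ i, (v i * (ν n i / N)) • (lp.single 1 (Nat.pair n i) 1 : ellOne)‖ ≤ _
      calc _ ≤ ∑ i, ‖v‖ * (ν n i / N) := norm_sum_le_of_le _ fun i _ => by
            rw [norm_smul, lp.norm_single (by simp), norm_one, mul_one, norm_mul,
              Real.norm_of_nonneg (div_nonneg (hν0 n i) hN.le)]
            exact mul_le_mul_of_nonneg_right (PiLp.norm_apply_le v i)
              (div_nonneg (hν0 n i) hN.le)
        _ ≤ 1 * ‖v‖ := by
            rw [← Finset.mul_sum, ← Finset.sum_div, mul_comm]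
            gcongr
            exact div_le_one_of_le₀ (hνN n) hN.le
  refine ⟨S.comp R, ⟨R, S, rfl⟩, ?_⟩
  rw [dist_eq_norm]
  refine lt_of_le_of_lt (opNorm_le_of_single _ (half_pos hε).le fun n v => ?_) (half_lt_self hε)
  refine lp.norm_le_of_forall_le (by positivity) fun k => ?_
  have hT : T (lp.single 1 n v) k = ∑ i, v i * f n i k := by
    have : (lp.single 1 n v : ESpace) = block n v.ofLp := rfl
    rw [this, block_eq_sum, map_sum, lp.coeFn_sum, Finset.sum_apply]
    exact Finset.sum_congr rfl fun i _ => by rw [map_smul]; rfl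
  have hSR : S (R (lp.single 1 n v)) k = ∑ i, v i * t n i k := by
    rw [hR]
    change S (∑ i, (v i * (ν n i / N)) • (lp.single 1 (Nat.pair n i) 1 : ellOne)) k = _
    rw [map_sum, lp.coeFn_sum, Finset.sum_apply]
    refine Finset.sum_congr rfl fun i _ => ?_
    rw [map_smul, hS, LinearMap.toSpanSingleton_apply, one_smul, hs'pair]
    change v i * (ν n i / N) * (N * (t n i k / ν n i)) = _
    rcases eq_or_ne (ν n i) 0 with h0 | h0
    · have h1 := ht n i k
      rw [h0] at h1
      rw [abs_nonpos_iff.1 h1, h0]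
      simp
    · field_simp
  change ‖T (lp.single 1 n v) k - S (R (lp.single 1 n v)) k‖ ≤ _
  rw [hT, hSR, ← Finset.sum_sub_distrib]
  calc _ ≤ ∑ i, ‖v‖ * max (|f n i k| - ν n i) 0 := norm_sum_le_of_le _ fun i _ => by
        rw [← mul_sub, norm_mul]
        exact mul_le_mul (PiLp.norm_apply_le v i) (hft n i k) (norm_nonneg _) (norm_nonneg _)
    _ ≤ ε / 2 * ‖v‖ := by
        rw [← Finset.mul_sum, mul_comm]
        gcongr
        exact hν n k

theorem sum_powerset_sq {ι : Type*} [DecidableEq ι] (s : Finset ι) (a : ι → ℝ) (x : ℝ) :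
    ∑ t ∈ s.powerset, (x + 2 * ∑ i ∈ t, a i - ∑ i ∈ s, a i) ^ 2 =
      2 ^ s.card * (x ^ 2 + ∑ i ∈ s, a i ^ 2) := by
  induction s using Finset.induction_on generalizing x with
  | empty => simp
  | insert b s hb ih =>
    have h1 : ∑ t ∈ s.powerset, (x + 2 * ∑ i ∈ insert b t, a i - (a b + ∑ i ∈ s, a i)) ^ 2 =
        ∑ t ∈ s.powerset, (x + a b + 2 * ∑ i ∈ t, a i - ∑ i ∈ s, a i) ^ 2 := by
      refine Finset.sum_congr rfl fun t ht => ?_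
      rw [Finset.sum_insert fun h => hb (Finset.mem_powerset.1 ht h)]
      ring
    have h2 : ∑ t ∈ s.powerset, (x + 2 * ∑ i ∈ t, a i - (a b + ∑ i ∈ s, a i)) ^ 2 =
        ∑ t ∈ s.powerset, (x - a b + 2 * ∑ i ∈ t, a i - ∑ i ∈ s, a i) ^ 2 :=
      Finset.sum_congr rfl fun t ht => by ring
    rw [Finset.sum_powerset_insert hb, Finset.sum_insert hb, Finset.sum_insert hb,
      Finset.card_insert_of_notMem hb, h1, h2, ih, ih]
    ring

theorem sum_powerset_pow_four_le {ι : Type*} [DecidableEq ι] (s : Finset ι) (a : ι → ℝ) (x : ℝ) :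
    ∑ t ∈ s.powerset, (x + 2 * ∑ i ∈ t, a i - ∑ i ∈ s, a i) ^ 4 ≤
      2 ^ s.card * (x ^ 4 + 6 * x ^ 2 * ∑ i ∈ s, a i ^ 2 + 3 * (∑ i ∈ s, a i ^ 2) ^ 2) := by
  induction s using Finset.induction_on generalizing x with
  | empty => simp
  | insert b s hb ih =>
    have h1 : ∑ t ∈ s.powerset, (x + 2 * ∑ i ∈ insert b t, a i - (a b + ∑ i ∈ s, a i)) ^ 4 =
        ∑ t ∈ s.powerset, (x + a b + 2 * ∑ i ∈ t, a i - ∑ i ∈ s, a i) ^ 4 := by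
      refine Finset.sum_congr rfl fun t ht => ?_
      rw [Finset.sum_insert fun h => hb (Finset.mem_powerset.1 ht h)]
      ring
    have h2 : ∑ t ∈ s.powerset, (x + 2 * ∑ i ∈ t, a i - (a b + ∑ i ∈ s, a i)) ^ 4 =
        ∑ t ∈ s.powerset, (x - a b + 2 * ∑ i ∈ t, a i - ∑ i ∈ s, a i) ^ 4 :=
      Finset.sum_congr rfl fun t ht => by ring
    rw [Finset.sum_powerset_insert hb, Finset.sum_insert hb, Finset.sum_insert hb,
      Finset.card_insert_of_notMem hb, h1, h2]
    refine (add_le_add (ih _) (ih _)).trans ?_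
    have h3 : 0 ≤ (2 : ℝ) ^ s.card * (4 * a b ^ 4) := by positivity
    rw [pow_succ (2 : ℝ)]
    linarith

/-- A weak form of Khintchine's inequality: the average of `|∑ ± aᵢ|` over all choices of signs
is at least `(4 √n)⁻¹ ∑ |aᵢ|`. -/
theorem sum_abs_le_sum_powerset {ι : Type*} [DecidableEq ι] (s : Finset ι) (a : ι → ℝ) :
    2 ^ s.card * ∑ i ∈ s, |a i| ≤
      4 * √s.card * ∑ t ∈ s.powerset, |2 * ∑ i ∈ t, a i - ∑ i ∈ s, a i| := by
  have hσ0 : 0 ≤ ∑ i ∈ s, a i ^ 2 := Finset.sum_nonneg fun _ _ => sq_nonneg _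
  obtain ⟨σ, hσ, hσ2⟩ : ∃ σ : ℝ, 0 ≤ σ ∧ σ ^ 2 = ∑ i ∈ s, a i ^ 2 :=
    ⟨_, Real.sqrt_nonneg _, Real.sq_sqrt hσ0⟩
  have hcs : ∑ i ∈ s, |a i| ≤ √s.card * σ := by
    refine abs_le_of_sq_le_sq' ?_ (by positivity) |>.2
    rw [mul_pow, Real.sq_sqrt (by positivity), hσ2]
    simpa only [sq_abs] using sq_sum_le_card_mul_sum_sq (s := s) (f := fun i => |a i|)
  have hkh : 2 ^ s.card * σ ≤ 4 * ∑ t ∈ s.powerset, |2 * ∑ i ∈ t, a i - ∑ i ∈ s, a i| := by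
    rcases hσ.eq_or_lt with h0 | hpos
    · rw [← h0, mul_zero]
      exact mul_nonneg (by norm_num) (Finset.sum_nonneg fun _ _ => abs_nonneg _)
    have hpt (y : ℝ) : 4 * σ ^ 2 * y ^ 2 - y ^ 4 ≤ 4 * σ ^ 3 * |y| := by
      have h1 : 4 * σ ^ 2 * |y| ^ 2 - |y| ^ 4 ≤ 4 * σ ^ 3 * |y| := by
        have hy := abs_nonneg y
        generalize |y| = z at hy
        have h2 : 0 ≤ (z - 6 / 5 * σ) ^ 2 * (z + 12 / 5 * σ) := by positivity
        have h3 : 0 ≤ σ ^ 2 * z := by positivity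
        have h4 : 0 ≤ σ ^ 3 := by positivity
        have h5 : 0 ≤ 4 * σ ^ 3 - 4 * σ ^ 2 * z + z ^ 3 := by nlinarith
        nlinarith [mul_nonneg hy h5]
      rwa [sq_abs, show |y| ^ 4 = y ^ 4 from (even_two_mul 2).pow_abs y] at h1
    have hsq := sum_powerset_sq s a 0
    have hfour := sum_powerset_pow_four_le s a 0
    simp only [zero_add, ← hσ2] at hsq hfour
    have hsum := Finset.sum_le_sum fun t (_ : t ∈ s.powerset) =>
      hpt (2 * ∑ i ∈ t, a i - ∑ i ∈ s, a i)
    rw [Finset.sum_sub_distrib, ← Finset.mul_sum, ← Finset.mul_sum, hsq] at hsum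
    have h6 : σ ^ 3 * (2 ^ s.card * σ) ≤
        σ ^ 3 * (4 * ∑ t ∈ s.powerset, |2 * ∑ i ∈ t, a i - ∑ i ∈ s, a i|) := by
      nlinarith
    exact le_of_mul_le_mul_left h6 (by positivity)
  calc 2 ^ s.card * ∑ i ∈ s, |a i| ≤ 2 ^ s.card * (√s.card * σ) := by gcongr
    _ = √s.card * (2 ^ s.card * σ) := by ring
    _ ≤ √s.card * (4 * ∑ t ∈ s.powerset, |2 * ∑ i ∈ t, a i - ∑ i ∈ s, a i|) := by gcongr
    _ = _ := by ring

theorem sum_norm_le_sum_powerset {ι : Type*} [DecidableEq ι] (s : Finset ι) (y : ι → ellOne) :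
    2 ^ s.card * ∑ i ∈ s, ‖y i‖ ≤
      4 * √s.card * ∑ t ∈ s.powerset, ‖(2 : ℝ) • ∑ i ∈ t, y i - ∑ i ∈ s, y i‖ := by
  refine hasSum_le (fun k => ?_)
    ((hasSum_sum fun i (_ : i ∈ s) => hasSum_norm_one (y i)).mul_left _)
    ((hasSum_sum fun t (_ : t ∈ s.powerset) =>
      hasSum_norm_one ((2 : ℝ) • ∑ i ∈ t, y i - ∑ i ∈ s, y i)).mul_left _)
  have h (t : Finset ι) : ((2 : ℝ) • ∑ i ∈ t, y i - ∑ i ∈ s, y i) k =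
      2 * ∑ i ∈ t, y i k - ∑ i ∈ s, y i k := by
    rw [lp.coeFn_sub, lp.coeFn_smul, lp.coeFn_sum, lp.coeFn_sum]
    simp
  simpa only [h, Real.norm_eq_abs] using sum_abs_le_sum_powerset s (fun i => y i k)

/-- `E` does not embed into `ℓ¹`. -/
theorem not_bounded_below_ellOne (R : ESpace →L[ℝ] ellOne) {c : ℝ} (hc : 0 < c)
    (hR : ∀ x, c * ‖x‖ ≤ ‖R x‖) : False := by
  obtain ⟨n, hn⟩ := exists_nat_gt ((4 * ‖R‖ / c) ^ 2)
  set y : Fin (n + 1) → ellOne := fun i => R (block n (Pi.single i 1)) with hy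
  have hlow : (n + 1) * c ≤ ∑ i, ‖y i‖ := by
    have := Finset.card_nsmul_le_sum Finset.univ (fun i => ‖y i‖) c fun i _ => by
      simpa [norm_block, Pi.norm_single] using hR (block n (Pi.single i 1))
    simpa using this
  have hup (t : Finset (Fin (n + 1))) : ‖(2 : ℝ) • ∑ i ∈ t, y i - ∑ i, y i‖ ≤ ‖R‖ := by
    set ε : Fin (n + 1) → ℝ := fun i => if i ∈ t then 1 else -1 with hεdef
    have h1 : (2 : ℝ) • ∑ i ∈ t, y i - ∑ i, y i = R (block n ε) := by
      rw [block_eq_sum, map_sum, Finset.smul_sum,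
        ← Finset.sum_filter_add_sum_filter_not Finset.univ (· ∈ t) y,
        ← Finset.sum_filter_add_sum_filter_not Finset.univ (· ∈ t) (fun i => R _)]
      rw [Finset.filter_univ_mem, sub_add_eq_sub_sub, ← Finset.sum_sub_distrib, sub_eq_add_neg,
        ← Finset.sum_neg_distrib]
      congr 1
      · refine Finset.sum_congr rfl fun i hi => ?_
        simp [hεdef, hi, hy, two_smul]
      · refine Finset.sum_congr rfl fun i hi => ?_
        simp [hεdef, (Finset.mem_filter.1 hi).2, hy]
    have h2 : ‖ε‖ ≤ 1 := (pi_norm_le_iff_of_nonneg zero_le_one).2 fun i => by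
      simp only [hεdef]
      split_ifs <;> simp
    rw [h1]
    refine (R.le_opNorm _).trans ?_
    rw [norm_block]
    exact mul_le_of_le_one_right (norm_nonneg R) h2
  have hmain := sum_norm_le_sum_powerset Finset.univ y
  have hsum : ∑ t ∈ (Finset.univ : Finset (Fin (n + 1))).powerset,
      ‖(2 : ℝ) • ∑ i ∈ t, y i - ∑ i, y i‖ ≤ 2 ^ (n + 1) * ‖R‖ := by
    refine (Finset.sum_le_card_nsmul _ _ ‖R‖ fun t _ => hup t).trans ?_
    simp
  rw [Finset.card_univ, Fintype.card_fin] at hmain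
  set w := √((n + 1 : ℕ) : ℝ) with hw
  have hw2 : w ^ 2 = n + 1 := by
    rw [hw, Real.sq_sqrt (by positivity)]
    push_cast
    rfl
  have hw0 : 0 < w := Real.sqrt_pos.2 (by positivity)
  have h3 : (2 : ℝ) ^ (n + 1) * w * (w * c) ≤ 2 ^ (n + 1) * w * (4 * ‖R‖) := by
    calc (2 : ℝ) ^ (n + 1) * w * (w * c) = 2 ^ (n + 1) * ((n + 1) * c) := by
          rw [← hw2]; ring
      _ ≤ 2 ^ (n + 1) * ∑ i, ‖y i‖ := by gcongr
      _ ≤ _ := hmain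
      _ ≤ 4 * w * (2 ^ (n + 1) * ‖R‖) := by gcongr
      _ = _ := by ring
  have h4 : w * c ≤ 4 * ‖R‖ := le_of_mul_le_mul_left h3 (by positivity)
  have h5 : w ≤ 4 * ‖R‖ / c := (le_div_iff₀ hc).2 h4
  have h6 : w ^ 2 ≤ (4 * ‖R‖ / c) ^ 2 := by gcongr
  linarith

/-- The operators which factor through `ℓ¹`. -/
def factorSet (X Y : Type*) [NormedAddCommGroup X] [NormedSpace ℝ X] [NormedAddCommGroup Y]
    [NormedSpace ℝ Y] : Set (X →L[ℝ] Y) :=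
  {W | ∃ (R : X →L[ℝ] ellOne) (S : ellOne →L[ℝ] Y), W = S.comp R}

/-- The `n`-th unit vector of `ℓ¹`. -/
def unitVec (n : ℕ) : ellOne := lp.single 1 n (1 : ℝ)

theorem single_eq_smul_unitVec (n : ℕ) (v : ℝ) :
    (lp.single 1 n v : ellOne) = v • unitVec n := by
  rw [unitVec, ← lp.single_smul, smul_eq_mul, mul_one]

theorem norm_unitVec (n : ℕ) : ‖unitVec n‖ = 1 := by
  rw [unitVec, lp.norm_single (by simp), norm_one]

theorem exists_map_unitVec (y : ℕ → ellOne) (hy : ∀ n, ‖y n‖ ≤ 1) :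
    ∃ F : ellOne →L[ℝ] ellOne, ∀ n, F (unitVec n) = y n := by
  obtain ⟨F, -, hF⟩ := exists_lift (V := fun _ : ℕ => ℝ) (Y := ellOne)
    (fun n => LinearMap.toSpanSingleton ℝ ellOne (y n)) zero_le_one fun n v => by
      rw [LinearMap.toSpanSingleton_apply, norm_smul, one_mul]
      exact mul_le_of_le_one_right (norm_nonneg v) (hy n)
  refine ⟨F, fun n => ?_⟩
  rw [unitVec, hF, LinearMap.toSpanSingleton_apply, one_smul]

theorem ellOne_hom_ext {F G : ellOne →L[ℝ] ellOne} (h : ∀ n, F (unitVec n) = G (unitVec n)) :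
    F = G := by
  rw [← sub_eq_zero, ← norm_le_zero_iff]
  refine opNorm_le_of_single _ le_rfl fun n v => ?_
  rw [single_eq_smul_unitVec, map_smul, sub_apply, h, sub_self, smul_zero,
    norm_zero, zero_mul]

/-- `ℓ¹` is isomorphic to its square. -/
theorem exists_ellOne_square : ∃ J₁ J₂ P₁ P₂ : ellOne →L[ℝ] ellOne,
    P₁.comp J₁ = .id ℝ ellOne ∧ P₂.comp J₂ = .id ℝ ellOne ∧ P₁.comp J₂ = 0 ∧ P₂.comp J₁ = 0 := by
  have hP (b n : ℕ) : ‖if n % 2 = b then unitVec (n / 2) else 0‖ ≤ 1 := by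
    split_ifs
    · exact (norm_unitVec _).le
    · rw [norm_zero]
      exact zero_le_one
  obtain ⟨J₁, hJ₁⟩ := exists_map_unitVec (fun n => unitVec (2 * n)) fun n => (norm_unitVec _).le
  obtain ⟨J₂, hJ₂⟩ := exists_map_unitVec (fun n => unitVec (2 * n + 1))
    fun n => (norm_unitVec _).le
  obtain ⟨P₁, hP₁⟩ := exists_map_unitVec _ (hP 0)
  obtain ⟨P₂, hP₂⟩ := exists_map_unitVec _ (hP 1)
  refine ⟨J₁, J₂, P₁, P₂, ellOne_hom_ext fun n => ?_, ellOne_hom_ext fun n => ?_,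
    ellOne_hom_ext fun n => ?_, ellOne_hom_ext fun n => ?_⟩
  · rw [ContinuousLinearMap.comp_apply, hJ₁, hP₁, if_pos (by omega),
      show 2 * n / 2 = n by omega, ContinuousLinearMap.id_apply]
  · rw [ContinuousLinearMap.comp_apply, hJ₂, hP₂, if_pos (by omega),
      show (2 * n + 1) / 2 = n by omega, ContinuousLinearMap.id_apply]
  · rw [ContinuousLinearMap.comp_apply, hJ₂, hP₁, if_neg (by omega),
      zero_apply]
  · rw [ContinuousLinearMap.comp_apply, hJ₁, hP₂, if_neg (by omega),
      zero_apply]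

section Ideal

variable {X Y Z : Type*} [NormedAddCommGroup X] [NormedSpace ℝ X] [NormedAddCommGroup Y]
  [NormedSpace ℝ Y] [NormedAddCommGroup Z] [NormedSpace ℝ Z]

theorem zero_mem_factorSet : (0 : X →L[ℝ] Y) ∈ factorSet X Y :=
  ⟨0, 0, by simp⟩

theorem add_mem_factorSet {V W : X →L[ℝ] Y} (hV : V ∈ factorSet X Y) (hW : W ∈ factorSet X Y) :
    V + W ∈ factorSet X Y := by
  obtain ⟨R₁, S₁, rfl⟩ := hV
  obtain ⟨R₂, S₂, rfl⟩ := hW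
  obtain ⟨J₁, J₂, P₁, P₂, h₁₁, h₂₂, h₁₂, h₂₁⟩ := exists_ellOne_square
  have e₁₁ (x) : P₁ (J₁ x) = x := DFunLike.congr_fun h₁₁ x
  have e₂₂ (x) : P₂ (J₂ x) = x := DFunLike.congr_fun h₂₂ x
  have e₁₂ (x) : P₁ (J₂ x) = 0 := DFunLike.congr_fun h₁₂ x
  have e₂₁ (x) : P₂ (J₁ x) = 0 := DFunLike.congr_fun h₂₁ x
  refine ⟨J₁.comp R₁ + J₂.comp R₂, S₁.comp P₁ + S₂.comp P₂, ?_⟩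
  ext x
  simp [e₁₁, e₂₂, e₁₂, e₂₁]

theorem add_mem_closure_factorSet {V W : X →L[ℝ] Y} (hV : V ∈ closure (factorSet X Y))
    (hW : W ∈ closure (factorSet X Y)) : V + W ∈ closure (factorSet X Y) :=
  map_mem_closure₂ continuous_add hV hW fun _ ha _ hb => add_mem_factorSet ha hb

theorem neg_mem_closure_factorSet {W : X →L[ℝ] Y} (hW : W ∈ closure (factorSet X Y)) :
    -W ∈ closure (factorSet X Y) :=
  map_mem_closure continuous_neg hW fun _ ⟨R, S, h⟩ => ⟨R, -S, by rw [h]; rfl⟩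

theorem comp_mem_closure_factorSet_left (U : Y →L[ℝ] Z) {W : X →L[ℝ] Y}
    (hW : W ∈ closure (factorSet X Y)) : U.comp W ∈ closure (factorSet X Z) :=
  map_mem_closure (f := fun W : X →L[ℝ] Y => U.comp W)
    (continuous_const.clm_comp continuous_id) hW
    fun _ ⟨R, S, h⟩ => ⟨R, U.comp S, by rw [h]; rfl⟩

theorem comp_mem_closure_factorSet_right (U : X →L[ℝ] Y) {W : Y →L[ℝ] Z}
    (hW : W ∈ closure (factorSet Y Z)) : W.comp U ∈ closure (factorSet X Z) :=
  map_mem_closure (f := fun W : Y →L[ℝ] Z => W.comp U)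
    (continuous_id.clm_comp continuous_const) hW
    fun _ ⟨R, S, h⟩ => ⟨R.comp U, S, by rw [h]; rfl⟩

/-- Membership in `GiEllOne` may be tested on any isomorphic embedding into `ℓ∞`. -/
theorem mem_GiEllOne_iff {θ : X →L[ℝ] ellInfty} {c : ℝ} (hc : 0 < c)
    (hθ : ∀ x, c * ‖x‖ ≤ ‖θ x‖) {T : X →L[ℝ] X} :
    T ∈ GiEllOne X ↔ θ.comp T ∈ closure (factorSet X ellInfty) := by
  refine ⟨fun ⟨ψ, ⟨d, hd, hψ⟩, hT⟩ => ?_, fun hT => ⟨θ, ⟨c, hc, hθ⟩, hT⟩⟩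
  obtain ⟨U, rfl⟩ := exists_extension ψ hd hψ θ
  exact comp_mem_closure_factorSet_left U hT

theorem isClosed_GiEllOne {θ : X →L[ℝ] ellInfty} {c : ℝ} (hc : 0 < c)
    (hθ : ∀ x, c * ‖x‖ ≤ ‖θ x‖) : IsClosed (GiEllOne X) := by
  have h : GiEllOne X = (fun T : X →L[ℝ] X => θ.comp T) ⁻¹' closure (factorSet X ellInfty) :=
    Set.ext fun T => mem_GiEllOne_iff hc hθ
  rw [h]
  exact isClosed_closure.preimage (continuous_const.clm_comp continuous_id)

theorem exists_twoSidedIdeal_coe_eq {θ : X →L[ℝ] ellInfty} {c : ℝ} (hc : 0 < c)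
    (hθ : ∀ x, c * ‖x‖ ≤ ‖θ x‖) :
    ∃ I : TwoSidedIdeal (X →L[ℝ] X), (I : Set (X →L[ℝ] X)) = GiEllOne X := by
  have hiff {T : X →L[ℝ] X} := mem_GiEllOne_iff hc hθ (T := T)
  refine ⟨.mk' (GiEllOne X) ?_ ?_ ?_ ?_ ?_, TwoSidedIdeal.coe_mk' ..⟩
  · rw [hiff, ContinuousLinearMap.comp_zero]
    exact subset_closure zero_mem_factorSet
  · intro S T hS hT
    rw [hiff] at *
    rw [ContinuousLinearMap.comp_add]
    exact add_mem_closure_factorSet hS hT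
  · intro T hT
    rw [hiff] at *
    rw [ContinuousLinearMap.comp_neg]
    exact neg_mem_closure_factorSet hT
  · intro S T hT
    obtain ⟨U, hU⟩ := exists_extension θ hc hθ (θ.comp S)
    rw [hiff] at *
    change (θ.comp S).comp T ∈ _
    rw [← hU]
    exact comp_mem_closure_factorSet_left U hT
  · intro S T hS
    rw [hiff] at *
    exact comp_mem_closure_factorSet_right T hS

end Ideal

theorem one_notMem_GiEllOne : (1 : ESpace →L[ℝ] ESpace) ∉ GiEllOne ESpace := by
  rintro ⟨θ, ⟨c, hc, hθ⟩, h⟩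
  obtain ⟨_, ⟨R, S, rfl⟩, hS⟩ := Metric.mem_closure_iff.1 h (c / 2) (half_pos hc)
  rw [dist_eq_norm] at hS
  refine not_bounded_below_ellOne R (c := c / 2 / (‖S‖ + 1)) (by positivity) fun x => ?_
  have h1 : ‖θ x - S (R x)‖ ≤ c / 2 * ‖x‖ :=
    (θ.comp (1 : ESpace →L[ℝ] ESpace) - S.comp R).le_of_opNorm_le hS.le x
  have h2 := hθ x
  have h3 := norm_sub_norm_le (θ x) (S (R x))
  have h4 := S.le_opNorm (R x)
  have h5 := norm_nonneg (R x)
  rw [div_mul_eq_mul_div, div_le_iff₀ (by positivity)]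
  linarith

/-- The identity of `E` factors approximately through every operator outside `GiEllOne`. -/
theorem exists_norm_one_sub_lt_one_of_notMem {T : ESpace →L[ℝ] ESpace}
    (hT : T ∉ GiEllOne ESpace) : ∃ A B : ESpace →L[ℝ] ESpace, ‖1 - A * T * B‖ < 1 := by
  have := separableSpace_ellOneSum fun n : ℕ => PiLp ⊤ (fun _ : Fin (n + 1) => ℝ)
  obtain ⟨θ, hθ⟩ := exists_isometric_embedding ESpace
  rw [mem_GiEllOne_iff one_pos fun x => (one_mul ‖x‖).trans_le (hθ x).ge] at hT
  have hdom := mt (mem_closure_of_dominated (θ.comp T)) hT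
  push Not at hdom
  obtain ⟨ε, hε, hdom⟩ := hdom
  refine exists_norm_one_sub_lt_one T (C := 2 / ε) (by positivity) fun m r η hη => ?_
  refine exists_local_factorization T (fun k => (lp.evalCLM ℝ (fun _ : ℕ => ℝ) ⊤ k).comp θ)
    (fun k => ?_) hε hdom m r hη
  refine ContinuousLinearMap.opNorm_le_bound _ zero_le_one fun x => ?_
  rw [one_mul, ← hθ x]
  exact lp.norm_apply_le_norm (by simp) (θ x) k

end EllOneSum

/-- for `E = (⊕ₙ ℓ∞(n))_{ℓ¹}`, `G^i_{ℓ¹}(E)` is the unique maximal two-sided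
ideal of `L(E)`: it is a proper closed two-sided ideal, and every proper two-sided ideal of
`L(E)` is contained in it. -/
theorem stmt9 :
    IsClosed (GiEllOne ESpace) ∧ GiEllOne ESpace ≠ Set.univ ∧
      (∃ I : TwoSidedIdeal (ESpace →L[ℝ] ESpace),
        (I : Set (ESpace →L[ℝ] ESpace)) = GiEllOne ESpace) ∧
      ∀ J : TwoSidedIdeal (ESpace →L[ℝ] ESpace),
        (J : Set (ESpace →L[ℝ] ESpace)) ≠ Set.univ →
        (J : Set (ESpace →L[ℝ] ESpace)) ⊆ GiEllOne ESpace := by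
  have := EllOneSum.separableSpace_ellOneSum fun n : ℕ => PiLp ⊤ (fun _ : Fin (n + 1) => ℝ)
  obtain ⟨θ, hθ⟩ := EllOneSum.exists_isometric_embedding ESpace
  have hθ' (x) : 1 * ‖x‖ ≤ ‖θ x‖ := by rw [one_mul, hθ]
  refine ⟨EllOneSum.isClosed_GiEllOne one_pos hθ',
    (Set.ne_univ_iff_exists_notMem _).2 ⟨1, EllOneSum.one_notMem_GiEllOne⟩,
    EllOneSum.exists_twoSidedIdeal_coe_eq one_pos hθ', fun J hJ T hTJ => ?_⟩
  by_contra hT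
  obtain ⟨A, B, hAB⟩ := EllOneSum.exists_norm_one_sub_lt_one_of_notMem hT
  obtain ⟨V, hV⟩ := isUnit_one_sub_of_norm_lt_one hAB
  rw [sub_sub_cancel] at hV
  have hmem : (V : ESpace →L[ℝ] ESpace) ∈ J := by
    rw [hV]
    exact J.mul_mem_right _ _ (J.mul_mem_left _ _ hTJ)
  refine hJ (Set.eq_univ_of_forall fun W => ?_)
  have h := J.mul_mem_left (W * ↑V⁻¹) _ hmem
  rwa [mul_assoc, Units.inv_mul, mul_one] at h
end
end
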